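/- Let G be a balanced bipartite graph of order 2n with S ⊆ X, |S| ≥ 2k+1, such that every nonadjacent pair x ∈ S, y ∈ Y satisfies d(x)+d(y) ≥ n+1. Then G contains k disjoint feasible cycles such that either these k cycles cover all vertices of G, or each of the k cycles contains exactly two vertices of S. -/

import Mathlib

namespace FeasibleCycles

open Finset

set_option linter.unusedSectionVars false

/-- `c` runs periodically around a cycle of length `L`. -/
structure CycParam {V : Type*} (G : SimpleGraph V) (c : ℕ → V) (L : ℕ) : Prop where
  three_le : 3 ≤ L
  adj : ∀ i, G.Adj (c i) (c (i + 1))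
  per : ∀ i, c (i + L) = c i
  inj : ∀ i j, i < L → j < L → c i = c j → i = j

/-- `A` is the vertex set of a cycle. -/
def IsCyc {V : Type*} [DecidableEq V] (G : SimpleGraph V) (A : Finset V) : Prop :=
  ∃ L c, CycParam G c L ∧ A = (range L).image c

/-- `A` is the vertex set of a cycle with exactly two vertices in `S`. -/
def Two {V : Type*} [DecidableEq V] (G : SimpleGraph V) (S A : Finset V) : Prop :=
  IsCyc G A ∧ (S ∩ A).card = 2

/-- A family of disjoint cycles, each with exactly two vertices in `S`. -/
structure IsConf {V : Type*} [DecidableEq V] (G : SimpleGraph V) (S : Finset V) {r : ℕ}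
    (C : Fin r → Finset V) : Prop where
  disj : ∀ i j, i ≠ j → Disjoint (C i) (C j)
  two : ∀ i, Two G S (C i)

/-- A family of disjoint two-vertex cycles with minimal total length. -/
def IsMin {V : Type*} [DecidableEq V] (G : SimpleGraph V) (S : Finset V) {r : ℕ}
    (C : Fin r → Finset V) : Prop :=
  IsConf G S C ∧ ∀ C' : Fin r → Finset V, IsConf G S C' → ∑ i, (C i).card ≤ ∑ i, (C' i).card

/-- `v` lies on no member of the family. -/
def Free {V : Type*} {r : ℕ} (C : Fin r → Finset V) (v : V) : Prop := ∀ i, v ∉ C i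

/-- The conclusion of the main theorem in terms of vertex sets, with a bound on `S` in the covering
case that makes induction possible. -/
def Goal {V : Type*} [DecidableEq V] (G : SimpleGraph V) (S : Finset V) (k : ℕ) : Prop :=
  ∃ C : Fin k → Finset V, (∀ i j, i ≠ j → Disjoint (C i) (C j)) ∧ (∀ i, IsCyc G (C i)) ∧
    (∀ i, 2 ≤ (S ∩ C i).card) ∧ (((∀ u, ∃ i, u ∈ C i) ∧ S.card ≤ 2 * k + 1) ∨ ∀ i, (S ∩ C i).card = 2)

/-- The hypotheses of the main theorem together with the failure of its conclusion. -/
structure Ctx {V : Type*} [Fintype V] [DecidableEq V] (G : SimpleGraph V) [DecidableRel G.Adj]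
    (X Y S : Finset V) (n r : ℕ) : Prop where
  disj : Disjoint X Y
  cover : X ∪ Y = univ
  cardX : X.card = n
  cardY : Y.card = n
  bip : ∀ u v : V, G.Adj u v → (u ∈ X ∧ v ∈ Y) ∨ (u ∈ Y ∧ v ∈ X)
  sub : S ⊆ X
  cardS : 2 * r + 3 ≤ S.card
  deg : ∀ x ∈ S, ∀ y ∈ Y, ¬ G.Adj x y → n + 1 ≤ G.degree x + G.degree y
  nogoal : ¬ Goal G S (r + 1)

section Cycles

variable {V : Type*} [DecidableEq V] {G : SimpleGraph V}

theorem CycParam.mod {c : ℕ → V} {L : ℕ} (h : CycParam G c L) (i : ℕ) : c (i % L) = c i := by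
  have h2 : ∀ q i, c (i + L * q) = c i := by
    intro q
    induction q with
    | zero => simp
    | succ q ih => intro i; rw [Nat.mul_succ, ← add_assoc, h.per, ih]
  conv_rhs => rw [← Nat.mod_add_div i L]
  rw [h2]

theorem CycParam.eq_iff {c : ℕ → V} {L : ℕ} (h : CycParam G c L) (i j : ℕ) :
    c i = c j ↔ i % L = j % L := by
  have := h.three_le
  constructor
  · intro e
    rw [← h.mod i, ← h.mod j] at e
    exact h.inj _ _ (Nat.mod_lt _ (by omega)) (Nat.mod_lt _ (by omega)) e
  · intro e
    rw [← h.mod i, ← h.mod j, e]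

theorem CycParam.mem {c : ℕ → V} {L : ℕ} (h : CycParam G c L) (i : ℕ) :
    c i ∈ (range L).image c := by
  have := h.three_le
  rw [← h.mod i]
  exact mem_image_of_mem _ (by simpa using Nat.mod_lt _ (by omega))

theorem CycParam.card {c : ℕ → V} {L : ℕ} (h : CycParam G c L) :
    ((range L).image c).card = L := by
  rw [card_image_of_injOn, card_range]
  intro i hi j hj e
  exact h.inj i j (by simpa using hi) (by simpa using hj) e

theorem CycParam.shift {c : ℕ → V} {L : ℕ} (h : CycParam G c L) (t : ℕ) :
    CycParam G (fun i => c (i + t)) L where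
  three_le := h.three_le
  adj i := by have := h.adj (i + t); rwa [add_right_comm] at this
  per i := by have := h.per (i + t); rwa [add_right_comm] at this
  inj i j hi hj e := by
    rw [h.eq_iff] at e
    have : i ≡ j [MOD L] := Nat.ModEq.add_right_cancel' t e
    exact Nat.ModEq.eq_of_lt_of_lt this hi hj

theorem CycParam.image_shift {c : ℕ → V} {L : ℕ} (h : CycParam G c L) (t : ℕ) :
    (range L).image (fun i => c (i + t)) = (range L).image c := by
  apply Finset.eq_of_subset_of_card_le
  · intro v hv
    obtain ⟨i, _, rfl⟩ := mem_image.1 hv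
    exact h.mem _
  · rw [h.card, (h.shift t).card]

theorem isCyc_of_fun (L : ℕ) (f : ℕ → V) (hL : 3 ≤ L)
    (hadj : ∀ i, i + 1 < L → G.Adj (f i) (f (i + 1))) (hc : G.Adj (f (L - 1)) (f 0))
    (hinj : ∀ i j, i < L → j < L → f i = f j → i = j) :
    CycParam G (fun i => f (i % L)) L where
  three_le := hL
  adj i := by
    have hl := Nat.mod_lt i (show 0 < L by omega)
    have hm : (i + 1) % L = if i % L + 1 = L then 0 else i % L + 1 := by
      rw [← Nat.mod_add_mod]
      split_ifs with h
      · rw [h, Nat.mod_self]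
      · exact Nat.mod_eq_of_lt (by omega)
    simp only [hm]
    split_ifs with h
    · rw [show i % L = L - 1 by omega]; exact hc
    · exact hadj _ (by omega)
  per i := by simp
  inj i j hi hj e := by
    simp only [Nat.mod_eq_of_lt hi, Nat.mod_eq_of_lt hj] at e
    exact hinj i j hi hj e

theorem isCyc_image (L : ℕ) (f : ℕ → V) (hL : 3 ≤ L)
    (hadj : ∀ i, i + 1 < L → G.Adj (f i) (f (i + 1))) (hc : G.Adj (f (L - 1)) (f 0))
    (hinj : ∀ i j, i < L → j < L → f i = f j → i = j) :
    IsCyc G ((range L).image f) := by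
  refine ⟨L, _, isCyc_of_fun L f hL hadj hc hinj, ?_⟩
  apply image_congr
  intro i hi
  simp only [Nat.mod_eq_of_lt (by simpa using hi : i < L)]

theorem isCyc_four {a p b q : V} (h1 : G.Adj a p) (h2 : G.Adj b p) (h3 : G.Adj b q)
    (h4 : G.Adj a q) (hab : a ≠ b) (hpq : p ≠ q) : IsCyc G {a, b, p, q} := by
  have h := isCyc_image (G := G) 4 (fun i => [a, p, b, q].getD i a) (by norm_num)
    (by intro i hi
        have : i < 3 := by omega
        interval_cases i <;> simp [h1, h2.symm, h3])
    (by simp [h4.symm])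
    (by have := h1.ne; have := h2.ne; have := h3.ne; have := h4.ne
        intro i j hi hj
        interval_cases i <;> interval_cases j <;> simp_all [eq_comm])
  convert h using 1
  ext v
  simp [Finset.range_add_one]
  tauto

theorem isCyc_six {x₁ x₂ x₃ y₁ y₂ y₃ : V} (h11 : G.Adj x₁ y₁) (h21 : G.Adj x₂ y₁)
    (h22 : G.Adj x₂ y₂) (h32 : G.Adj x₃ y₂) (h33 : G.Adj x₃ y₃) (h13 : G.Adj x₁ y₃)
    (hd : [x₁, x₂, x₃, y₁, y₂, y₃].Nodup) : IsCyc G {x₁, x₂, x₃, y₁, y₂, y₃} := by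
  have h := isCyc_image (G := G) 6 (fun i => [x₁, y₁, x₂, y₂, x₃, y₃].getD i x₁) (by norm_num)
    (by intro i hi
        have : i < 5 := by omega
        interval_cases i <;> simp [h11, h21.symm, h22, h32.symm, h33])
    (by simp [h13.symm])
    (by simp only [List.nodup_cons, List.mem_cons, List.not_mem_nil, not_or] at hd
        intro i j hi hj
        interval_cases i <;> interval_cases j <;> simp_all [eq_comm])
  convert h using 1
  ext v
  simp [Finset.range_add_one]
  tauto

/-- An arc of a cycle closed up by one outside vertex. -/
theorem CycParam.ear_one {c : ℕ → V} {L : ℕ} (h : CycParam G c L) {i d : ℕ} (hd : d < L)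
    (hd1 : 1 ≤ d) {w : V} (hw : ∀ j, c j ≠ w) (h1 : G.Adj w (c i)) (h2 : G.Adj w (c (i + d))) :
    IsCyc G (insert w ((range (d + 1)).image fun j => c (i + j))) := by
  have hh := isCyc_image (G := G) (d + 2) (fun j => if j = d + 1 then w else c (i + j)) (by omega)
    (by intro j hj
        simp only [show j ≠ d + 1 by omega, if_false]
        split_ifs with e
        · rw [show j = d by omega]; exact h2.symm
        · exact h.adj _)
    (by simpa using h1)
    (by intro j k hj hk e
        split_ifs at e with e1 e2 e3
        · omega
        · exact absurd e.symm (hw _)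
        · exact absurd e (hw _)
        · rw [h.eq_iff] at e
          have e : j ≡ k [MOD L] := Nat.ModEq.add_left_cancel' i e
          exact Nat.ModEq.eq_of_lt_of_lt e (by omega) (by omega))
  convert hh using 1
  rw [show d + 2 = (d + 1) + 1 by rfl, Finset.range_add_one (n := d + 1), image_insert]
  simp only [if_true]
  congr 1
  apply image_congr
  intro j hj
  have : j < d + 1 := by simpa using hj
  simp [show j ≠ d + 1 by omega]

/-- An arc of a cycle closed up by two adjacent outside vertices. -/
theorem CycParam.ear_two {c : ℕ → V} {L : ℕ} (h : CycParam G c L) {i d : ℕ} (hd : d < L)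
    (hd1 : 1 ≤ d) {w w' : V} (hw : ∀ j, c j ≠ w) (hw' : ∀ j, c j ≠ w') (hww : G.Adj w w')
    (h1 : G.Adj w (c i)) (h2 : G.Adj w' (c (i + d))) :
    IsCyc G (insert w (insert w' ((range (d + 1)).image fun j => c (i + j)))) := by
  have hh := isCyc_image (G := G) (d + 3)
    (fun j => if j = d + 2 then w else if j = d + 1 then w' else c (i + j)) (by omega)
    (by intro j hj
        rcases (by omega : j = d + 1 ∨ j = d ∨ j < d) with e | e | e
        · simpa [e] using hww.symm
        · simpa [e] using h2.symm
        · simpa [show j ≠ d + 2 by omega, show j + 1 ≠ d + 2 by omega, show j ≠ d + 1 by omega,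
            show j ≠ d by omega, add_assoc] using h.adj (i + j))
    (by simpa using h1)
    (by have hne := hww.ne
        intro j k hj hk e
        split_ifs at e with e1 e2 e3 e4 e5 e6 e7
        · omega
        · exact absurd e hne
        · exact absurd e.symm (hw _)
        · exact absurd e.symm hne
        · omega
        · exact absurd e.symm (hw' _)
        · exact absurd e (hw _)
        · exact absurd e (hw' _)
        · rw [h.eq_iff] at e
          have e : j ≡ k [MOD L] := Nat.ModEq.add_left_cancel' i e
          exact Nat.ModEq.eq_of_lt_of_lt e (by omega) (by omega))
  convert hh using 1
  rw [show d + 3 = (d + 1) + 1 + 1 by rfl, Finset.range_add_one (n := d + 1 + 1),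
    Finset.range_add_one (n := d + 1), image_insert, image_insert]
  simp only [if_true, show d + 1 + 1 = d + 2 from rfl, show d + 1 ≠ d + 2 by omega, if_false]
  congr 2
  apply image_congr
  intro j hj
  have : j < d + 1 := by simpa using hj
  simp [show j ≠ d + 1 by omega, show j ≠ d + 2 by omega]

end Cycles

section Conf

variable {V : Type*} [DecidableEq V] {G : SimpleGraph V} {S : Finset V} {r : ℕ}
  {C : Fin r → Finset V}

theorem free_update {A : Finset V} {i : Fin r} (hd : ∀ i j, i ≠ j → Disjoint (C i) (C j)) {v : V} :
    Free (Function.update C i A) v ↔ v ∉ A ∧ (Free C v ∨ v ∈ C i) := by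
  constructor
  · intro h
    refine ⟨by simpa using h i, ?_⟩
    by_cases hv : v ∈ C i
    · exact Or.inr hv
    · left
      intro j
      by_cases e : j = i
      · rwa [e]
      · simpa [e] using h j
  · rintro ⟨h1, h2⟩ j
    by_cases e : j = i
    · subst e; simpa using h1
    · simp only [Function.update_of_ne e]
      rcases h2 with h2 | h2
      · exact h2 j
      · exact Finset.disjoint_left.1 (hd i j (Ne.symm e)) h2

theorem IsConf.update (h : IsConf G S C) {A : Finset V} {i : Fin r} (hA : Two G S A)
    (hs : ∀ v ∈ A, Free C v ∨ v ∈ C i) : IsConf G S (Function.update C i A) := by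
  have key : ∀ j, j ≠ i → Disjoint A (C j) := by
    intro j hj
    rw [Finset.disjoint_left]
    intro v hv
    rcases hs v hv with h2 | h2
    · exact h2 j
    · exact Finset.disjoint_left.1 (h.disj i j (Ne.symm hj)) h2
  constructor
  · intro j k hjk
    by_cases e : j = i
    · subst e
      simp only [Function.update_self, Function.update_of_ne (Ne.symm hjk)]
      exact key k (Ne.symm hjk)
    · by_cases e' : k = i
      · subst e'
        simp only [Function.update_self, Function.update_of_ne e]
        exact (key j e).symm
      · simp only [Function.update_of_ne e, Function.update_of_ne e']
        exact h.disj j k hjk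
  · intro j
    by_cases e : j = i
    · subst e; simpa using hA
    · simpa [e] using h.two j

theorem sum_card_update (A : Finset V) (i : Fin r) :
    ∑ j, (Function.update C i A j).card + (C i).card = ∑ j, (C j).card + A.card := by
  have h1 := Finset.add_sum_erase univ (fun j => (C j).card) (mem_univ i)
  have h2 := Finset.add_sum_erase univ (fun j => (Function.update C i A j).card) (mem_univ i)
  have h3 : ∑ j ∈ univ.erase i, (Function.update C i A j).card =
      ∑ j ∈ univ.erase i, (C j).card := by
    apply Finset.sum_congr rfl
    intro j hj
    rw [Function.update_of_ne (Finset.ne_of_mem_erase hj)]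
  simp only [Function.update_self] at h2
  omega

theorem IsMin.card_le (h : IsMin G S C) {A : Finset V} {i : Fin r} (hA : Two G S A)
    (hs : ∀ v ∈ A, Free C v ∨ v ∈ C i) : (C i).card ≤ A.card := by
  have h1 := h.2 _ (h.1.update hA hs)
  have h2 := sum_card_update (C := C) A i
  omega

theorem IsMin.update (h : IsMin G S C) {A : Finset V} {i : Fin r} (hA : Two G S A)
    (hs : ∀ v ∈ A, Free C v ∨ v ∈ C i) (hc : A.card ≤ (C i).card) :
    IsMin G S (Function.update C i A) := by
  refine ⟨h.1.update hA hs, fun C' hC' => ?_⟩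
  have h1 := h.2 _ hC'
  have h2 := sum_card_update (C := C) A i
  omega

theorem IsMin.free_update (h : IsMin G S C) {A : Finset V} {i : Fin r} {v : V} :
    Free (Function.update C i A) v ↔ v ∉ A ∧ (Free C v ∨ v ∈ C i) := FeasibleCycles.free_update h.1.disj

theorem IsConf.snoc (h : IsConf G S C) {A : Finset V} (hA : ∀ v ∈ A, Free C v) :
    ∀ i j : Fin (r + 1), i ≠ j → Disjoint (Fin.snoc (α := fun _ => Finset V) C A i)
      (Fin.snoc (α := fun _ => Finset V) C A j) := by
  have key : ∀ i, Disjoint (C i) A := by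
    intro i
    rw [Finset.disjoint_right]
    intro v hv
    exact hA v hv i
  intro i j
  refine Fin.lastCases ?_ (fun i => ?_) i <;> refine Fin.lastCases ?_ (fun j => ?_) j
  · intro h; exact absurd rfl h
  · intro _; simpa using (key j).symm
  · intro _; simpa using key i
  · intro hij
    simpa using h.disj i j (fun e => hij (by rw [e]))

end Conf

section Context

variable {V : Type*} [Fintype V] [DecidableEq V] {G : SimpleGraph V} [DecidableRel G.Adj]
  {X Y S : Finset V} {n r : ℕ} {C : Fin r → Finset V}

theorem Ctx.no_free_two (h : Ctx G X Y S n r) (hC : IsConf G S C) {A : Finset V}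
    (hA : Two G S A) (hf : ∀ v ∈ A, Free C v) : False := by
  apply h.nogoal
  have hall : ∀ i : Fin (r + 1), Two G S (Fin.snoc (α := fun _ => Finset V) C A i) := by
    intro i
    refine Fin.lastCases ?_ (fun i => ?_) i
    · simpa using hA
    · simpa using hC.two i
  exact ⟨_, hC.snoc hf, fun i => (hall i).1, fun i => (hall i).2.ge, Or.inr fun i => (hall i).2⟩

theorem Ctx.no_cover (h : Ctx G X Y S n r) (hC : IsConf G S C) {A : Finset V}
    (hA : IsCyc G A) (h2 : (S ∩ A).card = 3) (hf : ∀ v ∈ A, Free C v)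
    (hc : ∀ v, Free C v → v ∈ A) : False := by
  apply h.nogoal
  have hcov : ∀ u, (∃ i, u ∈ C i) ∨ u ∈ A := by
    intro u
    by_cases hu : Free C u
    · exact Or.inr (hc u hu)
    · simp only [Free, not_forall, not_not] at hu
      exact Or.inl hu
  refine ⟨_, hC.snoc hf, ?_, ?_, Or.inl ⟨?_, ?_⟩⟩
  · intro i
    refine Fin.lastCases ?_ (fun i => ?_) i
    · simpa using hA
    · simpa using (hC.two i).1
  · intro i
    refine Fin.lastCases ?_ (fun i => ?_) i
    · simp [h2]
    · simpa using (hC.two i).2.ge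
  · intro u
    rcases hcov u with ⟨i, hi⟩ | hu
    · exact ⟨i.castSucc, by simpa using hi⟩
    · exact ⟨Fin.last r, by simpa using hu⟩
  · have hsub : S ⊆ (univ.biUnion fun i => S ∩ C i) ∪ (S ∩ A) := by
      intro u hu
      rcases hcov u with ⟨i, hi⟩ | hA
      · exact mem_union_left _ (mem_biUnion.2 ⟨i, mem_univ i, mem_inter.2 ⟨hu, hi⟩⟩)
      · exact mem_union_right _ (mem_inter.2 ⟨hu, hA⟩)
    have h1 := (card_le_card hsub).trans (card_union_le _ _)
    have h3 : (univ.biUnion fun i => S ∩ C i).card ≤ ∑ i, (S ∩ C i).card := card_biUnion_le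
    have h4 : ∑ i, (S ∩ C i).card = r * 2 := by simp [(hC.two _).2]
    omega

end Context

/-- The number of neighbours of `v` in `A`. -/
def dg {V : Type*} (G : SimpleGraph V) [DecidableRel G.Adj] (v : V) (A : Finset V) : ℕ :=
  ∑ u ∈ A, if G.Adj v u then 1 else 0

/-- The vertices outside the family. -/
def rest {V : Type*} [Fintype V] [DecidableEq V] {r : ℕ} (C : Fin r → Finset V) : Finset V :=
  univ.filter fun v => ∀ i, v ∉ C i

section Rest

variable {V : Type*} [Fintype V] [DecidableEq V] {r : ℕ} {C : Fin r → Finset V}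

@[simp] theorem mem_rest {v : V} : v ∈ rest C ↔ Free C v := by simp [rest, Free]

theorem sum_split (hd : ∀ i j, i ≠ j → Disjoint (C i) (C j)) (f : V → ℕ) :
    ∑ v, f v = ∑ v ∈ rest C, f v + ∑ i, ∑ v ∈ C i, f v := by
  rw [← Finset.sum_biUnion (fun i _ j _ hij => hd i j hij),
    ← Finset.sum_union]
  · apply Finset.sum_congr _ (fun _ _ => rfl)
    ext v
    simp only [mem_univ, mem_union, mem_rest, mem_biUnion, true_and, true_iff, Free]
    by_cases h : ∃ a, v ∈ C a
    · exact Or.inr h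
    · left; simpa using h
  · rw [Finset.disjoint_left]
    intro v hv hv2
    simp only [mem_biUnion, mem_univ, true_and] at hv2
    obtain ⟨i, hi⟩ := hv2
    exact mem_rest.1 hv i hi

theorem card_split (hd : ∀ i j, i ≠ j → Disjoint (C i) (C j)) (A : Finset V) :
    A.card = (A ∩ rest C).card + ∑ i, (A ∩ C i).card := by
  have := sum_split hd (fun v => if v ∈ A then 1 else 0)
  simpa [Finset.sum_ite_mem, Finset.inter_comm] using this

end Rest

section Context

variable {V : Type*} [Fintype V] [DecidableEq V] {G : SimpleGraph V} [DecidableRel G.Adj]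
  {X Y S : Finset V} {n r : ℕ} {C : Fin r → Finset V}

theorem Ctx.not_mem_X (h : Ctx G X Y S n r) {v : V} : v ∉ X ↔ v ∈ Y := by
  constructor
  · intro hv
    have : v ∈ X ∪ Y := by rw [h.cover]; exact mem_univ v
    exact (mem_union.1 this).resolve_left hv
  · intro hv hx
    exact Finset.disjoint_left.1 h.disj hx hv

theorem Ctx.adj_X (h : Ctx G X Y S n r) {u v : V} (ha : G.Adj u v) (hu : u ∈ X) : v ∈ Y := by
  rcases h.bip u v ha with h1 | h1
  · exact h1.2
  · exact absurd hu (h.not_mem_X.2 h1.1)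

theorem Ctx.adj_Y (h : Ctx G X Y S n r) {u v : V} (ha : G.Adj u v) (hu : u ∈ Y) : v ∈ X := by
  rcases h.bip u v ha with h1 | h1
  · exact absurd h1.1 (h.not_mem_X.2 hu)
  · exact h1.2

theorem Ctx.ne (h : Ctx G X Y S n r) {u v : V} (hu : u ∈ X) (hv : v ∈ Y) : u ≠ v := by
  rintro rfl
  exact h.not_mem_X.2 hv hu

theorem Ctx.cyc_param (h : Ctx G X Y S n r) {A : Finset V} (hA : IsCyc G A) {a : V}
    (ha : a ∈ A) (haX : a ∈ X) : ∃ m c, 2 ≤ m ∧ CycParam G c (2 * m) ∧ c 0 = a ∧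
      A = (range (2 * m)).image c ∧ (∀ i, c (2 * i) ∈ X) ∧ ∀ i, c (2 * i + 1) ∈ Y := by
  obtain ⟨L, c, hc, rfl⟩ := hA
  obtain ⟨t, _, rfl⟩ := mem_image.1 ha
  have hpar : ∀ i, c (2 * i + t) ∈ X ∧ c (2 * i + 1 + t) ∈ Y := by
    intro i
    induction i with
    | zero =>
      refine ⟨by simpa using haX, ?_⟩
      have := h.adj_X (hc.adj t) haX
      rwa [add_comm t 1] at this
    | succ i ih =>
      have h1 := h.adj_Y (hc.adj _) ih.2
      rw [show 2 * i + 1 + t + 1 = 2 * (i + 1) + t by ring] at h1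
      refine ⟨h1, ?_⟩
      have h2 := h.adj_X (hc.adj _) h1
      rwa [show 2 * (i + 1) + t + 1 = 2 * (i + 1) + 1 + t by ring] at h2
  have hL := hc.three_le
  have hev : ∃ m, L = 2 * m := by
    rcases Nat.even_or_odd' L with ⟨m, e | e⟩
    · exact ⟨m, e⟩
    · exfalso
      have h1 := (hpar m).2
      rw [show 2 * m + 1 + t = t + L by omega, hc.per] at h1
      exact h.not_mem_X.2 h1 haX
  obtain ⟨m, rfl⟩ := hev
  exact ⟨m, fun i => c (i + t), by omega, hc.shift t, by simp, (hc.image_shift t).symm,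
    fun i => (hpar i).1, fun i => (hpar i).2⟩

theorem Ctx.exists_mem_X (h : Ctx G X Y S n r) {A : Finset V} (hA : IsCyc G A) :
    ∃ a ∈ A, a ∈ X := by
  obtain ⟨L, c, hc, rfl⟩ := hA
  by_cases h0 : c 0 ∈ X
  · exact ⟨_, hc.mem 0, h0⟩
  · exact ⟨_, hc.mem 1, h.adj_Y (hc.adj 0) (h.not_mem_X.1 h0)⟩

theorem sum_range_two_mul {M : Type*} [AddCommMonoid M] (f : ℕ → M) (m : ℕ) :
    ∑ i ∈ range (2 * m), f i = ∑ j ∈ range m, f (2 * j) + ∑ j ∈ range m, f (2 * j + 1) := by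
  induction m with
  | zero => simp
  | succ m ih =>
    rw [show 2 * (m + 1) = 2 * m + 1 + 1 by ring, sum_range_succ, sum_range_succ, ih,
      sum_range_succ, sum_range_succ]
    abel

theorem CycParam.sum_image {c : ℕ → V} {L : ℕ} (hc : CycParam G c L) (f : V → ℕ) :
    ∑ v ∈ (range L).image c, f v = ∑ i ∈ range L, f (c i) :=
  Finset.sum_image fun i hi j hj e => hc.inj i j (by simpa using hi) (by simpa using hj) e

theorem Ctx.card_cyc (h : Ctx G X Y S n r) {A : Finset V} (hA : IsCyc G A) :
    (X ∩ A).card = (Y ∩ A).card ∧ A.card = 2 * (Y ∩ A).card := by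
  obtain ⟨a, ha, haX⟩ := h.exists_mem_X hA
  obtain ⟨m, c, hm, hc, h0, rfl, hX, hY⟩ := h.cyc_param hA ha haX
  have h1 : ∀ B : Finset V, (B ∩ (range (2 * m)).image c).card =
      ∑ v ∈ (range (2 * m)).image c, if v ∈ B then 1 else 0 := by
    intro B
    simp [Finset.sum_ite_mem, Finset.inter_comm]
  have hx : (X ∩ (range (2 * m)).image c).card = m := by
    rw [h1, hc.sum_image, sum_range_two_mul]
    simp [hX, h.not_mem_X.2 (hY _)]
  have hy : (Y ∩ (range (2 * m)).image c).card = m := by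
    have hX' : ∀ i, c (2 * i) ∉ Y := fun i hi => h.not_mem_X.2 hi (hX i)
    rw [h1, hc.sum_image, sum_range_two_mul]
    simp [hY, hX']
  rw [hx, hy, hc.card]
  simp

theorem Ctx.card_rest (h : Ctx G X Y S n r) (hC : IsConf G S C) :
    (X ∩ rest C).card = (Y ∩ rest C).card ∧ 3 ≤ (S ∩ rest C).card ∧ 3 ≤ (Y ∩ rest C).card ∧
      n = (Y ∩ rest C).card + ∑ i, (Y ∩ C i).card := by
  have hx := card_split hC.disj X
  have hy := card_split hC.disj Y
  have hs := card_split hC.disj S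
  have e : ∑ i, (X ∩ C i).card = ∑ i, (Y ∩ C i).card :=
    Finset.sum_congr rfl fun i _ => (h.card_cyc (hC.two i).1).1
  have e2 : ∑ i, (S ∩ C i).card = 2 * r := by
    rw [Finset.sum_congr rfl fun i _ => (hC.two i).2]
    simp [mul_comm]
  have h1 := h.cardX
  have h2 := h.cardY
  have h3 := h.cardS
  have h4 : (S ∩ rest C).card ≤ (X ∩ rest C).card :=
    Finset.card_le_card (Finset.inter_subset_inter_right h.sub)
  refine ⟨by omega, by omega, by omega, by omega⟩

theorem degree_eq_dg (v : V) : G.degree v = dg G v univ := by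
  rw [dg, SimpleGraph.degree, SimpleGraph.neighborFinset_eq_filter, Finset.card_filter]

/-- Averaging: some member of the family receives many edges. -/
theorem Ctx.exists_heavy (h : Ctx G X Y S n r) (hC : IsConf G S C) {K : ℕ}
    (u w : Fin K → V) (hu : ∀ j, u j ∈ S) (hw : ∀ j, w j ∈ Y) (hn : ∀ j, ¬ G.Adj (u j) (w j))
    (hD : ∑ j, (dg G (u j) (rest C) + dg G (w j) (rest C)) + 1 ≤
      K * (Y ∩ rest C).card + K) :
    ∃ i, K * (Y ∩ C i).card + 1 ≤ ∑ j, (dg G (u j) (C i) + dg G (w j) (C i)) := by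
  by_contra! hcon
  have h1 : ∑ j : Fin K, (n + 1) ≤ ∑ j, (G.degree (u j) + G.degree (w j)) :=
    Finset.sum_le_sum fun j _ => h.deg _ (hu j) _ (hw j) (hn j)
  have h2 : ∑ j, (G.degree (u j) + G.degree (w j)) =
      ∑ j, (dg G (u j) (rest C) + dg G (w j) (rest C)) +
        ∑ i, ∑ j, (dg G (u j) (C i) + dg G (w j) (C i)) := by
    rw [Finset.sum_comm, ← Finset.sum_add_distrib]
    apply Finset.sum_congr rfl
    intro j _
    simp only [degree_eq_dg, dg]
    rw [sum_split hC.disj, sum_split hC.disj (fun v => if G.Adj (w j) v then 1 else 0),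
      Finset.sum_add_distrib]
    ring
  have h3 : ∑ i, ∑ j, (dg G (u j) (C i) + dg G (w j) (C i)) ≤ ∑ i, K * (Y ∩ C i).card :=
    Finset.sum_le_sum fun i _ => by have := hcon i; omega
  obtain ⟨-, -, -, h4⟩ := h.card_rest hC
  rw [← Finset.mul_sum] at h3
  simp only [sum_const, card_univ, Fintype.card_fin, smul_eq_mul] at h1
  have h5 : K * (n + 1) = K * (Y ∩ rest C).card + K * ∑ i, (Y ∩ C i).card + K := by
    conv_lhs => rw [h4]
    ring
  omega

theorem Ctx.sum_dg_rest_le (h : Ctx G X Y S n r) (hC : IsConf G S C) {K : ℕ}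
    (u w : Fin K → V) (hu : ∀ j, u j ∈ X) (hw : ∀ j, w j ∈ Y)
    (P Q : Finset V) (hP : ∀ v ∈ P, v ∈ X ∧ Free C v) (hQ : ∀ v ∈ Q, v ∈ Y ∧ Free C v)
    (A B : ℕ)
    (hx : ∀ x ∈ X, Free C x → x ∉ P → ∑ j, (if G.Adj x (w j) then 1 else 0) ≤ A)
    (hy : ∀ y ∈ Y, Free C y → y ∉ Q → ∑ j, (if G.Adj (u j) y then 1 else 0) ≤ B) :
    ∑ j, (dg G (u j) (rest C) + dg G (w j) (rest C)) + A * P.card + B * Q.card ≤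
      ∑ x ∈ P, ∑ j, (if G.Adj x (w j) then 1 else 0) +
      ∑ y ∈ Q, ∑ j, (if G.Adj (u j) y then 1 else 0) +
        A * (Y ∩ rest C).card + B * (Y ∩ rest C).card := by
  have key : ∀ (Z P : Finset V) (f : V → ℕ) (A : ℕ), (∀ v ∈ P, v ∈ Z ∧ Free C v) →
      (∀ x ∈ Z, Free C x → x ∉ P → f x ≤ A) →
      ∑ x ∈ Z ∩ rest C, f x + A * P.card ≤ ∑ x ∈ P, f x + A * (Z ∩ rest C).card := by
    intro Z P f A hP hf
    have hPs : P ⊆ Z ∩ rest C := fun v hv => by simpa using hP v hv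
    rw [← Finset.sum_sdiff hPs]
    have h1 : ∑ x ∈ (Z ∩ rest C) \ P, f x ≤ ((Z ∩ rest C) \ P).card * A := by
      apply Finset.sum_le_card_nsmul
      intro x hx
      simp only [mem_sdiff, mem_inter, mem_rest] at hx
      exact hf x hx.1.1 hx.1.2 hx.2
    have h2 := Finset.card_sdiff_add_card_eq_card hPs
    have h3 : ((Z ∩ rest C) \ P).card * A + A * P.card = A * (Z ∩ rest C).card := by
      rw [← h2]; ring
    omega
  have e1 : ∑ j, dg G (u j) (rest C) =
      ∑ y ∈ Y ∩ rest C, ∑ j, (if G.Adj (u j) y then 1 else 0) := by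
    rw [Finset.sum_comm]
    apply Finset.sum_congr rfl
    intro j _
    rw [dg]
    symm
    apply Finset.sum_subset Finset.inter_subset_right
    intro v hv hv2
    rw [if_neg]
    intro ha
    exact hv2 (mem_inter.2 ⟨h.adj_X ha (hu j), hv⟩)
  have e2 : ∑ j, dg G (w j) (rest C) =
      ∑ x ∈ X ∩ rest C, ∑ j, (if G.Adj x (w j) then 1 else 0) := by
    rw [Finset.sum_comm]
    apply Finset.sum_congr rfl
    intro j _
    rw [dg]
    symm
    simp only [G.adj_comm (w j)]
    apply Finset.sum_subset Finset.inter_subset_right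
    intro v hv hv2
    rw [if_neg]
    intro ha
    exact hv2 (mem_inter.2 ⟨h.adj_Y ha.symm (hw j), hv⟩)
  rw [Finset.sum_add_distrib, e1, e2]
  have k1 := key X P _ A hP hx
  have k2 := key Y Q _ B hQ hy
  obtain ⟨h4, -, -, -⟩ := h.card_rest hC
  rw [h4] at k1
  omega

theorem Ctx.exists_heavy_of_bound (h : Ctx G X Y S n r) (hC : IsConf G S C) {K : ℕ}
    (u w : Fin K → V) (hu : ∀ j, u j ∈ S) (hw : ∀ j, w j ∈ Y) (hn : ∀ j, ¬ G.Adj (u j) (w j))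
    (P Q : Finset V) (hP : ∀ v ∈ P, v ∈ X ∧ Free C v) (hQ : ∀ v ∈ Q, v ∈ Y ∧ Free C v)
    (A B E n₀ : ℕ) (hK' : A + B + E = K) (hn₀ : n₀ ≤ (Y ∩ rest C).card)
    (hx : ∀ x ∈ X, Free C x → x ∉ P → ∑ j, (if G.Adj x (w j) then 1 else 0) ≤ A)
    (hy : ∀ y ∈ Y, Free C y → y ∉ Q → ∑ j, (if G.Adj (u j) y then 1 else 0) ≤ B)
    (hH : ∑ x ∈ P, ∑ j, (if G.Adj x (w j) then 1 else 0) +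
      ∑ y ∈ Q, ∑ j, (if G.Adj (u j) y then 1 else 0) + 1 ≤
        A * P.card + B * Q.card + E * n₀ + K) :
    ∃ i, K * (Y ∩ C i).card + 1 ≤ ∑ j, (dg G (u j) (C i) + dg G (w j) (C i)) := by
  apply h.exists_heavy hC u w hu hw hn
  have h1 := h.sum_dg_rest_le hC u w (fun j => h.sub (hu j)) hw P Q hP hQ A B hx hy
  have h5 : E * n₀ ≤ E * (Y ∩ rest C).card := Nat.mul_le_mul_left _ hn₀
  have h6 : K * (Y ∩ rest C).card =
      A * (Y ∩ rest C).card + B * (Y ∩ rest C).card + E * (Y ∩ rest C).card := by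
    rw [← hK']; ring
  omega

/-- Averaging with one exceptional member of the family. -/
theorem Ctx.exists_heavy_ne (h : Ctx G X Y S n r) (hC : IsConf G S C) {K : ℕ} (i₀ : Fin r)
    (u w : Fin K → V) (hu : ∀ j, u j ∈ S) (hw : ∀ j, w j ∈ Y) (hn : ∀ j, ¬ G.Adj (u j) (w j))
    (hD : ∑ j, (dg G (u j) (rest C) + dg G (w j) (rest C)) +
      ∑ j, (dg G (u j) (C i₀) + dg G (w j) (C i₀)) + 1 ≤
      K * (Y ∩ rest C).card + K * (Y ∩ C i₀).card + K) :
    ∃ i, i ≠ i₀ ∧ K * (Y ∩ C i).card + 1 ≤ ∑ j, (dg G (u j) (C i) + dg G (w j) (C i)) := by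
  by_contra! hcon
  have h1 : ∑ j : Fin K, (n + 1) ≤ ∑ j, (G.degree (u j) + G.degree (w j)) :=
    Finset.sum_le_sum fun j _ => h.deg _ (hu j) _ (hw j) (hn j)
  have h2 : ∑ j, (G.degree (u j) + G.degree (w j)) =
      ∑ j, (dg G (u j) (rest C) + dg G (w j) (rest C)) +
        ∑ i, ∑ j, (dg G (u j) (C i) + dg G (w j) (C i)) := by
    rw [Finset.sum_comm, ← Finset.sum_add_distrib]
    apply Finset.sum_congr rfl
    intro j _
    simp only [degree_eq_dg, dg]
    rw [sum_split hC.disj, sum_split hC.disj (fun v => if G.Adj (w j) v then 1 else 0),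
      Finset.sum_add_distrib]
    ring
  rw [← Finset.add_sum_erase _ _ (mem_univ i₀)] at h2
  have h3 : ∑ i ∈ univ.erase i₀, ∑ j, (dg G (u j) (C i) + dg G (w j) (C i)) ≤
      ∑ i ∈ univ.erase i₀, K * (Y ∩ C i).card :=
    Finset.sum_le_sum fun i hi => by have := hcon i (Finset.ne_of_mem_erase hi); omega
  obtain ⟨-, -, -, h4⟩ := h.card_rest hC
  rw [← Finset.mul_sum] at h3
  rw [← Finset.add_sum_erase _ _ (mem_univ i₀)] at h4
  simp only [sum_const, card_univ, Fintype.card_fin, smul_eq_mul] at h1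
  have h5 : K * (n + 1) = K * (Y ∩ rest C).card + K * (Y ∩ C i₀).card +
      K * ∑ i ∈ univ.erase i₀, (Y ∩ C i).card + K := by
    conv_lhs => rw [h4]
    ring
  omega

end Context

/-- A minimal family together with distinct vertices `ss` of `S` and `zs` of `Y` outside it. -/
structure Fr {V : Type*} [DecidableEq V] (G : SimpleGraph V) (S Y : Finset V) {r : ℕ}
    (C : Fin r → Finset V) (ss zs : List V) : Prop where
  min : IsMin G S C
  nds : ss.Nodup
  ndz : zs.Nodup
  mems : ∀ v ∈ ss, v ∈ S ∧ Free C v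
  memz : ∀ v ∈ zs, v ∈ Y ∧ Free C v

/-- Some minimal family has the edge pattern `E` outside it. -/
def Has {V : Type*} [DecidableEq V] (G : SimpleGraph V) (S Y : Finset V) (r : ℕ)
    (E : List (ℕ × ℕ)) : Prop :=
  ∃ (C : Fin r → Finset V) (s z : ℕ → V), Fr G S Y C [s 0, s 1, s 2] [z 0, z 1, z 2] ∧
    ∀ e ∈ E, G.Adj (s e.1) (z e.2)

section Frames

variable {V : Type*} [DecidableEq V] {G : SimpleGraph V} {S Y : Finset V} {r : ℕ}
  {C : Fin r → Finset V} {ss zs : List V}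

theorem nodup_filterMap_getElem {α : Type*} {l : List α} (hl : l.Nodup) {is : List ℕ}
    (his : is.Nodup) : (is.filterMap fun i => l[i]?).Nodup := by
  apply his.filterMap
  intro i j a hi hj
  simp only [Option.mem_def] at hi hj
  have hi' := List.getElem?_eq_some_iff.1 hi
  have hj' := List.getElem?_eq_some_iff.1 hj
  obtain ⟨h1, h2⟩ := hi'
  obtain ⟨h3, h4⟩ := hj'
  exact (hl.getElem_inj_iff).1 (h2.trans h4.symm)

/-- Select and reorder the vertices of a frame. -/
theorem Fr.sel (h : Fr G S Y C ss zs) (is js : List ℕ) (hi : is.Nodup) (hj : js.Nodup) :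
    Fr G S Y C (is.filterMap fun i => ss[i]?) (js.filterMap fun i => zs[i]?) where
  min := h.min
  nds := nodup_filterMap_getElem h.nds hi
  ndz := nodup_filterMap_getElem h.ndz hj
  mems v hv := by
    obtain ⟨i, -, hi⟩ := List.mem_filterMap.1 hv
    exact h.mems v (List.mem_of_getElem? hi)
  memz v hv := by
    obtain ⟨i, -, hi⟩ := List.mem_filterMap.1 hv
    exact h.memz v (List.mem_of_getElem? hi)

theorem Fr.consZ (h : Fr G S Y C ss zs) {v : V} (hY : v ∈ Y) (hf : Free C v) (hv : v ∉ zs) :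
    Fr G S Y C ss (v :: zs) where
  min := h.min
  nds := h.nds
  ndz := List.nodup_cons.2 ⟨hv, h.ndz⟩
  mems := h.mems
  memz w hw := by
    rcases List.mem_cons.1 hw with rfl | hw
    · exact ⟨hY, hf⟩
    · exact h.memz w hw

theorem IsMin.swap_frame (hC : IsMin G S C) {A : Finset V} {i : Fin r} (hA : Two G S A)
    (hs : ∀ v ∈ A, Free C v ∨ v ∈ C i) (hc : A.card ≤ (C i).card) (nds : ss.Nodup)
    (ndz : zs.Nodup) (hss : ∀ v ∈ ss, v ∈ S ∧ v ∉ A ∧ (Free C v ∨ v ∈ C i))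
    (hzs : ∀ v ∈ zs, v ∈ Y ∧ v ∉ A ∧ (Free C v ∨ v ∈ C i)) :
    Fr G S Y (Function.update C i A) ss zs where
  min := hC.update hA hs hc
  nds := nds
  ndz := ndz
  mems v hv := ⟨(hss v hv).1, hC.free_update.2 (hss v hv).2⟩
  memz v hv := ⟨(hzs v hv).1, hC.free_update.2 (hzs v hv).2⟩

end Frames

section Search

/-- The bit encoding an edge between row `e.1` and column `e.2`. -/
def ebit (e : ℕ × ℕ) : ℕ := 6 * e.1 + e.2

/-- The bit mask of a list of edges. -/
def maskOf (l : List (ℕ × ℕ)) : ℕ := l.foldr (fun e a => a ||| 2 ^ ebit e) 0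

theorem testBit_maskOf (l : List (ℕ × ℕ)) (b : ℕ) :
    (maskOf l).testBit b = true ↔ ∃ e ∈ l, ebit e = b := by
  induction l with
  | nil => simp [maskOf]
  | cons e l ih =>
    have : maskOf (e :: l) = maskOf l ||| 2 ^ ebit e := rfl
    rw [this, Nat.testBit_or, Bool.or_eq_true, ih, Nat.testBit_two_pow]
    simp [or_comm]

/-- Branch over the edges in the list; an edge of weight `w` may be absent at the expense of `w`
units of `slack`. Every branch has to reach a set of edges containing one of the masks. -/
def search (ms : List ℕ) : List ((ℕ × ℕ) × ℕ) → ℕ → ℕ → Bool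
  | [], _, _ => false
  | (e, w) :: bs, acc, slack =>
    (if slack < w then true else search ms bs acc (slack - w)) &&
      (ms.any (fun m => m &&& (acc ||| 2 ^ ebit e) == m) ||
        search ms bs (acc ||| 2 ^ ebit e) slack)

theorem search_sound (Sat : ℕ → Prop) [DecidablePred Sat] (ms : List ℕ) :
    ∀ (bs : List ((ℕ × ℕ) × ℕ)) (acc slack : ℕ), search ms bs acc slack = true →
      (∀ b, acc.testBit b = true → Sat b) →
      (bs.map fun e => if Sat (ebit e.1) then 0 else e.2).sum ≤ slack →
      ∃ m ∈ ms, ∀ b, m.testBit b = true → Sat b := by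
  intro bs
  induction bs with
  | nil => intro acc slack h; simp [search] at h
  | cons ew bs ih =>
    obtain ⟨e, w⟩ := ew
    intro acc slack h hacc hsum
    simp only [search, Bool.and_eq_true, Bool.or_eq_true] at h
    simp only [List.map_cons, List.sum_cons] at hsum
    by_cases hs : Sat (ebit e)
    · have hacc' : ∀ b, (acc ||| 2 ^ ebit e).testBit b = true → Sat b := by
        intro b hb
        rw [Nat.testBit_or, Bool.or_eq_true, Nat.testBit_two_pow] at hb
        rcases hb with hb | hb
        · exact hacc b hb
        · rw [decide_eq_true_eq] at hb
          exact hb ▸ hs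
      rcases h.2 with h2 | h2
      · rw [List.any_eq_true] at h2
        obtain ⟨m, hm, hm2⟩ := h2
        refine ⟨m, hm, fun b hb => hacc' b ?_⟩
        rw [beq_iff_eq] at hm2
        rw [← hm2, Nat.testBit_and, Bool.and_eq_true] at hb
        exact hb.2
      · rw [if_pos hs, zero_add] at hsum
        exact ih _ _ h2 hacc' hsum
    · rw [if_neg hs] at hsum
      have h1 := h.1
      rw [if_neg (by omega)] at h1
      exact ih _ _ h1 hacc (by omega)

/-- The `k`-th decimal digit. -/
def dgt (w k : ℕ) : ℕ := w / 10 ^ k % 10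

/-- A witness consists of a row and a column selection, written as five decimal digits each, and
the index of a target pattern. -/
abbrev Wit := ℕ × ℕ × ℕ

/-- The pattern followed by the four edges of a new cycle on rows and columns `3, 4`. -/
def fullPat (E : List (ℕ × ℕ)) : List (ℕ × ℕ) := (3, 3) :: (3, 4) :: (4, 3) :: (4, 4) :: E

/-- The edges required by a witness. -/
def witEdges (ts : List (List (ℕ × ℕ))) (w : Wit) : List (ℕ × ℕ) :=
  (fullPat (ts.getD w.2.2 [])).map fun e => (dgt w.1 e.1, dgt w.2.1 e.2)

/-- Rows and columns of a witness are distinct and lie in the given lists. -/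
def witValid (ra ca : List ℕ) (nt : ℕ) (w : Wit) : Bool :=
  let rs := (List.range 5).map (dgt w.1)
  let cs := (List.range 5).map (dgt w.2.1)
  decide rs.Nodup && decide cs.Nodup && rs.all (fun k => ra.contains k) &&
    cs.all (fun k => ca.contains k) && decide (w.2.2 < nt)

end Search

section Swap

variable {V : Type*} [Fintype V] [DecidableEq V] {G : SimpleGraph V} [DecidableRel G.Adj]
  {X Y S : Finset V} {n r : ℕ} {C : Fin r → Finset V}

theorem Ctx.two_four (h : Ctx G X Y S n r) {a b p q : V} (ha : a ∈ S) (hb : b ∈ S) (hp : p ∈ Y)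
    (hq : q ∈ Y) (hab : a ≠ b) (hpq : p ≠ q) (h1 : G.Adj a p) (h2 : G.Adj a q) (h3 : G.Adj b p)
    (h4 : G.Adj b q) : Two G S {a, b, p, q} := by
  refine ⟨isCyc_four h1 h3 h4 h2 hab hpq, ?_⟩
  have e : S ∩ {a, b, p, q} = {a, b} := by
    have hp' : p ∉ S := fun hs => h.not_mem_X.2 hp (h.sub hs)
    have hq' : q ∉ S := fun hs => h.not_mem_X.2 hq (h.sub hs)
    ext v
    simp only [mem_inter, mem_insert, mem_singleton]
    constructor
    · rintro ⟨hv, rfl | rfl | rfl | rfl⟩ <;> simp_all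
    · rintro (rfl | rfl) <;> simp_all
  rw [e, card_pair hab]

theorem Ctx.two_six (h : Ctx G X Y S n r) {x₁ x₂ x₃ y₁ y₂ y₃ : V} (hx₁ : x₁ ∈ S) (hx₂ : x₂ ∈ S)
    (hx₃ : x₃ ∈ X) (hx₃' : x₃ ∉ S) (hy₁ : y₁ ∈ Y) (hy₂ : y₂ ∈ Y) (hy₃ : y₃ ∈ Y) (hx : x₁ ≠ x₂)
    (h12 : y₁ ≠ y₂) (h13' : y₁ ≠ y₃) (h23 : y₂ ≠ y₃)
    (h11 : G.Adj x₁ y₁) (h21 : G.Adj x₂ y₁) (h22 : G.Adj x₂ y₂) (h32 : G.Adj x₃ y₂)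
    (h33 : G.Adj x₃ y₃) (h13 : G.Adj x₁ y₃) : Two G S {x₁, x₂, x₃, y₁, y₂, y₃} := by
  have hns : ∀ y ∈ Y, y ∉ S := fun y hy hs => h.not_mem_X.2 hy (h.sub hs)
  have hn1 := hns _ hy₁
  have hn2 := hns _ hy₂
  have hn3 := hns _ hy₃
  refine ⟨isCyc_six h11 h21 h22 h32 h33 h13 ?_, ?_⟩
  · have a1 : ∀ y ∈ Y, x₁ ≠ y := fun y hy e => hns y hy (e ▸ hx₁)
    have a2 : ∀ y ∈ Y, x₂ ≠ y := fun y hy e => hns y hy (e ▸ hx₂)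
    have a3 : ∀ y ∈ Y, x₃ ≠ y := fun y hy e => h.not_mem_X.2 hy (e ▸ hx₃)
    have b1 : x₁ ≠ x₃ := fun e => hx₃' (e ▸ hx₁)
    have b2 : x₂ ≠ x₃ := fun e => hx₃' (e ▸ hx₂)
    simp [hx, b1, b2, h12, h13', h23, a1 _ hy₁, a1 _ hy₂, a1 _ hy₃, a2 _ hy₁, a2 _ hy₂, a2 _ hy₃,
      a3 _ hy₁, a3 _ hy₂, a3 _ hy₃]
  · have e : S ∩ {x₁, x₂, x₃, y₁, y₂, y₃} = {x₁, x₂} := by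
      ext v
      simp only [mem_inter, mem_insert, mem_singleton]
      constructor
      · rintro ⟨hv, rfl | rfl | rfl | rfl | rfl | rfl⟩ <;> simp_all
      · rintro (rfl | rfl) <;> simp_all
    rw [e, card_pair hx]

theorem Ctx.has_of_wit (h : Ctx G X Y S n r) (hC : IsMin G S C) (i : Fin r)
    (hi : (C i).card = 4) (xs ys : ℕ → V) (ra ca : List ℕ)
    (hra : ∀ k ∈ ra, xs k ∈ S ∧ (Free C (xs k) ∨ xs k ∈ C i))
    (hca : ∀ k ∈ ca, ys k ∈ Y ∧ (Free C (ys k) ∨ ys k ∈ C i))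
    (hrinj : ∀ k ∈ ra, ∀ l ∈ ra, xs k = xs l → k = l)
    (hcinj : ∀ k ∈ ca, ∀ l ∈ ca, ys k = ys l → k = l)
    (ts : List (List (ℕ × ℕ))) (w : Wit) (hw : witValid ra ca ts.length w = true)
    (hsat : ∀ e ∈ witEdges ts w, G.Adj (xs e.1) (ys e.2)) : ∃ E ∈ ts, Has G S Y r E := by
  simp only [witValid, Bool.and_eq_true, decide_eq_true_eq, List.all_eq_true, List.mem_map,
    List.mem_range, forall_exists_index, and_imp, forall_apply_eq_imp_iff₂,
    List.contains_eq_mem] at hw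
  obtain ⟨⟨⟨⟨hr, hc⟩, hra'⟩, hca'⟩, ht⟩ := hw
  have hne : ∀ (w : ℕ), ((List.range 5).map (dgt w)).Nodup → ∀ j k, j < 5 → k < 5 →
      dgt w j = dgt w k → j = k := by
    intro w hnd j k hj hk e
    exact List.inj_on_of_nodup_map hnd (List.mem_range.2 hj) (List.mem_range.2 hk) e
  have hx : ∀ j k, j < 5 → k < 5 → xs (dgt w.1 j) = xs (dgt w.1 k) → j = k :=
    fun j k hj hk e => hne _ hr j k hj hk (hrinj _ (hra' j hj) _ (hra' k hk) e)
  have hy : ∀ j k, j < 5 → k < 5 → ys (dgt w.2.1 j) = ys (dgt w.2.1 k) → j = k :=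
    fun j k hj hk e => hne _ hc j k hj hk (hcinj _ (hca' j hj) _ (hca' k hk) e)
  have hs : ∀ e ∈ fullPat (ts.getD w.2.2 []), G.Adj (xs (dgt w.1 e.1)) (ys (dgt w.2.1 e.2)) :=
    fun e he => hsat _ (List.mem_map_of_mem (f := fun e => (dgt w.1 e.1, dgt w.2.1 e.2)) he)
  refine ⟨ts.getD w.2.2 [], ?_, ?_⟩
  · rw [List.getD_eq_getElem _ _ ht]
    exact List.getElem_mem _
  set f : ℕ → V := fun k => xs (dgt w.1 k) with hf
  set g : ℕ → V := fun k => ys (dgt w.2.1 k) with hg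
  have hfS : ∀ k, k < 5 → f k ∈ S ∧ (Free C (f k) ∨ f k ∈ C i) := fun k hk => hra _ (hra' k hk)
  have hgY : ∀ k, k < 5 → g k ∈ Y ∧ (Free C (g k) ∨ g k ∈ C i) := fun k hk => hca _ (hca' k hk)
  have hfne : ∀ j k, j < 5 → k < 5 → j ≠ k → f j ≠ f k :=
    fun j k hj hk hjk e => hjk (hx j k hj hk e)
  have hgne : ∀ j k, j < 5 → k < 5 → j ≠ k → g j ≠ g k :=
    fun j k hj hk hjk e => hjk (hy j k hj hk e)
  have hfg : ∀ j k, j < 5 → k < 5 → f j ≠ g k :=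
    fun j k hj hk => h.ne (h.sub (hfS j hj).1) (hgY k hk).1
  have h2 : Two G S {f 3, f 4, g 3, g 4} :=
    h.two_four (hfS 3 (by omega)).1 (hfS 4 (by omega)).1 (hgY 3 (by omega)).1
      (hgY 4 (by omega)).1 (hfne _ _ (by omega) (by omega) (by omega))
      (hgne _ _ (by omega) (by omega) (by omega)) (hs (3, 3) (by simp [fullPat]))
      (hs (3, 4) (by simp [fullPat])) (hs (4, 3) (by simp [fullPat])) (hs (4, 4) (by simp [fullPat]))
  refine ⟨_, f, g, hC.swap_frame (i := i) h2 ?_ ?_ ?_ ?_ ?_ ?_,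
    fun e he => hs e (by simp only [fullPat, List.mem_cons]; tauto)⟩
  · intro v hv
    simp only [mem_insert, mem_singleton] at hv
    rcases hv with rfl | rfl | rfl | rfl
    · exact (hfS 3 (by omega)).2
    · exact (hfS 4 (by omega)).2
    · exact (hgY 3 (by omega)).2
    · exact (hgY 4 (by omega)).2
  · rw [hi]
    exact Finset.card_le_four
  · simp [hfne]
  · simp [hgne]
  · intro v hv
    simp only [List.mem_cons, List.not_mem_nil, or_false] at hv
    rcases hv with rfl | rfl | rfl
    · exact ⟨(hfS 0 (by omega)).1, by simp [hfne, hfg], (hfS 0 (by omega)).2⟩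
    · exact ⟨(hfS 1 (by omega)).1, by simp [hfne, hfg], (hfS 1 (by omega)).2⟩
    · exact ⟨(hfS 2 (by omega)).1, by simp [hfne, hfg], (hfS 2 (by omega)).2⟩
  · intro v hv
    simp only [List.mem_cons, List.not_mem_nil, or_false] at hv
    have hgf : ∀ j k, j < 5 → k < 5 → g j ≠ f k := fun j k hj hk => (hfg k j hk hj).symm
    rcases hv with rfl | rfl | rfl
    · exact ⟨(hgY 0 (by omega)).1, by simp [hgne, hgf], (hgY 0 (by omega)).2⟩
    · exact ⟨(hgY 1 (by omega)).1, by simp [hgne, hgf], (hgY 1 (by omega)).2⟩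
    · exact ⟨(hgY 2 (by omega)).1, by simp [hgne, hgf], (hgY 2 (by omega)).2⟩

end Swap

/-- The `i`-th member of the family is the four-cycle `a p b q`. -/
structure Quad {V : Type*} [DecidableEq V] (G : SimpleGraph V) (S Y : Finset V) {r : ℕ}
    (C : Fin r → Finset V) (i : Fin r) (a b p q : V) : Prop where
  eq : C i = {a, b, p, q}
  ha : a ∈ S
  hb : b ∈ S
  hp : p ∈ Y
  hq : q ∈ Y
  hab : a ≠ b
  hpq : p ≠ q
  ap : G.Adj a p
  aq : G.Adj a q
  bp : G.Adj b p
  bq : G.Adj b q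

section Quads

variable {V : Type*} [Fintype V] [DecidableEq V] {G : SimpleGraph V} [DecidableRel G.Adj]
  {X Y S : Finset V} {n r : ℕ} {C : Fin r → Finset V}

theorem Ctx.exists_quad (h : Ctx G X Y S n r) (hC : IsConf G S C) {i : Fin r}
    (hi : (Y ∩ C i).card = 2) : ∃ a b p q, Quad G S Y C i a b p q := by
  have ht := hC.two i
  obtain ⟨a, ha, haX⟩ := h.exists_mem_X ht.1
  obtain ⟨m, c, hm, hc, h0, hA, hX, hY⟩ := h.cyc_param ht.1 ha haX
  have hcard := (h.card_cyc ht.1).2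
  rw [hi, hA, hc.card] at hcard
  obtain rfl : m = 2 := by omega
  have hs : C i = {c 0, c 2, c 1, c 3} := by
    rw [hA]
    ext v
    simp [Finset.range_add_one]
    tauto
  have hsub : S ∩ C i ⊆ {c 0, c 2} := by
    intro v hv
    rw [hs] at hv
    simp only [mem_inter, mem_insert, mem_singleton] at hv
    have h1 := hY 0
    have h3 := hY 1
    simp only [mem_insert, mem_singleton]
    rcases hv with ⟨hv, rfl | rfl | rfl | rfl⟩
    · simp
    · simp
    · exact absurd (h.sub hv) (h.not_mem_X.2 h1)
    · exact absurd (h.sub hv) (h.not_mem_X.2 h3)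
  have hne : ∀ i j, i < 4 → j < 4 → i ≠ j → c i ≠ c j := fun i j hi hj hij e =>
    hij (hc.inj i j hi hj e)
  have heq : S ∩ C i = {c 0, c 2} := by
    apply Finset.eq_of_subset_of_card_le hsub
    rw [ht.2]
    exact Finset.card_le_two
  have m0 : c 0 ∈ S ∩ C i := by rw [heq]; simp
  have m2 : c 2 ∈ S ∩ C i := by rw [heq]; simp
  have h4 := hc.per 0
  refine ⟨c 0, c 2, c 1, c 3, hs, (mem_inter.1 m0).1, (mem_inter.1 m2).1, hY 0, hY 1,
    hne _ _ (by omega) (by omega) (by omega), hne _ _ (by omega) (by omega) (by omega),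
    hc.adj 0, ?_, (hc.adj 1).symm, hc.adj 2⟩
  have := hc.adj 3
  rw [show 3 + 1 = 0 + 2 * 2 by rfl, h4] at this
  exact this.symm

theorem Quad.card {i : Fin r} {a b p q : V} (hQ : Quad G S Y C i a b p q)
    (h : Ctx G X Y S n r) : (C i).card = 4 := by
  have := h.ne (h.sub hQ.ha) hQ.hp
  have := h.ne (h.sub hQ.ha) hQ.hq
  have := h.ne (h.sub hQ.hb) hQ.hp
  have := h.ne (h.sub hQ.hb) hQ.hq
  have := hQ.hab
  have := hQ.hpq
  rw [hQ.eq]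
  rw [card_insert_of_notMem, card_insert_of_notMem, card_insert_of_notMem, card_singleton] <;>
    simp [*]

theorem Quad.dgX {i : Fin r} {a b p q : V} (hQ : Quad G S Y C i a b p q)
    (h : Ctx G X Y S n r) {s : V} (hs : s ∈ X) :
    dg G s (C i) = (if G.Adj s p then 1 else 0) + (if G.Adj s q then 1 else 0) := by
  have h1 := h.ne (h.sub hQ.ha) hQ.hp
  have h2 := h.ne (h.sub hQ.ha) hQ.hq
  have h3 := h.ne (h.sub hQ.hb) hQ.hp
  have h4 := h.ne (h.sub hQ.hb) hQ.hq
  have n1 : ¬ G.Adj s a := fun hadj => h.not_mem_X.2 (h.adj_X hadj hs) (h.sub hQ.ha)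
  have n2 : ¬ G.Adj s b := fun hadj => h.not_mem_X.2 (h.adj_X hadj hs) (h.sub hQ.hb)
  rw [dg, hQ.eq, sum_insert (by simp [hQ.hab, h1, h2]), sum_insert (by simp [h3, h4]),
    sum_insert (by simp [hQ.hpq]), sum_singleton, if_neg n1, if_neg n2]
  simp

theorem Quad.dgY {i : Fin r} {a b p q : V} (hQ : Quad G S Y C i a b p q)
    (h : Ctx G X Y S n r) {z : V} (hz : z ∈ Y) :
    dg G z (C i) = (if G.Adj a z then 1 else 0) + (if G.Adj b z then 1 else 0) := by
  have h1 := h.ne (h.sub hQ.ha) hQ.hp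
  have h2 := h.ne (h.sub hQ.ha) hQ.hq
  have h3 := h.ne (h.sub hQ.hb) hQ.hp
  have h4 := h.ne (h.sub hQ.hb) hQ.hq
  have n1 : ¬ G.Adj z p := fun hadj => h.not_mem_X.2 hQ.hp (h.adj_Y hadj hz)
  have n2 : ¬ G.Adj z q := fun hadj => h.not_mem_X.2 hQ.hq (h.adj_Y hadj hz)
  rw [dg, hQ.eq, sum_insert (by simp [hQ.hab, h1, h2]), sum_insert (by simp [h3, h4]),
    sum_insert (by simp [hQ.hpq]), sum_singleton, if_neg n1, if_neg n2]
  simp [G.adj_comm z]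

/-- The certificate for a list of edge patterns to be unavoidable: if the edges in `base` are
present and the weights of the present edges in `wE` add up to at least `T`, then all edges of some
member of `ls` are present. -/
def ecert (base : List (ℕ × ℕ)) (wE : List ((ℕ × ℕ) × ℕ)) (T : ℕ)
    (ls : List (List (ℕ × ℕ))) : Bool :=
  search (ls.map maskOf) (wE.filter fun e => decide (e.2 ≠ 0)) (maskOf base)
      ((wE.map Prod.snd).sum - T) &&
    decide (T ≤ (wE.map Prod.snd).sum) && (base.all fun e => decide (e.2 < 6)) &&
    (wE.all fun e => decide (e.1.2 < 6)) && ls.all fun l => l.all fun e => decide (e.2 < 6)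

theorem sum_filter_ne_zero (P : ℕ × ℕ → Prop) [DecidablePred P] (l : List ((ℕ × ℕ) × ℕ)) :
    ((l.filter fun e => decide (e.2 ≠ 0)).map fun e => if P e.1 then 0 else e.2).sum =
      (l.map fun e => if P e.1 then 0 else e.2).sum := by
  induction l with
  | nil => rfl
  | cons e l ih =>
    rw [List.filter_cons]
    by_cases he : e.2 = 0
    · rw [if_neg (by simp [he]), ih]
      simp [he]
    · rw [if_pos (by simp [he]), List.map_cons, List.map_cons, List.sum_cons, List.sum_cons, ih]

theorem absent_add_present (P : ℕ × ℕ → Prop) [DecidablePred P] (l : List ((ℕ × ℕ) × ℕ)) :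
    (l.map fun e => if P e.1 then 0 else e.2).sum +
      (l.map fun e => e.2 * if P e.1 then 1 else 0).sum = (l.map Prod.snd).sum := by
  induction l with
  | nil => rfl
  | cons e l ih =>
    simp only [List.map_cons, List.sum_cons, ← ih]
    split_ifs <;> ring

theorem exists_pattern (P : ℕ → ℕ → Prop) [∀ i j, Decidable (P i j)] (base : List (ℕ × ℕ))
    (wE : List ((ℕ × ℕ) × ℕ)) (T : ℕ) (ls : List (List (ℕ × ℕ)))
    (hcert : ecert base wE T ls = true) (hbase : ∀ e ∈ base, P e.1 e.2)
    (hT : T ≤ (wE.map fun e => e.2 * if P e.1.1 e.1.2 then 1 else 0).sum) :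
    ∃ l ∈ ls, ∀ e ∈ l, P e.1 e.2 := by
  simp only [ecert, Bool.and_eq_true, decide_eq_true_eq, List.all_eq_true] at hcert
  obtain ⟨⟨⟨⟨hs, hTs⟩, hb⟩, hw⟩, hl⟩ := hcert
  let Sat : ℕ → Prop := fun b => P (b / 6) (b % 6)
  have hSat : ∀ e : ℕ × ℕ, e.2 < 6 → (Sat (ebit e) ↔ P e.1 e.2) := by
    intro e he
    simp only [Sat, ebit]
    rw [show (6 * e.1 + e.2) / 6 = e.1 by omega, show (6 * e.1 + e.2) % 6 = e.2 by omega]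
  have hsum : (wE.map fun e => if Sat (ebit e.1) then 0 else e.2).sum ≤
      (wE.map Prod.snd).sum - T := by
    have e1 : (wE.map fun e => e.2 * if P e.1.1 e.1.2 then 1 else 0) =
        wE.map fun e => e.2 * if Sat (ebit e.1) then 1 else 0 := by
      apply List.map_congr_left
      intro e he
      simp only [hSat e.1 (hw e he)]
    rw [e1] at hT
    have := absent_add_present (fun e => Sat (ebit e)) wE
    omega
  obtain ⟨m, hm, hmS⟩ := search_sound Sat _ _ _ _ hs (by
      intro b hb'
      rw [testBit_maskOf] at hb'
      obtain ⟨e, he, rfl⟩ := hb'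
      exact (hSat e (hb e he)).2 (hbase e he))
    (by rwa [sum_filter_ne_zero (fun e => Sat (ebit e))])
  obtain ⟨l, hl', rfl⟩ := List.mem_map.1 hm
  exact ⟨l, hl', fun e he => (hSat e (hl l hl' e he)).1
    (hmS _ ((testBit_maskOf _ _).2 ⟨e, he, rfl⟩))⟩

/-- Row vertices: three outside vertices, then the two vertices of the four-cycle. -/
def rowV {V : Type*} (s₁ s₂ s₃ a b : V) : ℕ → V
  | 0 => s₁
  | 1 => s₂
  | 2 => s₃
  | 3 => a
  | _ => b

/-- Column vertices: up to four outside vertices, then the two vertices of the four-cycle. -/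
def colV {V : Type*} (zs : List V) (p q : V) : ℕ → V
  | 4 => p
  | 5 => q
  | k => zs.getD k p

/-- The edges of the four-cycle. -/
def quadE : List (ℕ × ℕ) := [(3, 4), (3, 5), (4, 4), (4, 5)]

/-- The weighted edges between the frame and the four-cycle. -/
def wEdges (al be : List ℕ) : List ((ℕ × ℕ) × ℕ) :=
  ((List.range 3).flatMap fun k => [((k, 4), al.getD k 0), ((k, 5), al.getD k 0)]) ++
    (List.range be.length).flatMap fun k => [((3, k), be.getD k 0), ((4, k), be.getD k 0)]

/-- The kernel-checked certificate used for four-cycles. -/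
def qcert (base : List (ℕ × ℕ)) (al be : List ℕ) (T : ℕ) (nt : ℕ) (ts : List (List (ℕ × ℕ)))
    (wl : List Wit) (stuck : List (List (ℕ × ℕ))) : Bool :=
  wl.all (witValid [0, 1, 2, 3, 4] (List.range nt ++ [4, 5]) ts.length) &&
    ecert (quadE ++ base) (wEdges al be) T (wl.map (witEdges ts) ++ stuck) && decide (nt ≤ 4)

theorem Quad.cols {i : Fin r} {a b p q : V} {ss zs : List V} (hQ : Quad G S Y C i a b p q)
    (hF : Fr G S Y C ss zs) (hnt : zs.length ≤ 4) :
    (∀ k ∈ List.range zs.length ++ [4, 5], colV zs p q k ∈ Y ∧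
      (Free C (colV zs p q k) ∨ colV zs p q k ∈ C i)) ∧
    ∀ k ∈ List.range zs.length ++ [4, 5], ∀ l ∈ List.range zs.length ++ [4, 5],
      colV zs p q k = colV zs p q l → k = l := by
  have hz : ∀ k ∈ List.range zs.length, ∃ hk : k < zs.length, colV zs p q k = zs[k] := by
    intro k hk
    have hk := List.mem_range.1 hk
    refine ⟨hk, ?_⟩
    rw [colV, List.getD_eq_getElem _ _ hk]
    all_goals omega
  have hpC : p ∈ C i := by simp [hQ.eq]
  have hqC : q ∈ C i := by simp [hQ.eq]
  have hne : ∀ {u v : V}, Free C u → v ∈ C i → u ≠ v := fun hu hv e => hu i (e ▸ hv)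
  constructor
  · intro k hk
    rcases List.mem_append.1 hk with hk | hk
    · obtain ⟨hk', e⟩ := hz k hk
      rw [e]
      have := hF.memz zs[k] (List.getElem_mem _)
      exact ⟨this.1, Or.inl this.2⟩
    · simp only [List.mem_cons, List.not_mem_nil, or_false] at hk
      rcases hk with rfl | rfl
      · exact ⟨hQ.hp, Or.inr hpC⟩
      · exact ⟨hQ.hq, Or.inr hqC⟩
  · intro k hk l hl e
    rcases List.mem_append.1 hk with hk | hk <;> rcases List.mem_append.1 hl with hl | hl
    · obtain ⟨hk1, hk2⟩ := hz k hk
      obtain ⟨hl1, hl2⟩ := hz l hl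
      rw [hk2, hl2] at e
      exact (hF.ndz.getElem_inj_iff).1 e
    · obtain ⟨hk1, hk2⟩ := hz k hk
      have hf := (hF.memz zs[k] (List.getElem_mem _)).2
      simp only [List.mem_cons, List.not_mem_nil, or_false] at hl
      rw [hk2] at e
      rcases hl with rfl | rfl
      · exact absurd e (hne hf hpC)
      · exact absurd e (hne hf hqC)
    · obtain ⟨hk1, hk2⟩ := hz l hl
      have hf := (hF.memz zs[l] (List.getElem_mem _)).2
      simp only [List.mem_cons, List.not_mem_nil, or_false] at hk
      rw [hk2] at e
      rcases hk with rfl | rfl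
      · exact absurd e.symm (hne hf hpC)
      · exact absurd e.symm (hne hf hqC)
    · simp only [List.mem_cons, List.not_mem_nil, or_false] at hk hl
      rcases hk with rfl | rfl <;> rcases hl with rfl | rfl
      · rfl
      · exact absurd e hQ.hpq
      · exact absurd e.symm hQ.hpq
      · rfl

theorem Quad.rows {i : Fin r} {a b p q s₁ s₂ s₃ : V} {zs : List V}
    (hQ : Quad G S Y C i a b p q) (hF : Fr G S Y C [s₁, s₂, s₃] zs) :
    (∀ k ∈ [0, 1, 2, 3, 4], rowV s₁ s₂ s₃ a b k ∈ S ∧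
      (Free C (rowV s₁ s₂ s₃ a b k) ∨ rowV s₁ s₂ s₃ a b k ∈ C i)) ∧
    ∀ k ∈ [0, 1, 2, 3, 4], ∀ l ∈ [0, 1, 2, 3, 4],
      rowV s₁ s₂ s₃ a b k = rowV s₁ s₂ s₃ a b l → k = l := by
  have h1 := hF.mems s₁ (by simp)
  have h2 := hF.mems s₂ (by simp)
  have h3 := hF.mems s₃ (by simp)
  have haC : a ∈ C i := by simp [hQ.eq]
  have hbC : b ∈ C i := by simp [hQ.eq]
  constructor
  · intro k hk
    simp only [List.mem_cons, List.not_mem_nil, or_false] at hk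
    rcases hk with rfl | rfl | rfl | rfl | rfl
    · exact ⟨h1.1, Or.inl h1.2⟩
    · exact ⟨h2.1, Or.inl h2.2⟩
    · exact ⟨h3.1, Or.inl h3.2⟩
    · exact ⟨hQ.ha, Or.inr haC⟩
    · exact ⟨hQ.hb, Or.inr hbC⟩
  · have hne : ∀ {u v : V}, Free C u → v ∈ C i → u ≠ v := fun hu hv e => hu i (e ▸ hv)
    have hn : ([s₁, s₂, s₃] ++ [a, b]).Nodup := by
      rw [List.nodup_append]
      refine ⟨hF.nds, by simp [hQ.hab], ?_⟩
      intro u hu v hv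
      have hf := (hF.mems u hu).2
      simp only [List.mem_cons, List.not_mem_nil, or_false] at hv
      rcases hv with rfl | rfl
      · exact hne hf haC
      · exact hne hf hbC
    have hr : ∀ k ∈ [0, 1, 2, 3, 4], ([s₁, s₂, s₃] ++ [a, b])[k]? = some (rowV s₁ s₂ s₃ a b k) ∧
        k < ([s₁, s₂, s₃] ++ [a, b]).length := by
      intro k hk
      simp only [List.mem_cons, List.not_mem_nil, or_false] at hk
      rcases hk with rfl | rfl | rfl | rfl | rfl <;> simp [rowV]
    intro k hk l hl e
    have e1 := hr k hk
    have e2 := hr l hl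
    rw [e] at e1
    exact (List.getElem?_inj e1.2 hn).1 (e1.1.trans e2.1.symm)

/-- The alternative for a four-cycle receiving many edges from a frame. -/
theorem Ctx.qcheck (h : Ctx G X Y S n r) {s₁ s₂ s₃ : V} {zs : List V}
    (hF : Fr G S Y C [s₁, s₂, s₃] zs) {i : Fin r} {a b p q : V} (hQ : Quad G S Y C i a b p q)
    (base : List (ℕ × ℕ)) (al be : List ℕ) (T : ℕ) (ts : List (List (ℕ × ℕ)))
    (wl : List Wit) (stuck : List (List (ℕ × ℕ)))
    (hcert : qcert base al be T zs.length ts wl stuck = true)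
    (hbase : ∀ e ∈ base, G.Adj (rowV s₁ s₂ s₃ a b e.1) (colV zs p q e.2))
    (hT : T ≤ ((wEdges al be).map fun e => e.2 *
      if G.Adj (rowV s₁ s₂ s₃ a b e.1.1) (colV zs p q e.1.2) then 1 else 0).sum) :
    (∃ E ∈ ts, Has G S Y r E) ∨
      ∃ l ∈ stuck, ∀ e ∈ l, G.Adj (rowV s₁ s₂ s₃ a b e.1) (colV zs p q e.2) := by
  simp only [qcert, Bool.and_eq_true, decide_eq_true_eq, List.all_eq_true] at hcert
  obtain ⟨⟨hv, hs⟩, hnt⟩ := hcert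
  obtain ⟨l, hl, hlP⟩ := exists_pattern
    (fun k l => G.Adj (rowV s₁ s₂ s₃ a b k) (colV zs p q l)) _ _ _ _ hs (by
      intro e he
      rcases List.mem_append.1 he with he | he
      · simp only [quadE, List.mem_cons, List.not_mem_nil, or_false] at he
        rcases he with rfl | rfl | rfl | rfl
        · exact hQ.ap
        · exact hQ.aq
        · exact hQ.bp
        · exact hQ.bq
      · exact hbase e he) hT
  rcases List.mem_append.1 hl with hl | hl
  · left
    obtain ⟨w, hw, rfl⟩ := List.mem_map.1 hl
    obtain ⟨hc1, hc2⟩ := hQ.cols hF hnt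
    obtain ⟨hr1, hr2⟩ := hQ.rows hF
    exact h.has_of_wit hF.min i (hQ.card h) _ _ _ _ hr1 hc1 hr2 hc2 ts w (hv w hw) hlP
  · exact Or.inr ⟨l, hl, hlP⟩

end Quads

/-- A parametrization of the `i`-th member of the family, of length `2 * m ≥ 6`, whose vertices in
`S` are `c 0` and `c (2 * p)`. -/
structure Lng {V : Type*} [DecidableEq V] (G : SimpleGraph V) (X Y S : Finset V) {r : ℕ}
    (C : Fin r → Finset V) (i : Fin r) (m p : ℕ) (c : ℕ → V) : Prop where
  hm : 3 ≤ m
  hp : 0 < p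
  hpm : p < m
  par : CycParam G c (2 * m)
  eq : C i = (range (2 * m)).image c
  memX : ∀ j, c (2 * j) ∈ X
  memY : ∀ j, c (2 * j + 1) ∈ Y
  memS : ∀ k, k < 4 * m → (c k ∈ S ↔ k = 0 ∨ k = 2 * p ∨ k = 2 * m ∨ k = 2 * m + 2 * p)

section Long

variable {V : Type*} [Fintype V] [DecidableEq V] {G : SimpleGraph V} [DecidableRel G.Adj]
  {X Y S : Finset V} {n r : ℕ} {C : Fin r → Finset V} {i : Fin r} {m p : ℕ} {c : ℕ → V}

theorem Ctx.exists_lng (h : Ctx G X Y S n r) (hC : IsConf G S C) (i : Fin r)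
    (hi : 3 ≤ (Y ∩ C i).card) : ∃ p c, Lng G X Y S C i (Y ∩ C i).card p c := by
  have ht := hC.two i
  obtain ⟨a, b, hab, hS⟩ := card_eq_two.1 ht.2
  have ha : a ∈ S ∩ C i := by simp [hS]
  have hb : b ∈ S ∩ C i := by simp [hS]
  rw [mem_inter] at ha hb
  obtain ⟨m, c, hm, hc, h0, hA, hX, hY⟩ := h.cyc_param ht.1 ha.2 (h.sub ha.1)
  have hcard := (h.card_cyc ht.1).2
  rw [hA, hc.card, ← hA] at hcard
  obtain rfl : m = (Y ∩ C i).card := by omega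
  set m := (Y ∩ C i).card
  have hb' := hb.2
  rw [hA] at hb'
  obtain ⟨t, ht', rfl⟩ := mem_image.1 hb'
  have htm : t < 2 * m := by simpa using ht'
  have heven : ∃ p, t = 2 * p := by
    rcases Nat.even_or_odd' t with ⟨p, e | e⟩
    · exact ⟨p, e⟩
    · exfalso
      have := hY p
      rw [← e] at this
      exact h.not_mem_X.2 this (h.sub hb.1)
  obtain ⟨p, rfl⟩ := heven
  have hp : p ≠ 0 := by rintro rfl; exact hab h0.symm
  have hlow : ∀ k, k < 2 * m → (c k ∈ S ↔ k = 0 ∨ k = 2 * p) := by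
    intro k hk
    constructor
    · intro hkS
      have : c k ∈ S ∩ C i := mem_inter.2 ⟨hkS, by rw [hA]; exact hc.mem k⟩
      rw [hS, mem_insert, mem_singleton, ← h0] at this
      rcases this with e | e
      · exact Or.inl (hc.inj _ _ hk (by omega) e)
      · exact Or.inr (hc.inj _ _ hk htm e)
    · rintro (rfl | rfl)
      · rw [h0]; exact ha.1
      · exact hb.1
  refine ⟨p, c, hi, by omega, by omega, hc, hA, hX, hY, fun k hk => ?_⟩
  rcases lt_or_ge k (2 * m) with hk' | hk'
  · rw [hlow k hk']; omega
  · obtain ⟨l, rfl⟩ := Nat.exists_eq_add_of_le' hk'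
    rw [hc.per, hlow l (by omega)]
    omega

theorem Lng.per (hL : Lng G X Y S C i m p c) (k : ℕ) : c (k + 2 * m) = c k := hL.par.per k

theorem Lng.shift (hL : Lng G X Y S C i m p c) :
    Lng G X Y S C i m (m - p) (fun k => c (k + 2 * p)) where
  hm := hL.hm
  hp := by have := hL.hpm; omega
  hpm := by have := hL.hpm; have := hL.hp; omega
  par := hL.par.shift _
  eq := by rw [hL.par.image_shift, hL.eq]
  memX j := by have := hL.memX (j + p); rwa [show 2 * (j + p) = 2 * j + 2 * p by ring] at this
  memY j := by
    have := hL.memY (j + p); rwa [show 2 * (j + p) + 1 = 2 * j + 1 + 2 * p by ring] at this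
  memS k hk := by
    have h1 := hL.hpm
    have h2 := hL.hp
    rcases lt_or_ge (k + 2 * p) (4 * m) with h3 | h3
    · rw [hL.memS _ h3]; omega
    · obtain ⟨l, hl⟩ : ∃ l, k + 2 * p = l + 2 * m + 2 * m := ⟨k + 2 * p - 4 * m, by omega⟩
      rw [hl, hL.per, hL.per, hL.memS l (by omega)]
      omega

theorem Lng.mem (hL : Lng G X Y S C i m p c) (k : ℕ) : c k ∈ C i := by
  rw [hL.eq]; exact hL.par.mem k

theorem Lng.ne_free (hL : Lng G X Y S C i m p c) {w : V} (hw : Free C w) (k : ℕ) : c k ≠ w := by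
  rintro rfl
  exact hw i (hL.mem k)

theorem Lng.card (hL : Lng G X Y S C i m p c) : (C i).card = 2 * m := by
  rw [hL.eq, hL.par.card]

/-- The vertices of a segment of the cycle. -/
def seg {V : Type*} [DecidableEq V] (c : ℕ → V) (j d : ℕ) : Finset V :=
  (range (d + 1)).image fun t => c (j + t)

theorem mem_seg {j d : ℕ} {v : V} : v ∈ seg c j d ↔ ∃ t ≤ d, c (j + t) = v := by
  simp [seg]

theorem seg_card (j d : ℕ) : (seg c j d).card ≤ d + 1 := by
  simpa [seg] using card_image_le (s := range (d + 1)) (f := fun t => c (j + t))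

theorem Lng.seg_free (hL : Lng G X Y S C i m p c) {j d : ℕ} {v : V} (hv : v ∈ seg c j d) :
    Free C v ∨ v ∈ C i := by
  obtain ⟨t, -, rfl⟩ := mem_seg.1 hv
  exact Or.inr (hL.mem _)

theorem Lng.inter_seg_mid (hL : Lng G X Y S C i m p c) {j d : ℕ} (h1 : 1 ≤ j) (h2 : j ≤ 2 * p)
    (h3 : 2 * p ≤ j + d) (h4 : j + d < 2 * m) : S ∩ seg c j d = {c (2 * p)} := by
  have := hL.hpm
  ext v
  simp only [mem_inter, mem_seg, mem_singleton]
  constructor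
  · rintro ⟨hv, t, ht, rfl⟩
    rw [hL.memS _ (by omega)] at hv
    congr 1; omega
  · rintro rfl
    exact ⟨(hL.memS _ (by omega)).2 (by omega), 2 * p - j, by omega, by congr 1; omega⟩

theorem Lng.inter_seg_end (hL : Lng G X Y S C i m p c) {j d : ℕ} (h1 : 2 * p < j)
    (h2 : j ≤ 2 * m) (h3 : 2 * m ≤ j + d) (h4 : j + d < 2 * m + 2 * p) :
    S ∩ seg c j d = {c (2 * m)} := by
  have := hL.hpm
  ext v
  simp only [mem_inter, mem_seg, mem_singleton]
  constructor
  · rintro ⟨hv, t, ht, rfl⟩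
    rw [hL.memS _ (by omega)] at hv
    congr 1; omega
  · rintro rfl
    exact ⟨(hL.memS _ (by omega)).2 (by omega), 2 * m - j, by omega, by congr 1; omega⟩

theorem Lng.inter_seg_both (hL : Lng G X Y S C i m p c) {j d : ℕ} (h1 : 1 ≤ j) (h2 : j ≤ 2 * p)
    (h3 : 2 * m ≤ j + d) (h4 : j + d < 2 * m + 2 * p) :
    (S ∩ seg c j d).card = 2 := by
  have := hL.hpm
  have e : S ∩ seg c j d = {c (2 * p), c (2 * m)} := by
    ext v
    simp only [mem_inter, mem_seg, mem_singleton, mem_insert]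
    constructor
    · rintro ⟨hv, t, ht, rfl⟩
      rw [hL.memS _ (by omega)] at hv
      rcases (by omega : j + t = 2 * p ∨ j + t = 2 * m) with e | e <;> simp [e]
    · rintro (rfl | rfl)
      · exact ⟨(hL.memS _ (by omega)).2 (by omega), 2 * p - j, by omega, by congr 1; omega⟩
      · exact ⟨(hL.memS _ (by omega)).2 (by omega), 2 * m - j, by omega, by congr 1; omega⟩
  rw [e, card_pair]
  intro e'
  have e0 := hL.per 0
  rw [zero_add] at e0
  rw [e0] at e'
  have := hL.hp
  have := hL.par.inj _ _ (by omega) (by omega) e'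
  omega

theorem card_inter_insert {s : V} {A : Finset V} {v : V} (hs : s ∈ S) (hA : S ∩ A = {v})
    (hv : v ≠ s) : (S ∩ insert s A).card = 2 := by
  rw [inter_insert_of_mem hs, hA, card_pair hv.symm]

/-- The neighbours of an outside vertex of `S` lie on one side. -/
theorem Lng.one_side (hC : IsMin G S C)
    (hL : Lng G X Y S C i m p c) {s : V} (hs : s ∈ S) (hf : Free C s) {j l : ℕ}
    (hj : j < p) (hl : p ≤ l) (hlm : l < m) (h1 : G.Adj s (c (2 * j + 1)))
    (h2 : G.Adj s (c (2 * l + 1))) : False := by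
  have hm := hL.hm
  have hpm := hL.hpm
  have c1 := hL.par.ear_one (i := 2 * j + 1) (d := 2 * l - 2 * j) (by omega) (by omega)
    (hL.ne_free hf) h1 (by rwa [show 2 * j + 1 + (2 * l - 2 * j) = 2 * l + 1 by omega])
  have c2 := hL.par.ear_one (i := 2 * l + 1) (d := 2 * m + 2 * j - 2 * l) (by omega) (by omega)
    (hL.ne_free hf) h2
    (by rwa [show 2 * l + 1 + (2 * m + 2 * j - 2 * l) = 2 * j + 1 + 2 * m by omega, hL.per])
  have t1 := card_inter_insert hs (hL.inter_seg_mid (j := 2 * j + 1) (d := 2 * l - 2 * j)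
    (by omega) (by omega) (by omega) (by omega)) (hL.ne_free hf _)
  have t2 := card_inter_insert hs (hL.inter_seg_end (j := 2 * l + 1) (d := 2 * m + 2 * j - 2 * l)
    (by omega) (by omega) (by omega) (by omega)) (hL.ne_free hf _)
  have k1 := hC.card_le (i := i) ⟨c1, t1⟩ (by
    intro v hv
    rcases mem_insert.1 hv with rfl | hv
    · exact Or.inl hf
    · exact hL.seg_free hv)
  have k2 := hC.card_le (i := i) ⟨c2, t2⟩ (by
    intro v hv
    rcases mem_insert.1 hv with rfl | hv
    · exact Or.inl hf
    · exact hL.seg_free hv)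
  rw [hL.card] at k1 k2
  have b1 := k1.trans ((card_insert_le _ _).trans (Nat.add_le_add_right (seg_card _ _) 1))
  have b2 := k2.trans ((card_insert_le _ _).trans (Nat.add_le_add_right (seg_card _ _) 1))
  omega

/-- Two neighbours of an outside vertex of `Y` on the same side are close. -/
theorem Lng.close (h : Ctx G X Y S n r) (hC : IsMin G S C)
    (hL : Lng G X Y S C i m p c) {z : V} (hz : z ∈ Y) (hf : Free C z) {j l : ℕ}
    (hjl : j < l) (hl : l ≤ p) (h1 : G.Adj z (c (2 * j))) (h2 : G.Adj z (c (2 * l))) :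
    l = j + 1 := by
  have hm := hL.hm
  have hpm := hL.hpm
  have c1 := hL.par.ear_one (i := 2 * l) (d := 2 * m + 2 * j - 2 * l) (by omega) (by omega)
    (hL.ne_free hf) h2
    (by rwa [show 2 * l + (2 * m + 2 * j - 2 * l) = 2 * j + 2 * m by omega, hL.per])
  have t1 := hL.inter_seg_both (j := 2 * l) (d := 2 * m + 2 * j - 2 * l)
    (by omega) (by omega) (by omega) (by omega)
  have hzS : z ∉ S := fun hs => h.not_mem_X.2 hz (h.sub hs)
  have k1 := hC.card_le (i := i) ⟨c1, by rw [inter_insert_of_notMem hzS]; exact t1⟩ (by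
    intro v hv
    rcases mem_insert.1 hv with rfl | hv
    · exact Or.inl hf
    · exact hL.seg_free hv)
  rw [hL.card] at k1
  have b1 := k1.trans ((card_insert_le _ _).trans (Nat.add_le_add_right (seg_card _ _) 1))
  omega

/-- An outside vertex of `Y` is not adjacent to both vertices in `S`. -/
theorem Lng.not_both (h : Ctx G X Y S n r) (hC : IsMin G S C)
    (hL : Lng G X Y S C i m p c) {z : V} (hz : z ∈ Y) (hf : Free C z)
    (h1 : G.Adj z (c 0)) (h2 : G.Adj z (c (2 * p))) : False := by
  have hm := hL.hm
  have hpm := hL.hpm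
  have e1 := hL.close h hC hz hf hL.hp le_rfl h1 h2
  have e2 := hL.shift.close h hC hz hf (j := 0) (l := m - p) (by omega) le_rfl (by simpa using h2)
    (by rw [show 2 * (m - p) + 2 * p = 0 + 2 * m by omega, hL.per]; exact h1)
  omega

/-- An outside four-cycle closing an edge is too short. -/
theorem Lng.no_four (h : Ctx G X Y S n r) (hC : IsMin G S C)
    (hL : Lng G X Y S C i m p c) {a b u v : V} (ha : a ∈ S) (hb : b ∈ S)
    (hu : u ∈ Y) (hv : v ∈ Y) (hab : a ≠ b) (huv : u ≠ v) (fa : Free C a ∨ a ∈ C i)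
    (fb : Free C b ∨ b ∈ C i) (fu : Free C u ∨ u ∈ C i) (fv : Free C v ∨ v ∈ C i)
    (h1 : G.Adj a u) (h2 : G.Adj a v) (h3 : G.Adj b u) (h4 : G.Adj b v) : False := by
  have k1 := hC.card_le (i := i) (h.two_four ha hb hu hv hab huv h1 h2 h3 h4) (by
    intro w hw
    simp only [mem_insert, mem_singleton] at hw
    rcases hw with rfl | rfl | rfl | rfl <;> assumption)
  rw [hL.card] at k1
  have := hL.hm
  have := Finset.card_le_four (a := a) (b := b) (c := u) (d := v)
  omega

theorem Lng.cross (h : Ctx G X Y S n r) (hC : IsMin G S C)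
    (hL : Lng G X Y S C i m p c) {s z : V} (hs : s ∈ S) (hfs : Free C s)
    (hz : z ∈ Y) (hfz : Free C z) (hsz : G.Adj s z) {j l : ℕ} (hj : j < p) (hpl : p < l)
    (hlm : l < m) (h1 : G.Adj s (c (2 * j + 1))) (h2 : G.Adj z (c (2 * l))) : m = 3 := by
  have hm := hL.hm
  have hpm := hL.hpm
  have hzS : z ∉ S := fun hs => h.not_mem_X.2 hz (h.sub hs)
  have c1 := hL.par.ear_two (i := 2 * j + 1) (d := 2 * l - 2 * j - 1) (by omega) (by omega)
    (hL.ne_free hfs) (hL.ne_free hfz) hsz h1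
    (by rwa [show 2 * j + 1 + (2 * l - 2 * j - 1) = 2 * l by omega])
  have c2 := hL.par.ear_two (i := 2 * l) (d := 2 * m + 2 * j + 1 - 2 * l) (by omega) (by omega)
    (hL.ne_free hfz) (hL.ne_free hfs) hsz.symm h2
    (by rwa [show 2 * l + (2 * m + 2 * j + 1 - 2 * l) = 2 * j + 1 + 2 * m by omega, hL.per])
  have t1 := card_inter_insert hs (hL.inter_seg_mid (j := 2 * j + 1) (d := 2 * l - 2 * j - 1)
    (by omega) (by omega) (by omega) (by omega)) (hL.ne_free hfs _)
  have t2 := card_inter_insert hs (hL.inter_seg_end (j := 2 * l) (d := 2 * m + 2 * j + 1 - 2 * l)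
    (by omega) (by omega) (by omega) (by omega)) (hL.ne_free hfs _)
  have k1 := hC.card_le (i := i) ⟨c1, by
      rw [Finset.insert_comm, inter_insert_of_notMem hzS]; exact t1⟩ (by
    intro v hv
    rw [mem_insert, mem_insert] at hv
    rcases hv with rfl | rfl | hv
    · exact Or.inl hfs
    · exact Or.inl hfz
    · exact hL.seg_free hv)
  have k2 := hC.card_le (i := i) ⟨c2, by rw [inter_insert_of_notMem hzS]; exact t2⟩ (by
    intro v hv
    rw [mem_insert, mem_insert] at hv
    rcases hv with rfl | rfl | hv
    · exact Or.inl hfz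
    · exact Or.inl hfs
    · exact hL.seg_free hv)
  rw [hL.card] at k1 k2
  have b1 := k1.trans ((card_insert_le _ _).trans (Nat.add_le_add_right
    ((card_insert_le _ _).trans (Nat.add_le_add_right (seg_card _ _) 1)) 1))
  have b2 := k2.trans ((card_insert_le _ _).trans (Nat.add_le_add_right
    ((card_insert_le _ _).trans (Nat.add_le_add_right (seg_card _ _) 1)) 1))
  omega

/-- One may choose the parametrization so that the neighbours lie on the first side. -/
theorem Lng.exists_side (h : Ctx G X Y S n r) (hC : IsMin G S C)
    (hL : Lng G X Y S C i m p c) {s : V} (hs : s ∈ S) (hf : Free C s) :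
    ∃ p c, Lng G X Y S C i m p c ∧ ∀ j, p ≤ j → j < m → ¬ G.Adj s (c (2 * j + 1)) := by
  by_cases hex : ∃ l, p ≤ l ∧ l < m ∧ G.Adj s (c (2 * l + 1))
  · obtain ⟨l, hl, hlm, hsl⟩ := hex
    refine ⟨_, _, hL.shift, fun j hj hjm hadj => ?_⟩
    have := hL.hpm
    rw [show 2 * j + 1 + 2 * p = 2 * (j + p - m) + 1 + 2 * m by omega, hL.per] at hadj
    exact hL.one_side hC hs hf (by omega) hl hlm hadj hsl
  · push Not at hex
    exact ⟨p, c, hL, hex⟩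

theorem Lng.dgX (h : Ctx G X Y S n r) (hL : Lng G X Y S C i m p c) {s : V} (hs : s ∈ X) :
    dg G s (C i) = ((range m).filter fun j => G.Adj s (c (2 * j + 1))).card := by
  rw [dg, hL.eq, hL.par.sum_image, sum_range_two_mul, card_filter]
  rw [Finset.sum_eq_zero, zero_add]
  intro j _
  rw [if_neg]
  exact fun hadj => h.not_mem_X.2 (h.adj_X hadj hs) (hL.memX j)

theorem Lng.dgY (h : Ctx G X Y S n r) (hL : Lng G X Y S C i m p c) {z : V} (hz : z ∈ Y) :
    dg G z (C i) = ((range m).filter fun j => G.Adj z (c (2 * j))).card := by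
  rw [dg, hL.eq, hL.par.sum_image, sum_range_two_mul, card_filter]
  rw [add_eq_left]
  apply Finset.sum_eq_zero
  intro j _
  rw [if_neg]
  exact fun hadj => h.not_mem_X.2 (hL.memY j) (h.adj_Y hadj hz)

theorem Lng.near_card (h : Ctx G X Y S n r) (hC : IsMin G S C)
    (hL : Lng G X Y S C i m p c) {z : V} (hz : z ∈ Y) (hf : Free C z) :
    ((range (p + 1)).filter fun j => G.Adj z (c (2 * j))).card ≤ 2 := by
  set F := (range (p + 1)).filter fun j => G.Adj z (c (2 * j)) with hF
  rcases F.eq_empty_or_nonempty with he | hne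
  · simp [he]
  · have hsub : F ⊆ {F.min' hne, F.min' hne + 1} := by
      intro j hj
      have h0 := F.min'_mem hne
      have hle := F.min'_le j hj
      simp only [hF, mem_filter, mem_range] at hj h0
      rcases hle.lt_or_eq with hlt | heq
      · have := hL.close h hC hz hf hlt (by omega) h0.2 hj.2
        simp [this]
      · simp [heq]
    exact (card_le_card hsub).trans card_le_two

theorem Lng.dgY_le (h : Ctx G X Y S n r) (hL : Lng G X Y S C i m p c) {z : V} (hz : z ∈ Y) :
    dg G z (C i) ≤ ((range (p + 1)).filter fun j => G.Adj z (c (2 * j))).card +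
      ((Ico (p + 1) m).filter fun j => G.Adj z (c (2 * j))).card := by
  rw [hL.dgY h hz]
  refine (card_le_card ?_).trans (card_union_le _ _)
  intro j hj
  simp only [mem_filter, mem_union, mem_range, mem_Ico] at hj ⊢
  rcases Nat.lt_or_ge j (p + 1) with h1 | h1
  · exact Or.inl ⟨h1, hj.2⟩
  · exact Or.inr ⟨⟨h1, hj.1⟩, hj.2⟩

theorem Lng.core (h : Ctx G X Y S n r) (hC : IsMin G S C)
    (hL : Lng G X Y S C i m p c) {s z : V} (hs : s ∈ S)
    (hz : z ∈ Y) (hfz : Free C z) (hside : ∀ j, p ≤ j → j < m → ¬ G.Adj s (c (2 * j + 1)))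
    (hsum : m + 1 ≤ dg G s (C i) + dg G z (C i)) :
    dg G s (C i) = p ∧ dg G z (C i) = m + 1 - p ∧ (∀ j < p, G.Adj s (c (2 * j + 1))) ∧
      (∀ l, p < l → l < m → G.Adj z (c (2 * l))) ∧
      ∃ j < p, G.Adj z (c (2 * j)) ∧ G.Adj z (c (2 * j + 2)) := by
  have hpm := hL.hpm
  have n2 := hL.near_card h hC hz hfz
  have zle := hL.dgY_le h hz
  have sX := hL.dgX h (h.sub hs)
  have ssub : ((range m).filter fun j => G.Adj s (c (2 * j + 1))) ⊆ range p := by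
    intro j hj
    simp only [mem_filter, mem_range] at hj ⊢
    by_contra hcon
    exact hside j (by omega) hj.1 hj.2
  have sle := card_le_card ssub
  have fle := card_filter_le (Ico (p + 1) m) (fun j => G.Adj z (c (2 * j)))
  rw [card_range] at sle
  rw [Nat.card_Ico] at fle
  refine ⟨by omega, by omega, ?_, ?_, ?_⟩
  · intro j hj
    have e := Finset.eq_of_subset_of_card_le ssub (by rw [card_range]; omega)
    have : j ∈ range p := mem_range.2 hj
    rw [← e] at this
    exact (mem_filter.1 this).2
  · intro l hl hlm
    have e := Finset.eq_of_subset_of_card_le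
      (filter_subset (fun j => G.Adj z (c (2 * j))) (Ico (p + 1) m))
      (by rw [Nat.card_Ico]; omega)
    have : l ∈ Ico (p + 1) m := mem_Ico.2 ⟨hl, hlm⟩
    rw [← e] at this
    exact (mem_filter.1 this).2
  · obtain ⟨j, hj, l, hl, hne⟩ := Finset.one_lt_card.1
      (show 1 < ((range (p + 1)).filter fun j => G.Adj z (c (2 * j))).card by omega)
    simp only [mem_filter, mem_range] at hj hl
    rcases lt_or_gt_of_ne hne with hlt | hlt
    · have := hL.close h hC hz hfz hlt (by omega) hj.2 hl.2
      subst this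
      exact ⟨j, by omega, hj.2, hl.2⟩
    · have := hL.close h hC hz hfz hlt (by omega) hl.2 hj.2
      subst this
      exact ⟨l, by omega, hl.2, hj.2⟩

/-- Replace `y` on the cycle by `z`. -/
theorem Lng.replace (h : Ctx G X Y S n r) (hC : IsMin G S C)
    (hL : Lng G X Y S C i m p c) {z : V} (hz : z ∈ Y) (hf : Free C z) {j : ℕ}
    (hj : j < p) (h1 : G.Adj z (c (2 * j))) (h2 : G.Adj z (c (2 * j + 2))) :
    ∃ C' : Fin r → Finset V, IsMin G S C' ∧
      ∀ v, Free C' v ↔ v = c (2 * j + 1) ∨ (Free C v ∧ v ≠ z) := by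
  have hm := hL.hm
  have hpm := hL.hpm
  have c1 := hL.par.ear_one (i := 2 * j + 2) (d := 2 * m - 2) (by omega) (by omega)
    (hL.ne_free hf) h2
    (by rwa [show 2 * j + 2 + (2 * m - 2) = 2 * j + 2 * m by omega, hL.per])
  have t1 := hL.inter_seg_both (j := 2 * j + 2) (d := 2 * m - 2)
    (by omega) (by omega) (by omega) (by omega)
  have hzS : z ∉ S := fun hs => h.not_mem_X.2 hz (h.sub hs)
  refine ⟨_, hC.update (i := i) ⟨c1, by rw [inter_insert_of_notMem hzS]; exact t1⟩ ?_ ?_, ?_⟩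
  · intro v hv
    rcases mem_insert.1 hv with rfl | hv
    · exact Or.inl hf
    · exact hL.seg_free hv
  · rw [hL.card]
    have := (card_insert_le z (seg c (2 * j + 2) (2 * m - 2))).trans
      (Nat.add_le_add_right (seg_card _ _) 1)
    simp only [seg] at this
    omega
  · intro v
    rw [hC.free_update]
    have hseg : v ∈ C i → (v ∉ seg c (2 * j + 2) (2 * m - 2) ↔ v = c (2 * j + 1)) := by
      intro hv
      rw [hL.eq, ← hL.par.image_shift (2 * j + 2)] at hv
      obtain ⟨t, ht, rfl⟩ := mem_image.1 hv
      rw [mem_range] at ht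
      have hlast : c (2 * j + 1) = c (2 * m - 1 + (2 * j + 2)) := by
        rw [show 2 * m - 1 + (2 * j + 2) = 2 * j + 1 + 2 * m by omega, hL.per]
      rw [mem_seg, hlast]
      constructor
      · intro hn
        by_contra hne
        apply hn
        refine ⟨t, ?_, by rw [add_comm]⟩
        by_contra hcon
        exact hne (by rw [show t = 2 * m - 1 by omega])
      · rintro e ⟨u, hu, e2⟩
        rw [e] at e2
        rw [add_comm] at e2
        have := (hL.par.shift (2 * j + 2)).inj u (2 * m - 1) (by omega) (by omega) e2
        omega
    have hsf : ∀ w, Free C w → w ∉ seg c (2 * j + 2) (2 * m - 2) := by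
      intro w hw hmem
      obtain ⟨t, -, rfl⟩ := mem_seg.1 hmem
      exact hw i (hL.mem _)
    rw [mem_insert, not_or]
    change (v ≠ z ∧ v ∉ seg c (2 * j + 2) (2 * m - 2)) ∧ _ ↔ _
    constructor
    · rintro ⟨⟨a1, a2⟩, a3 | a3⟩
      · exact Or.inr ⟨a3, a1⟩
      · exact Or.inl ((hseg a3).1 a2)
    · rintro (rfl | ⟨a1, a2⟩)
      · exact ⟨⟨hL.ne_free hf _, (hseg (hL.mem _)).2 rfl⟩, Or.inr (hL.mem _)⟩
      · exact ⟨⟨a2, hsf _ a1⟩, Or.inl a1⟩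

end Long

/-- The `i`-th member of the family is the six-cycle `a y₁ x y₂ b y₃` with `a, b ∈ S`. -/
structure Hex {V : Type*} [DecidableEq V] (G : SimpleGraph V) (X Y S : Finset V) {r : ℕ}
    (C : Fin r → Finset V) (i : Fin r) (a b x y₁ y₂ y₃ : V) : Prop where
  eq : C i = {a, b, x, y₁, y₂, y₃}
  ha : a ∈ S
  hb : b ∈ S
  hx : x ∈ X
  hxS : x ∉ S
  hab : a ≠ b
  h₁ : y₁ ∈ Y
  h₂ : y₂ ∈ Y
  h₃ : y₃ ∈ Y
  h12 : y₁ ≠ y₂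
  h13 : y₁ ≠ y₃
  h23 : y₂ ≠ y₃
  a1 : G.Adj a y₁
  x1 : G.Adj x y₁
  x2 : G.Adj x y₂
  b2 : G.Adj b y₂
  b3 : G.Adj b y₃
  a3 : G.Adj a y₃

section Long

variable {V : Type*} [Fintype V] [DecidableEq V] {G : SimpleGraph V} [DecidableRel G.Adj]
  {X Y S : Finset V} {n r : ℕ} {C : Fin r → Finset V} {i : Fin r}

/-- A lower vertex of `S` and an outer vertex of `Y` with many neighbours on a long cycle. -/
theorem Ctx.beta (h : Ctx G X Y S n r) (hC : IsMin G S C) (hi : 3 ≤ (Y ∩ C i).card) {s z : V}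
    (hs : s ∈ S ∧ Free C s) (hz : z ∈ Y ∧ Free C z)
    (hsum : (Y ∩ C i).card + 1 ≤ dg G s (C i) + dg G z (C i)) :
    dg G s (C i) + dg G z (C i) = (Y ∩ C i).card + 1 ∧ ∃ (y : V) (C' : Fin r → Finset V), y ∈ Y ∧ y ∈ C i ∧ G.Adj s y ∧
      IsMin G S C' ∧ ∀ v, Free C' v ↔ v = y ∨ (Free C v ∧ v ≠ z) := by
  obtain ⟨p, c, hL⟩ := h.exists_lng hC.1 i hi
  obtain ⟨p, c, hL, hside⟩ := hL.exists_side h hC hs.1 hs.2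
  obtain ⟨h1, h2, h3, h4, j, hj, h5, h6⟩ := hL.core h hC hs.1 hz.1 hz.2 hside hsum
  obtain ⟨C', hC', hf⟩ := hL.replace h hC hz.1 hz.2 hj h5 h6
  have := hL.hpm
  exact ⟨by omega, _, C', hL.memY j, hL.mem _, h3 j hj, hC', hf⟩

theorem Ctx.dgY_lt (h : Ctx G X Y S n r) (hC : IsMin G S C) (hi : 3 ≤ (Y ∩ C i).card) {z : V}
    (hz : z ∈ Y ∧ Free C z) : dg G z (C i) < (Y ∩ C i).card := by
  obtain ⟨p, c, hL⟩ := h.exists_lng hC.1 i hi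
  have key : ∀ {p c}, Lng G X Y S C i (Y ∩ C i).card p c →
      dg G z (C i) ≤ 2 + ((Y ∩ C i).card - (p + 1)) := by
    intro p c hL
    refine (hL.dgY_le h hz.1).trans (Nat.add_le_add (hL.near_card h hC hz.1 hz.2) ?_)
    exact (card_filter_le _ _).trans (by rw [Nat.card_Ico])
  have h1 := key hL
  have h2 := key hL.shift
  have := hL.hpm
  have := hL.hp
  omega

theorem Ctx.dgX_lt (h : Ctx G X Y S n r) (hC : IsMin G S C) (hi : 3 ≤ (Y ∩ C i).card) {s : V}
    (hs : s ∈ S ∧ Free C s) : dg G s (C i) < (Y ∩ C i).card := by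
  obtain ⟨p, c, hL⟩ := h.exists_lng hC.1 i hi
  obtain ⟨p, c, hL, hside⟩ := hL.exists_side h hC hs.1 hs.2
  rw [hL.dgX h (h.sub hs.1)]
  have : ((range (Y ∩ C i).card).filter fun j => G.Adj s (c (2 * j + 1))) ⊆ range p := by
    intro j hj
    simp only [mem_filter, mem_range] at hj ⊢
    by_contra hcon
    exact hside j (by omega) hj.1 hj.2
  have := card_le_card this
  rw [card_range] at this
  have := hL.hpm
  omega

/-- A vertex of `S` with almost all possible neighbours on a long cycle leaves little room. -/
theorem Ctx.dg_full (h : Ctx G X Y S n r) (hC : IsMin G S C) (hi : 3 ≤ (Y ∩ C i).card) {s s' : V}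
    (hs : s ∈ S ∧ Free C s) (hs' : s' ∈ S ∧ Free C s') (hne : s ≠ s')
    (hd : (Y ∩ C i).card ≤ dg G s (C i) + 1) : dg G s' (C i) ≤ 1 := by
  obtain ⟨p, c, hL⟩ := h.exists_lng hC.1 i hi
  obtain ⟨p, c, hL, hside⟩ := hL.exists_side h hC hs.1 hs.2
  have hpm := hL.hpm
  rw [hL.dgX h (h.sub hs.1)] at hd
  have hsub : ((range (Y ∩ C i).card).filter fun j => G.Adj s (c (2 * j + 1))) ⊆ range p := by
    intro j hj
    simp only [mem_filter, mem_range] at hj ⊢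
    by_contra hcon
    exact hside j (by omega) hj.1 hj.2
  have hc := card_le_card hsub
  rw [card_range] at hc
  have e := Finset.eq_of_subset_of_card_le hsub (by rw [card_range]; omega)
  have full : ∀ j < p, G.Adj s (c (2 * j + 1)) := by
    intro j hj
    have : j ∈ range p := mem_range.2 hj
    rw [← e] at this
    exact (mem_filter.1 this).2
  by_contra hcon
  rw [hL.dgX h (h.sub hs'.1), not_le, Finset.one_lt_card] at hcon
  obtain ⟨j, hj, l, hl, hjl⟩ := hcon
  simp only [mem_filter, mem_range] at hj hl
  have hin : ∀ j l, j ≠ l → j < (Y ∩ C i).card → l < (Y ∩ C i).card →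
      G.Adj s' (c (2 * j + 1)) → G.Adj s' (c (2 * l + 1)) → j < p := by
    intro j l hjl hj hl h1 h2
    by_contra hcon
    exact hL.one_side hC hs'.1 hs'.2 (j := l) (l := j) (by omega) (by omega) hj h2 h1
  have hjp := hin j l hjl hj.1 hl.1 hj.2 hl.2
  have hlp := hin l j hjl.symm hl.1 hj.1 hl.2 hj.2
  refine hL.no_four h hC hs.1 hs'.1 (hL.memY j) (hL.memY l) hne ?_ (Or.inl hs.2) (Or.inl hs'.2)
    (Or.inr (hL.mem _)) (Or.inr (hL.mem _)) (full j hjp) (full l hlp) hj.2 hl.2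
  intro e
  have := hL.par.inj _ _ (by omega) (by omega) e
  omega

theorem Ctx.dgY_adj (h : Ctx G X Y S n r) (hC : IsMin G S C) (hi : 4 ≤ (Y ∩ C i).card) {s z : V}
    (hs : s ∈ S ∧ Free C s) (hz : z ∈ Y ∧ Free C z) (hsz : G.Adj s z)
    (hd : 1 ≤ dg G s (C i)) : dg G z (C i) ≤ 2 := by
  obtain ⟨p, c, hL⟩ := h.exists_lng hC.1 i (by omega)
  obtain ⟨p, c, hL, hside⟩ := hL.exists_side h hC hs.1 hs.2
  rw [hL.dgX h (h.sub hs.1), Nat.one_le_iff_ne_zero, ← Nat.pos_iff_ne_zero, Finset.card_pos] at hd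
  obtain ⟨j, hj⟩ := hd
  simp only [mem_filter, mem_range] at hj
  have hjp : j < p := by
    by_contra hcon
    exact hside j (by omega) hj.1 hj.2
  have h1 := hL.dgY_le h hz.1
  have h2 := hL.near_card h hC hz.1 hz.2
  have h3 : ((Ico (p + 1) (Y ∩ C i).card).filter fun j => G.Adj z (c (2 * j))) = ∅ := by
    rw [Finset.filter_eq_empty_iff]
    intro l hl hadj
    rw [mem_Ico] at hl
    have := hL.cross h hC hs.1 hs.2 hz.1 hz.2 hsz hjp (by omega) hl.2 hj.2 hadj
    omega
  rw [h3, card_empty] at h1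
  omega

/-- An adjacent pair outside with too many neighbours on a long cycle. -/
theorem Ctx.tight (h : Ctx G X Y S n r) (hC : IsMin G S C) (hi : 3 ≤ (Y ∩ C i).card) {s z : V}
    (hs : s ∈ S ∧ Free C s) (hz : z ∈ Y ∧ Free C z) (hsz : G.Adj s z)
    (hsum : (Y ∩ C i).card + 1 ≤ dg G s (C i) + dg G z (C i)) :
    dg G s (C i) + dg G z (C i) = (Y ∩ C i).card + 1 ∧ 4 ≤ (Y ∩ C i).card ∧
      (∀ s', s' ∈ S ∧ Free C s' → s' ≠ s → dg G s' (C i) ≤ 1) ∧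
      ∀ z', z' ∈ Y ∧ Free C z' → dg G z' (C i) ≤ 2 := by
  obtain ⟨p, c, hL⟩ := h.exists_lng hC.1 i hi
  obtain ⟨p, c, hL, hside⟩ := hL.exists_side h hC hs.1 hs.2
  obtain ⟨h1, h2, h3, h4, j, hj, h5, h6⟩ := hL.core h hC hs.1 hz.1 hz.2 hside hsum
  have hpm := hL.hpm
  have key : ∀ k, c k ∈ S → G.Adj (c k) (c (2 * j + 1)) → G.Adj z (c k) → False := by
    intro k hk hadj hzk
    exact hL.no_four h hC hs.1 hk hz.1 (hL.memY j) (hL.ne_free hs.2 _).symm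
      (hL.ne_free hz.2 _).symm (Or.inl hs.2) (Or.inr (hL.mem _)) (Or.inl hz.2)
      (Or.inr (hL.mem _)) hsz (h3 j hj) hzk.symm hadj
  have hj0 : j ≠ 0 := by
    rintro rfl
    exact key 0 ((hL.memS 0 (by omega)).2 (by omega)) (hL.par.adj 0) h5
  have hjp : j + 1 ≠ p := by
    rintro rfl
    exact key (2 * j + 2) ((hL.memS _ (by omega)).2 (by omega)) (hL.par.adj _).symm h6
  have hp1 : p + 1 = (Y ∩ C i).card := by
    by_contra hcon
    have := hL.cross h hC hs.1 hs.2 hz.1 hz.2 hsz (j := 0) (l := p + 1) (by omega) (by omega)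
      (by omega) (h3 0 (by omega)) (h4 _ (by omega) (by omega))
    omega
  refine ⟨by omega, by omega, fun s' hs' hne => ?_, fun z' hz' => ?_⟩
  · exact h.dg_full hC hi hs hs' hne.symm (by omega)
  · have a1 := hL.dgY_le h hz'.1
    have a2 := hL.near_card h hC hz'.1 hz'.2
    rw [← hp1, Finset.Ico_self, filter_empty, card_empty] at a1
    omega

theorem Ctx.two_pairs (h : Ctx G X Y S n r) (hC : IsMin G S C) (hi : 3 ≤ (Y ∩ C i).card)
    {s s' z z' : V} (hs : s ∈ S ∧ Free C s) (hz : z ∈ Y ∧ Free C z) (hsz : G.Adj s z)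
    (hs' : s' ∈ S ∧ Free C s') (hz' : z' ∈ Y ∧ Free C z') (hsz' : G.Adj s' z') (hne : s ≠ s') :
    dg G s (C i) + dg G z (C i) + (dg G s' (C i) + dg G z' (C i)) ≤ 2 * (Y ∩ C i).card := by
  by_contra hcon
  rcases (by omega : (Y ∩ C i).card + 1 ≤ dg G s (C i) + dg G z (C i) ∨
    (Y ∩ C i).card + 1 ≤ dg G s' (C i) + dg G z' (C i)) with h1 | h1
  · obtain ⟨a1, a2, a3, a4⟩ := h.tight hC hi hs hz hsz h1
    have := a3 s' hs' hne.symm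
    have := a4 z' hz'
    omega
  · obtain ⟨a1, a2, a3, a4⟩ := h.tight hC hi hs' hz' hsz' h1
    have := a3 s hs hne
    have := a4 z hz
    omega

theorem Ctx.three_pairs (h : Ctx G X Y S n r) (hC : IsMin G S C) (hi : 3 ≤ (Y ∩ C i).card)
    {s₁ s₂ s₃ z₁ z₂ z₃ : V} (hF : Fr G S Y C [s₁, s₂, s₃] [z₁, z₂, z₃]) (e₁ : G.Adj s₁ z₁)
    (e₂ : G.Adj s₂ z₂) (e₃ : G.Adj s₃ z₃) :
    dg G s₁ (C i) + dg G z₁ (C i) + (dg G s₂ (C i) + dg G z₂ (C i)) +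
      (dg G s₃ (C i) + dg G z₃ (C i)) ≤ 3 * (Y ∩ C i).card := by
  have m1 := hF.mems s₁ (by simp)
  have m2 := hF.mems s₂ (by simp)
  have m3 := hF.mems s₃ (by simp)
  have n1 := hF.memz z₁ (by simp)
  have n2 := hF.memz z₂ (by simp)
  have n3 := hF.memz z₃ (by simp)
  have nd := hF.nds
  simp only [List.nodup_cons, List.mem_cons, List.not_mem_nil, or_false, not_or] at nd
  have := h.two_pairs hC hi m1 n1 e₁ m2 n2 e₂ nd.1.1
  have := h.two_pairs hC hi m1 n1 e₁ m3 n3 e₃ nd.1.2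
  have := h.two_pairs hC hi m2 n2 e₂ m3 n3 e₃ nd.2.1
  omega

/-- A pair at distance three outside with too many neighbours on a long cycle. -/
theorem Ctx.gamma (h : Ctx G X Y S n r) (hC : IsMin G S C) (hi : 3 ≤ (Y ∩ C i).card)
    {s z₀ s' z : V} (hs : s ∈ S ∧ Free C s) (hz : z ∈ Y ∧ Free C z) (hs' : s' ∈ S ∧ Free C s')
    (hz₀ : z₀ ∈ Y ∧ Free C z₀) (hne : s ≠ s') (hne' : z₀ ≠ z) (e1 : G.Adj s z₀)
    (e2 : G.Adj s' z₀) (e3 : G.Adj s' z)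
    (hsum : (Y ∩ C i).card + 1 ≤ dg G s (C i) + dg G z (C i)) : (Y ∩ C i).card = 3 := by
  obtain ⟨p, c, hL⟩ := h.exists_lng hC.1 i hi
  obtain ⟨p, c, hL, hside⟩ := hL.exists_side h hC hs.1 hs.2
  obtain ⟨h1, h2, h3, h4, j, hj, h5, h6⟩ := hL.core h hC hs.1 hz.1 hz.2 hside hsum
  have hpm := hL.hpm
  have key : ∀ k, c k ∈ X → c k ∉ S → G.Adj (c k) (c (2 * j + 1)) → G.Adj z (c k) →
      (Y ∩ C i).card = 3 := by
    intro k hkX hkS hadj hzk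
    have ht := h.two_six hs.1 hs'.1 hkX hkS hz₀.1 hz.1 (hL.memY j) hne hne'
      (hL.ne_free hz₀.2 _).symm (hL.ne_free hz.2 _).symm e1 e2 e3 hzk.symm hadj (h3 j hj)
    have hk := hC.card_le (i := i) ht (by
      intro w hw
      simp only [mem_insert, mem_singleton] at hw
      rcases hw with rfl | rfl | rfl | rfl | rfl | rfl
      · exact Or.inl hs.2
      · exact Or.inl hs'.2
      · exact Or.inr (hL.mem _)
      · exact Or.inl hz₀.2
      · exact Or.inl hz.2
      · exact Or.inr (hL.mem _))
    have := Finset.card_le_six (a := s) (b := s') (c := c k) (d := z₀) (e := z) (f := c (2 * j + 1))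
    rw [hL.card] at hk
    omega
  by_cases hS : c (2 * j) ∈ S
  · refine key (2 * j + 2) ?_ ?_ (hL.par.adj _).symm h6
    · have := hL.memX (j + 1)
      rwa [show 2 * (j + 1) = 2 * j + 2 by ring] at this
    · intro hS2
      rw [hL.memS _ (by omega)] at hS hS2
      obtain rfl : j = 0 := by omega
      obtain rfl : p = 1 := by omega
      exact hL.not_both h hC hz.1 hz.2 h5 h6
  · exact key (2 * j) (hL.memX j) hS (hL.par.adj _) h5

theorem Ctx.exists_hex (h : Ctx G X Y S n r) (hC : IsMin G S C) (hi : (Y ∩ C i).card = 3)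
    {s z : V} (hs : s ∈ S ∧ Free C s) (hz : z ∈ Y ∧ Free C z)
    (hsum : 4 ≤ dg G s (C i) + dg G z (C i)) :
    ∃ a b x y₁ y₂ y₃, Hex G X Y S C i a b x y₁ y₂ y₃ ∧ G.Adj s y₁ ∧ G.Adj s y₂ ∧ G.Adj x z ∧
      G.Adj a z ∧ dg G s (C i) = 2 ∧ dg G z (C i) = 2 := by
  obtain ⟨p, c, hL⟩ := h.exists_lng hC.1 i hi.ge
  obtain ⟨p, c, hL, hside⟩ := hL.exists_side h hC hs.1 hs.2
  obtain ⟨h1, h2, h3, h4, j, hj, h5, h6⟩ := hL.core h hC hs.1 hz.1 hz.2 hside (by omega)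
  rw [hi] at hL h2 h4
  have hp2 : p = 2 := by
    have := hL.hpm
    have := hL.hp
    by_contra hcon
    obtain rfl : p = 1 := by omega
    obtain rfl : j = 0 := by omega
    exact hL.not_both h hC hz.1 hz.2 h5 h6
  subst hp2
  have hne : ∀ k l, k < 6 → l < 6 → k ≠ l → c k ≠ c l := fun k l hk hl hkl e =>
    hkl (hL.par.inj k l hk hl e)
  have a0 := hL.par.adj 0
  have a1 := hL.par.adj 1
  have a2 := hL.par.adj 2
  have a3 := hL.par.adj 3
  have a4 := hL.par.adj 4
  have a5 := hL.par.adj 5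
  rw [show 5 + 1 = 0 + 2 * 3 by rfl, hL.per] at a5
  have s0 := (hL.memS 0 (by omega)).2 (by omega)
  have s4 := (hL.memS 4 (by omega)).2 (by omega)
  have s2 : c 2 ∉ S := fun hs => by have := (hL.memS 2 (by omega)).1 hs; omega
  have e1 : C i = {c 0, c 4, c 2, c 1, c 3, c 5} := by
    rw [hL.eq]
    ext v
    simp [Finset.range_add_one]
    tauto
  have y1 := hL.memY 0
  have y3 := hL.memY 1
  have y5 := hL.memY 2
  have x2 := hL.memX 1
  rcases (by omega : j = 0 ∨ j = 1) with rfl | rfl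
  · exact ⟨c 0, c 4, c 2, c 1, c 3, c 5,
      ⟨e1, s0, s4, x2, s2, hne _ _ (by omega) (by omega) (by omega), y1, y3, y5,
        hne _ _ (by omega) (by omega) (by omega), hne _ _ (by omega) (by omega) (by omega),
        hne _ _ (by omega) (by omega) (by omega), a0, a1.symm, a2, a3.symm, a4, a5.symm⟩,
      h3 0 (by omega), h3 1 (by omega), h6.symm, h5.symm, h1, h2⟩
  · refine ⟨c 4, c 0, c 2, c 3, c 1, c 5,
      ⟨?_, s4, s0, x2, s2, hne _ _ (by omega) (by omega) (by omega), y3, y1, y5,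
        hne _ _ (by omega) (by omega) (by omega), hne _ _ (by omega) (by omega) (by omega),
        hne _ _ (by omega) (by omega) (by omega), a3.symm, a2, a1.symm, a0, a5.symm, a4⟩,
      h3 1 (by omega), h3 0 (by omega), h5.symm, h6.symm, h1, h2⟩
    rw [e1]
    ext v
    simp only [mem_insert, mem_singleton]
    tauto

end Long

/-- The vertices of a three-element list as a function. -/
def row3 {V : Type*} (s₁ s₂ s₃ : V) : ℕ → V
  | 0 => s₁
  | 1 => s₂
  | _ => s₃

/-- Multiplicities of `0, …, k - 1` in a list. -/
def mult (k : ℕ) (l : List ℕ) : List ℕ := (List.range k).map fun j => l.count j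

/-- The numerical conditions of `Ctx.step`. -/
def scert (ps non base : List (ℕ × ℕ)) (A B E n₀ nt : ℕ) (ts : List (List (ℕ × ℕ)))
    (wl : List Wit) (stuck : List (List (ℕ × ℕ))) : Bool :=
  decide (A + B + E = ps.length) && (ps.all fun e => non.contains e) &&
    (ps.all fun e => decide (e.1 < 3 ∧ e.2 < nt)) &&
    (base.all fun e => decide (e.1 < 3 ∧ e.2 < nt)) &&
    decide (∑ i ∈ range 3, (ps.map fun e => if non.contains (i, e.2) then 0 else 1).sum +
      ∑ k ∈ range nt, (ps.map fun e => if non.contains (e.1, k) then 0 else 1).sum + 1 ≤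
        A * 3 + B * nt + E * n₀ + ps.length) &&
    qcert base (mult 3 (ps.map Prod.fst)) (mult nt (ps.map Prod.snd)) (2 * ps.length + 1) nt ts wl
      stuck

section Step

variable {V : Type*} [Fintype V] [DecidableEq V] {G : SimpleGraph V} [DecidableRel G.Adj]
  {X Y S : Finset V} {n r : ℕ} {C : Fin r → Finset V}

theorem sum_map_eq_count (f : ℕ → ℕ) (k : ℕ) (l : List ℕ) (hl : ∀ j ∈ l, j < k) :
    (l.map f).sum = ∑ j ∈ range k, (mult k l).getD j 0 * f j := by
  have e : ∀ j ∈ range k, (mult k l).getD j 0 * f j = l.count j * f j := by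
    intro j hj
    have hj := mem_range.1 hj
    rw [mult, List.getD_eq_getElem _ _ (by simpa using hj)]
    simp
  rw [sum_congr rfl e]
  clear e
  induction l with
  | nil => simp
  | cons a l ih =>
    rw [List.map_cons, List.sum_cons, ih fun j hj => hl j (List.mem_cons_of_mem _ hj)]
    simp only [List.count_cons, add_mul, sum_add_distrib]
    rw [add_comm]
    congr 1
    rw [sum_eq_single a]
    · simp
    · intro b _ hb
      simp [hb.symm]
    · intro ha
      exact absurd (mem_range.2 (hl a List.mem_cons_self)) ha

theorem sum_map_le {α : Type*} (l : List α) (f g : α → ℕ) (hfg : ∀ e ∈ l, f e ≤ g e) :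
    (l.map f).sum ≤ (l.map g).sum := List.sum_le_sum hfg

theorem Fr.col_mem {ss zs : List V} (hF : Fr G S Y C ss zs) (d : V) {k : ℕ} (hk : k < zs.length) :
    zs.getD k d ∈ Y ∧ Free C (zs.getD k d) := by
  rw [List.getD_eq_getElem _ _ hk]
  exact hF.memz _ (List.getElem_mem _)

theorem Fr.row_mem {s₁ s₂ s₃ : V} {zs : List V} (hF : Fr G S Y C [s₁, s₂, s₃] zs) (k : ℕ) :
    row3 s₁ s₂ s₃ k ∈ S ∧ Free C (row3 s₁ s₂ s₃ k) := by
  apply hF.mems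
  rcases k with _ | _ | k <;> simp [row3]

theorem Fr.row_inj {s₁ s₂ s₃ : V} {zs : List V} (hF : Fr G S Y C [s₁, s₂, s₃] zs) :
    Set.InjOn (row3 s₁ s₂ s₃) (range 3 : Finset ℕ) := by
  have hn := hF.nds
  simp only [List.nodup_cons, List.mem_cons, List.not_mem_nil, or_false, not_or] at hn
  intro k hk l hl e
  simp only [coe_range, Set.mem_Iio] at hk hl
  interval_cases k <;> interval_cases l <;> simp_all [row3]

theorem Fr.col_inj {ss zs : List V} (hF : Fr G S Y C ss zs) (d : V) :
    Set.InjOn (fun k => zs.getD k d) (range zs.length : Finset ℕ) := by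
  intro k hk l hl e
  simp only [coe_range, Set.mem_Iio] at hk hl
  simp only [List.getD_eq_getElem _ _ hk, List.getD_eq_getElem _ _ hl] at e
  exact (hF.ndz.getElem_inj_iff).1 e

theorem sum_flatMap_pair (k : ℕ) (f g : ℕ → ℕ) (F : (ℕ × ℕ) × ℕ → ℕ) (a b : ℕ → (ℕ × ℕ) × ℕ)
    (hf : ∀ j, F (a j) = f j) (hg : ∀ j, F (b j) = g j) :
    (((List.range k).flatMap fun j => [a j, b j]).map F).sum = ∑ j ∈ range k, (f j + g j) := by
  induction k with
  | zero => simp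
  | succ k ih =>
    rw [List.range_succ, List.flatMap_append, List.map_append, List.sum_append, ih,
      sum_range_succ]
    simp [hf, hg]

theorem Quad.weight (h : Ctx G X Y S n r) {s₁ s₂ s₃ : V} {zs : List V}
    (hF : Fr G S Y C [s₁, s₂, s₃] zs) {i : Fin r} {a b p q : V} (hQ : Quad G S Y C i a b p q)
    (hlen : zs.length ≤ 4) (d : V)
    (ps : List (ℕ × ℕ)) (hps : ∀ e ∈ ps, e.1 < 3 ∧ e.2 < zs.length) :
    (ps.map fun e => dg G (row3 s₁ s₂ s₃ e.1) (C i) + dg G (zs.getD e.2 d) (C i)).sum =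
      ((wEdges (mult 3 (ps.map Prod.fst)) (mult zs.length (ps.map Prod.snd))).map fun e => e.2 *
      if G.Adj (rowV s₁ s₂ s₃ a b e.1.1) (colV zs p q e.1.2) then 1 else 0).sum := by
  have hl : (mult zs.length (ps.map Prod.snd)).length = zs.length := by simp [mult]
  rw [wEdges, List.map_append, List.sum_append, hl]
  rw [sum_flatMap_pair 3
    (fun k => (mult 3 (ps.map Prod.fst)).getD k 0 *
      if G.Adj (rowV s₁ s₂ s₃ a b k) p then 1 else 0)
    (fun k => (mult 3 (ps.map Prod.fst)).getD k 0 *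
      if G.Adj (rowV s₁ s₂ s₃ a b k) q then 1 else 0) _ _ _ (fun _ => rfl) (fun _ => rfl)]
  rw [sum_flatMap_pair zs.length
    (fun k => (mult zs.length (ps.map Prod.snd)).getD k 0 *
      if G.Adj a (colV zs p q k) then 1 else 0)
    (fun k => (mult zs.length (ps.map Prod.snd)).getD k 0 *
      if G.Adj b (colV zs p q k) then 1 else 0) _ _ _ (fun _ => rfl) (fun _ => rfl)]
  rw [List.sum_map_add]
  have e1 := sum_map_eq_count (fun k => dg G (row3 s₁ s₂ s₃ k) (C i)) 3 (ps.map Prod.fst)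
    (by simp only [List.mem_map]; rintro j ⟨e, he, rfl⟩; exact (hps e he).1)
  have e2 := sum_map_eq_count (fun k => dg G (zs.getD k d) (C i)) zs.length (ps.map Prod.snd)
    (by simp only [List.mem_map]; rintro j ⟨e, he, rfl⟩; exact (hps e he).2)
  rw [List.map_map] at e1 e2
  simp only [Function.comp_def] at e1 e2
  rw [e1, e2]
  congr 1
  · refine sum_congr rfl fun k hk => ?_
    have hk := mem_range.1 hk
    rw [hQ.dgX h (h.sub (hF.row_mem k).1), mul_add]
    interval_cases k <;> rfl
  · refine sum_congr rfl fun k hk => ?_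
    have hk := mem_range.1 hk
    have e : colV zs p q k = zs.getD k d := by
      rw [colV, List.getD_eq_getElem _ _ hk, List.getD_eq_getElem _ _ hk]
      all_goals omega
    rw [hQ.dgY h (hF.col_mem d hk).1, mul_add, e]

/-- Averaging over the cycles of the family: some cycle receives many edges from the frame. If it
is a four-cycle, it yields a forbidden pattern or one of the patterns in `stuck`. -/
theorem Ctx.false_of_heavy (h : Ctx G X Y S n r) {s₁ s₂ s₃ : V} {zs : List V}
    (hF : Fr G S Y C [s₁, s₂, s₃] zs) (ps non base : List (ℕ × ℕ)) (A B E n₀ : ℕ)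
    (ts : List (List (ℕ × ℕ))) (wl : List Wit) (stuck : List (List (ℕ × ℕ)))
    (hcert : scert ps non base A B E n₀ zs.length ts wl stuck = true)
    (hbase : base.Forall fun e => G.Adj (row3 s₁ s₂ s₃ e.1) (zs.getD e.2 s₁))
    (hts : ts.Forall fun E => ¬ Has G S Y r E)
    (hstuck : ∀ i a b p q, Quad G S Y C i a b p q → ∀ l ∈ stuck,
      (∀ e ∈ l, G.Adj (rowV s₁ s₂ s₃ a b e.1) (colV zs p q e.2)) → False)
    (hlong : ∀ i, 3 ≤ (Y ∩ C i).card →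
      (ps.map fun e => dg G (row3 s₁ s₂ s₃ e.1) (C i) + dg G (zs.getD e.2 s₁) (C i)).sum ≤
        ps.length * (Y ∩ C i).card) {i : Fin r}
    (hi : ps.length * (Y ∩ C i).card + 1 ≤
      (ps.map fun e => dg G (row3 s₁ s₂ s₃ e.1) (C i) + dg G (zs.getD e.2 s₁) (C i)).sum) :
    False := by
  simp only [scert, Bool.and_eq_true, decide_eq_true_eq, List.all_eq_true,
    List.contains_iff_mem] at hcert
  obtain ⟨⟨⟨⟨⟨hK, hpn⟩, hps⟩, hb⟩, hH⟩, hq⟩ := hcert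
  rw [List.forall_iff_forall_mem] at hbase hts
  have hnt : zs.length ≤ 4 := by
    simp only [qcert, Bool.and_eq_true, decide_eq_true_eq] at hq
    exact hq.2
  by_cases hm : 3 ≤ (Y ∩ C i).card
  · have := hlong i hm
    omega
  have h2 : (Y ∩ C i).card = 2 := by
    obtain ⟨h1, h2⟩ := h.card_cyc (hF.min.1.two i).1
    have h3 := card_le_card (inter_subset_inter h.sub (Subset.refl (C i)))
    rw [(hF.min.1.two i).2] at h3
    omega
  obtain ⟨a, b, p, q, hQ⟩ := h.exists_quad hF.min.1 h2
  rw [h2, hQ.weight h hF hnt s₁ ps hps, mul_comm] at hi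
  have hb' : ∀ e ∈ base, G.Adj (rowV s₁ s₂ s₃ a b e.1) (colV zs p q e.2) := by
    intro e he
    have h1 := hbase e he
    obtain ⟨h3, h4⟩ := hb e he
    have e1 : rowV s₁ s₂ s₃ a b e.1 = row3 s₁ s₂ s₃ e.1 := by
      generalize e.1 = k at h3
      interval_cases k <;> rfl
    have e2 : colV zs p q e.2 = zs.getD e.2 s₁ := by
      rw [colV, List.getD_eq_getElem _ _ h4, List.getD_eq_getElem _ _ h4]
      all_goals omega
    rwa [e1, e2]
  rcases h.qcheck hF hQ base _ _ _ ts wl stuck hq hb' hi with ⟨E, hE, hhas⟩ | ⟨l, hl, hP⟩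
  · exact hts E hE hhas
  · exact hstuck i a b p q hQ l hl hP

theorem Ctx.step (h : Ctx G X Y S n r) {s₁ s₂ s₃ : V} {zs : List V}
    (hF : Fr G S Y C [s₁, s₂, s₃] zs) (ps non base : List (ℕ × ℕ)) (A B E n₀ : ℕ)
    (ts : List (List (ℕ × ℕ))) (wl : List Wit) (stuck : List (List (ℕ × ℕ)))
    (hcert : scert ps non base A B E n₀ zs.length ts wl stuck = true)
    (hn₀ : n₀ ≤ (Y ∩ rest C).card)
    (hbase : base.Forall fun e => G.Adj (row3 s₁ s₂ s₃ e.1) (zs.getD e.2 s₁))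
    (hnon : non.Forall fun e => ¬ G.Adj (row3 s₁ s₂ s₃ e.1) (zs.getD e.2 s₁))
    (hx : ∀ x ∈ X, Free C x → x ∉ [s₁, s₂, s₃] →
      (ps.map fun e => if G.Adj x (zs.getD e.2 s₁) then 1 else 0).sum ≤ A)
    (hy : ∀ y ∈ Y, Free C y → y ∉ zs →
      (ps.map fun e => if G.Adj (row3 s₁ s₂ s₃ e.1) y then 1 else 0).sum ≤ B)
    (hts : ts.Forall fun E => ¬ Has G S Y r E)
    (hstuck : ∀ i a b p q, Quad G S Y C i a b p q → ∀ l ∈ stuck,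
      (∀ e ∈ l, G.Adj (rowV s₁ s₂ s₃ a b e.1) (colV zs p q e.2)) → False)
    (hlong : ∀ i, 3 ≤ (Y ∩ C i).card →
      (ps.map fun e => dg G (row3 s₁ s₂ s₃ e.1) (C i) + dg G (zs.getD e.2 s₁) (C i)).sum ≤
        ps.length * (Y ∩ C i).card) : False := by
  have hcert' := hcert
  simp only [scert, Bool.and_eq_true, decide_eq_true_eq, List.all_eq_true,
    List.contains_iff_mem] at hcert'
  obtain ⟨⟨⟨⟨⟨hK, hpn⟩, hps⟩, hb⟩, hH⟩, hq⟩ := hcert'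
  rw [List.forall_iff_forall_mem] at hnon
  have hPm : ∀ v, v ∈ (range 3).image (row3 s₁ s₂ s₃) ↔ v ∈ [s₁, s₂, s₃] := by
    intro v
    simp [range_add_one, row3]
    tauto
  have hQm : ∀ v, v ∈ (range zs.length).image (fun k => zs.getD k s₁) ↔ v ∈ zs := by
    intro v
    simp only [mem_image, mem_range, List.mem_iff_getElem]
    constructor
    · rintro ⟨k, hk, rfl⟩
      exact ⟨k, hk, (List.getD_eq_getElem _ _ hk).symm⟩
    · rintro ⟨k, hk, rfl⟩
      exact ⟨k, hk, List.getD_eq_getElem _ _ hk⟩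
  obtain ⟨i, hi⟩ := h.exists_heavy_of_bound hF.min.1 (K := ps.length)
    (fun j => row3 s₁ s₂ s₃ (ps[j.1]).1) (fun j => zs.getD (ps[j.1]).2 s₁)
    (fun j => (hF.row_mem _).1) (fun j => (hF.col_mem _ (hps _ (List.getElem_mem _)).2).1)
    (fun j => hnon _ (hpn _ (List.getElem_mem _)))
    ((range 3).image (row3 s₁ s₂ s₃)) ((range zs.length).image (fun k => zs.getD k s₁))
    (by
      intro v hv
      have := hF.mems v ((hPm v).1 hv)
      exact ⟨h.sub this.1, this.2⟩)
    (fun v hv => hF.memz v ((hQm v).1 hv)) A B E n₀ hK hn₀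
    (by
      intro x hxX hxf hxP
      rw [hPm] at hxP
      rw [Fin.sum_univ_fun_getElem ps (fun e => if G.Adj x (zs.getD e.2 s₁) then 1 else 0)]
      exact hx x hxX hxf hxP)
    (by
      intro y hyY hyf hyQ
      rw [hQm] at hyQ
      rw [Fin.sum_univ_fun_getElem ps (fun e => if G.Adj (row3 s₁ s₂ s₃ e.1) y then 1 else 0)]
      exact hy y hyY hyf hyQ)
    (by
      rw [sum_image hF.row_inj, sum_image (hF.col_inj s₁), card_image_of_injOn hF.row_inj,
        card_image_of_injOn (hF.col_inj s₁), card_range, card_range]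
      refine le_trans (Nat.add_le_add_right (Nat.add_le_add (sum_le_sum fun k _ => ?_)
        (sum_le_sum fun k _ => ?_)) 1) hH
      · rw [Fin.sum_univ_fun_getElem ps
          (fun e => if G.Adj (row3 s₁ s₂ s₃ k) (zs.getD e.2 s₁) then 1 else 0)]
        refine sum_map_le _ _ _ fun e _ => ?_
        by_cases hc : (k, e.2) ∈ non
        · rw [if_neg (hnon _ hc)]
          omega
        · rw [if_neg hc]
          split_ifs <;> omega
      · rw [Fin.sum_univ_fun_getElem ps
          (fun e => if G.Adj (row3 s₁ s₂ s₃ e.1) (zs.getD k s₁) then 1 else 0)]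
        refine sum_map_le _ _ _ fun e _ => ?_
        by_cases hc : (e.1, k) ∈ non
        · rw [if_neg (hnon _ hc)]
          omega
        · rw [if_neg hc]
          split_ifs <;> omega)
  rw [Fin.sum_univ_fun_getElem ps (fun e => dg G (row3 s₁ s₂ s₃ e.1) (C i) +
    dg G (zs.getD e.2 s₁) (C i))] at hi
  exact h.false_of_heavy hF ps non base A B E n₀ ts wl stuck hcert hbase hts hstuck hlong hi

end Step

/-- Two vertices of `S` with two common neighbours. -/
def pW4 : List (ℕ × ℕ) := [(0, 0), (0, 1), (1, 0), (1, 1)]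

/-- A six-cycle with three vertices of `S`. -/
def pW6 : List (ℕ × ℕ) := [(0, 0), (0, 1), (1, 1), (1, 2), (2, 0), (2, 2)]

theorem cert_W6 : scert [(0, 2), (1, 0), (2, 1)]
  [(0, 2), (1, 0), (2, 1)]
  pW6 1 1 1 4 3
  [pW4]
  [(10432, 41520, 0), (10342, 51420, 0), (20143, 40251, 0), (20431, 50421, 0), (41032, 21450, 0),
   (40321, 10542, 0), (10432, 51240, 0), (40321, 40152, 0), (31042, 41520, 0), (20143, 40152, 0),
   (30241, 10254, 0), (20341, 50241, 0), (40231, 10452, 0), (30142, 10542, 0), (30241, 54021, 0),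
   (40132, 50142, 0), (10342, 41052, 0), (31042, 21054, 0), (30421, 51042, 0), (30241, 40251, 0),
   (40231, 40521, 0), (10243, 51042, 0), (21043, 42150, 0), (21043, 52041, 0), (40132, 51420, 0),
   (41032, 51042, 0), (30142, 41250, 0), (31042, 42150, 0), (30142, 40152, 0), (40132, 10254, 0),
   (20431, 50142, 0), (30241, 41052, 0), (40231, 50241, 0), (21043, 52140, 0), (40231, 41052, 0),
   (41032, 42150, 0)]
  [] = true := by decide +kernel

section Chain

variable {V : Type*} [Fintype V] [DecidableEq V] {G : SimpleGraph V} [DecidableRel G.Adj]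
  {X Y S : Finset V} {n r : ℕ} {C : Fin r → Finset V}

theorem Ctx.no_four (h : Ctx G X Y S n r) (hC : IsMin G S C) {s s' z z' : V}
    (hs : s ∈ S ∧ Free C s) (hs' : s' ∈ S ∧ Free C s') (hz : z ∈ Y ∧ Free C z)
    (hz' : z' ∈ Y ∧ Free C z') (hss : s ≠ s') (hzz : z ≠ z') (h1 : G.Adj s z) (h2 : G.Adj s z')
    (h3 : G.Adj s' z) (h4 : G.Adj s' z') : False := by
  refine h.no_free_two hC.1 (h.two_four hs.1 hs'.1 hz.1 hz'.1 hss hzz h1 h2 h3 h4) ?_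
  intro v hv
  simp only [mem_insert, mem_singleton] at hv
  rcases hv with rfl | rfl | rfl | rfl
  exacts [hs.2, hs'.2, hz.2, hz'.2]

theorem Ctx.no_W4 (h : Ctx G X Y S n r) : ¬ Has G S Y r pW4 := by
  rintro ⟨C, s, z, hF, hE⟩
  have hn := hF.nds
  have hz := hF.ndz
  simp only [List.nodup_cons, List.mem_cons, List.not_mem_nil, or_false, not_or] at hn hz
  exact h.no_four hF.min (hF.mems _ (by simp)) (hF.mems _ (by simp)) (hF.memz _ (by simp))
    (hF.memz _ (by simp)) hn.1.1 hz.1.1 (hE (0, 0) (by simp [pW4])) (hE (0, 1) (by simp [pW4]))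
    (hE (1, 0) (by simp [pW4])) (hE (1, 1) (by simp [pW4]))

theorem Ctx.no_six (h : Ctx G X Y S n r) (hC : IsMin G S C) {s s' x y₁ y₂ y₃ : V}
    (hs : s ∈ S ∧ Free C s) (hs' : s' ∈ S ∧ Free C s') (hx : x ∈ X) (hxS : x ∉ S)
    (hxf : Free C x) (hy₁ : y₁ ∈ Y ∧ Free C y₁) (hy₂ : y₂ ∈ Y ∧ Free C y₂)
    (hy₃ : y₃ ∈ Y ∧ Free C y₃) (hss : s ≠ s') (h12 : y₁ ≠ y₂) (h13 : y₁ ≠ y₃) (h23 : y₂ ≠ y₃)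
    (e1 : G.Adj s y₁) (e2 : G.Adj s' y₁) (e3 : G.Adj s' y₂) (e4 : G.Adj x y₂) (e5 : G.Adj x y₃)
    (e6 : G.Adj s y₃) : False := by
  refine h.no_free_two hC.1 (h.two_six hs.1 hs'.1 hx hxS hy₁.1 hy₂.1 hy₃.1 hss h12 h13 h23
    e1 e2 e3 e4 e5 e6) ?_
  intro v hv
  simp only [mem_insert, mem_singleton] at hv
  rcases hv with rfl | rfl | rfl | rfl | rfl | rfl
  exacts [hs.2, hs'.2, hxf, hy₁.2, hy₂.2, hy₃.2]

theorem not_has {E : List (ℕ × ℕ)} (hE : E.all (fun e => decide (e.1 < 3 ∧ e.2 < 3)) = true)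
    (H : ∀ (C : Fin r → Finset V) (s₁ s₂ s₃ z₁ z₂ z₃ : V), Fr G S Y C [s₁, s₂, s₃] [z₁, z₂, z₃] →
      E.Forall (fun e => G.Adj (row3 s₁ s₂ s₃ e.1) (row3 z₁ z₂ z₃ e.2)) → False) :
    ¬ Has G S Y r E := by
  rintro ⟨C, s, z, hF, hEd⟩
  refine H C _ _ _ _ _ _ hF (List.forall_iff_forall_mem.2 fun e he => ?_)
  have h3 := List.all_eq_true.1 hE e he
  simp only [decide_eq_true_eq] at h3
  have key : ∀ (f : ℕ → V) (k : ℕ), k < 3 → row3 (f 0) (f 1) (f 2) k = f k := by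
    intro f k hk
    interval_cases k <;> rfl
  rw [key _ _ h3.1, key _ _ h3.2]
  exact hEd e he

/-- A frame is everything outside the family if it has the right size. -/
theorem Fr.mem_of_length (h : Ctx G X Y S n r) {ss zs : List V} (hF : Fr G S Y C ss zs)
    (hl : ss.length = zs.length) (hc : (Y ∩ rest C).card ≤ zs.length) {v : V} (hv : Free C v) :
    v ∈ ss ∨ v ∈ zs := by
  have hX : ss.toFinset = X ∩ rest C := by
    refine Finset.eq_of_subset_of_card_le (fun v hv => ?_) ?_
    · have := hF.mems v (List.mem_toFinset.1 hv)
      exact mem_inter.2 ⟨h.sub this.1, mem_rest.2 this.2⟩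
    · rw [List.toFinset_card_of_nodup hF.nds, (h.card_rest hF.min.1).1]
      omega
  have hY : zs.toFinset = Y ∩ rest C := by
    refine Finset.eq_of_subset_of_card_le (fun v hv => ?_) ?_
    · have := hF.memz v (List.mem_toFinset.1 hv)
      exact mem_inter.2 ⟨this.1, mem_rest.2 this.2⟩
    · rw [List.toFinset_card_of_nodup hF.ndz]
      omega
  by_cases hvX : v ∈ X
  · left
    rw [← List.mem_toFinset, hX]
    exact mem_inter.2 ⟨hvX, mem_rest.2 hv⟩
  · right
    rw [← List.mem_toFinset, hY]
    exact mem_inter.2 ⟨h.not_mem_X.1 hvX, mem_rest.2 hv⟩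

theorem Fr.facts {s₁ s₂ s₃ z₁ z₂ z₃ : V} (hF : Fr G S Y C [s₁, s₂, s₃] [z₁, z₂, z₃]) :
    (s₁ ∈ S ∧ Free C s₁) ∧ (s₂ ∈ S ∧ Free C s₂) ∧ (s₃ ∈ S ∧ Free C s₃) ∧
      (z₁ ∈ Y ∧ Free C z₁) ∧ (z₂ ∈ Y ∧ Free C z₂) ∧ (z₃ ∈ Y ∧ Free C z₃) ∧
      s₁ ≠ s₂ ∧ s₁ ≠ s₃ ∧ s₂ ≠ s₃ ∧ z₁ ≠ z₂ ∧ z₁ ≠ z₃ ∧ z₂ ≠ z₃ := by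
  have hn := hF.nds
  have hz := hF.ndz
  simp only [List.nodup_cons, List.mem_cons, List.not_mem_nil, or_false, not_or] at hn hz
  exact ⟨hF.mems s₁ (by simp), hF.mems s₂ (by simp), hF.mems s₃ (by simp), hF.memz z₁ (by simp),
    hF.memz z₂ (by simp), hF.memz z₃ (by simp), hn.1.1, hn.1.2, hn.2.1, hz.1.1, hz.1.2, hz.2.1⟩

theorem IsMin.fr (hC : IsMin G S C) {s₁ s₂ s₃ z₁ z₂ z₃ : V} (m₁ : s₁ ∈ S ∧ Free C s₁)
    (m₂ : s₂ ∈ S ∧ Free C s₂) (m₃ : s₃ ∈ S ∧ Free C s₃) (k₁ : z₁ ∈ Y ∧ Free C z₁)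
    (k₂ : z₂ ∈ Y ∧ Free C z₂) (k₃ : z₃ ∈ Y ∧ Free C z₃) (n₁₂ : s₁ ≠ s₂) (n₁₃ : s₁ ≠ s₃)
    (n₂₃ : s₂ ≠ s₃) (l₁₂ : z₁ ≠ z₂) (l₁₃ : z₁ ≠ z₃) (l₂₃ : z₂ ≠ z₃) :
    Fr G S Y C [s₁, s₂, s₃] [z₁, z₂, z₃] where
  min := hC
  nds := by simp [n₁₂, n₁₃, n₂₃]
  ndz := by simp [l₁₂, l₁₃, l₂₃]
  mems v hv := by
    simp only [List.mem_cons, List.not_mem_nil, or_false] at hv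
    rcases hv with rfl | rfl | rfl <;> assumption
  memz v hv := by
    simp only [List.mem_cons, List.not_mem_nil, or_false] at hv
    rcases hv with rfl | rfl | rfl <;> assumption

theorem Ctx.W6_false (h : Ctx G X Y S n r) {s₁ s₂ s₃ z₁ z₂ z₃ : V}
    (hF : Fr G S Y C [s₁, s₂, s₃] [z₁, z₂, z₃]) (e11 : G.Adj s₁ z₁) (e12 : G.Adj s₁ z₂)
    (e22 : G.Adj s₂ z₂) (e23 : G.Adj s₂ z₃) (e31 : G.Adj s₃ z₁) (e33 : G.Adj s₃ z₃) : False := by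
  have hC := hF.min
  obtain ⟨m1, m2, m3, k1, k2, k3, n12, n13, n23, l12, l13, l23⟩ := hF.facts
  have N13 : ¬ G.Adj s₁ z₃ := fun e => h.no_four hC m1 m2 k2 k3 n12 l23 e12 e e22 e23
  have N21 : ¬ G.Adj s₂ z₁ := fun e => h.no_four hC m1 m2 k1 k2 n12 l12 e11 e12 e e22
  have N32 : ¬ G.Adj s₃ z₂ := fun e => h.no_four hC m1 m3 k1 k2 n13 l12 e11 e12 e31 e
  have hR : 4 ≤ (Y ∩ rest C).card := by
    by_contra hR
    have hns : ∀ z ∈ Y, z ∉ S := fun z hz hzs => h.not_mem_X.2 hz (h.sub hzs)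
    have hne : ∀ s ∈ S, ∀ z ∈ Y, s ≠ z := fun s hs z hz => h.ne (h.sub hs) hz
    refine h.no_cover hC.1 (isCyc_six e12 e22 e23 e33 e31 e11 ?_) ?_ ?_ ?_
    · have := hne s₁ m1.1
      have := hne s₂ m2.1
      have := hne s₃ m3.1
      simp only [List.nodup_cons, List.mem_cons, List.not_mem_nil, or_false, not_or]
      grind
    · have : S ∩ {s₁, s₂, s₃, z₂, z₃, z₁} = {s₁, s₂, s₃} := by
        ext v
        simp only [mem_inter, mem_insert, mem_singleton]
        have := hns z₁ k1.1
        have := hns z₂ k2.1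
        have := hns z₃ k3.1
        have := m1.1
        have := m2.1
        have := m3.1
        grind
      rw [this, card_eq_three]
      exact ⟨s₁, s₂, s₃, n12, n13, n23, rfl⟩
    · intro v hv
      simp only [mem_insert, mem_singleton] at hv
      rcases hv with rfl | rfl | rfl | rfl | rfl | rfl
      exacts [m1.2, m2.2, m3.2, k2.2, k3.2, k1.2]
    · intro v hv
      have := hF.mem_of_length h rfl (by simp only [List.length_cons, List.length_nil]; omega) hv
      simp only [List.mem_cons, List.not_mem_nil, or_false] at this
      simp only [mem_insert, mem_singleton]
      tauto
  refine h.step hF _ _ _ _ _ _ _ _ _ _ cert_W6 hR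
    (And.intro e11 (And.intro e12 (And.intro e22 (And.intro e23 (And.intro e31 e33)))))
    (And.intro N13 (And.intro N21 N32)) ?_ ?_ h.no_W4 (by simp) ?_
  · intro x hxX hxf hx
    simp only [List.mem_cons, List.not_mem_nil, or_false, not_or] at hx
    have a12 : G.Adj x z₁ → G.Adj x z₂ → False := fun u v => by
      by_cases hxS : x ∈ S
      · exact h.no_four hC m1 ⟨hxS, hxf⟩ k1 k2 (Ne.symm hx.1) l12 e11 e12 u v
      · exact h.no_six hC m3 m2 hxX hxS hxf k3 k2 k1 n23.symm l23.symm l13.symm l12.symm e33 e23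
          e22 v u e31
    have a23 : G.Adj x z₂ → G.Adj x z₃ → False := fun u v => by
      by_cases hxS : x ∈ S
      · exact h.no_four hC m2 ⟨hxS, hxf⟩ k2 k3 (Ne.symm hx.2.1) l23 e22 e23 u v
      · exact h.no_six hC m1 m3 hxX hxS hxf k1 k3 k2 n13 l13 l12 l23.symm e11 e31 e33 v u e12
    have a13 : G.Adj x z₁ → G.Adj x z₃ → False := fun u v => by
      by_cases hxS : x ∈ S
      · exact h.no_four hC m3 ⟨hxS, hxf⟩ k1 k3 (Ne.symm hx.2.2) l13 e31 e33 u v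
      · exact h.no_six hC m1 m2 hxX hxS hxf k2 k3 k1 n12 l23 l12.symm l13.symm e12 e22 e23 v u e11
    simp
    split_ifs <;> first | omega | tauto
  · intro y hyY hyf hy
    simp only [List.mem_cons, List.not_mem_nil, or_false, not_or] at hy
    have a12 : G.Adj s₁ y → G.Adj s₂ y → False := fun u v =>
      h.no_four hC m1 m2 k2 ⟨hyY, hyf⟩ n12 (Ne.symm hy.2.1) e12 u e22 v
    have a23 : G.Adj s₂ y → G.Adj s₃ y → False := fun u v =>
      h.no_four hC m2 m3 k3 ⟨hyY, hyf⟩ n23 (Ne.symm hy.2.2) e23 u e33 v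
    have a13 : G.Adj s₁ y → G.Adj s₃ y → False := fun u v =>
      h.no_four hC m1 m3 k1 ⟨hyY, hyf⟩ n13 (Ne.symm hy.1) e11 u e31 v
    simp [row3]
    split_ifs <;> first | omega | tauto
  · intro i hi
    have := h.three_pairs hC hi hF e11 e22 e33
    simp [row3]
    omega

theorem Ctx.no_W6 (h : Ctx G X Y S n r) : ¬ Has G S Y r pW6 :=
  not_has (by decide) fun _ _ _ _ _ _ _ hF ⟨e1, e2, e3, e4, e5, e6⟩ =>
    h.W6_false hF e1 e2 e3 e4 e5 e6

/-- There is no hexagon outside the family containing two vertices of `S`. -/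
theorem Ctx.no_hex (h : Ctx G X Y S n r) (hC : IsMin G S C) {s s' x y₁ y₂ y₃ : V}
    (hs : s ∈ S ∧ Free C s) (hs' : s' ∈ S ∧ Free C s') (hx : x ∈ X) (hxf : Free C x)
    (hy₁ : y₁ ∈ Y ∧ Free C y₁) (hy₂ : y₂ ∈ Y ∧ Free C y₂) (hy₃ : y₃ ∈ Y ∧ Free C y₃)
    (hss : s ≠ s') (hxs : x ≠ s) (hxs' : x ≠ s') (h12 : y₁ ≠ y₂) (h13 : y₁ ≠ y₃) (h23 : y₂ ≠ y₃)
    (e1 : G.Adj s y₁) (e2 : G.Adj s' y₁) (e3 : G.Adj s' y₂) (e4 : G.Adj x y₂) (e5 : G.Adj x y₃)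
    (e6 : G.Adj s y₃) : False := by
  by_cases hxS : x ∈ S
  · exact h.W6_false (hC.fr hs hs' ⟨hxS, hxf⟩ hy₃ hy₁ hy₂ hss hxs.symm hxs'.symm h13.symm h23.symm
      h12) e6 e1 e2 e3 e5 e4
  · exact h.no_six hC hs hs' hx hxS hxf hy₁ hy₂ hy₃ hss h12 h13 h23 e1 e2 e3 e4 e5 e6

/-- Edges from `s₁, s₂, s₃` to `{z₂, z₃}, {z₁, z₂}, {z₁}`. -/
def pP6 : List (ℕ × ℕ) := [(0, 1), (0, 2), (1, 0), (1, 1), (2, 0)]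

theorem cert_P6 : scert [(0, 0), (1, 2), (2, 1)]
  [(0, 0), (1, 2), (2, 1), (2, 2)]
  pP6 2 1 0 0 3
  [pW4, pW6]
  [(10432, 41250, 0), (10342, 51240, 0), (30421, 21540, 0), (40321, 21450, 0), (30241, 42510, 0),
   (40231, 52410, 0), (32410, 54012, 1), (30241, 52041, 0), (30421, 41250, 0), (41032, 51240, 0),
   (43210, 52014, 1), (30241, 51240, 0), (30142, 21450, 0), (40231, 21540, 0), (10243, 51042, 0),
   (30241, 54210, 0), (42310, 54012, 1), (21043, 40251, 0), (40231, 42051, 0), (10243, 41250, 0),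
   (40231, 54210, 0), (40321, 42501, 1), (42310, 50412, 1), (30241, 21450, 0), (30421, 52401, 1),
   (40321, 52140, 0), (10243, 51240, 0), (40132, 42150, 0), (31042, 10254, 0), (30421, 21450, 0),
   (40321, 41250, 0), (41032, 41250, 0), (30421, 52140, 0), (40321, 21540, 0), (40132, 21540, 0),
   (32410, 40512, 1), (10342, 41250, 0), (30241, 21054, 0), (30241, 52410, 0), (31042, 41250, 0)]
  [] = true := by decide +kernel

theorem Ctx.P6_false (h : Ctx G X Y S n r) {s₁ s₂ s₃ z₁ z₂ z₃ : V}
    (hF : Fr G S Y C [s₁, s₂, s₃] [z₁, z₂, z₃]) (e12 : G.Adj s₁ z₂) (e13 : G.Adj s₁ z₃)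
    (e21 : G.Adj s₂ z₁) (e22 : G.Adj s₂ z₂) (e31 : G.Adj s₃ z₁) : False := by
  have hC := hF.min
  obtain ⟨m1, m2, m3, k1, k2, k3, n12, n13, n23, l12, l13, l23⟩ := hF.facts
  have N11 : ¬ G.Adj s₁ z₁ := fun e => h.no_four hC m1 m2 k1 k2 n12 l12 e e12 e21 e22
  have N23 : ¬ G.Adj s₂ z₃ := fun e => h.no_four hC m1 m2 k2 k3 n12 l23 e12 e13 e22 e
  have N32 : ¬ G.Adj s₃ z₂ := fun e => h.no_four hC m2 m3 k1 k2 n23 l12 e21 e22 e31 e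
  have N33 : ¬ G.Adj s₃ z₃ := fun e =>
    h.no_hex hC m1 m2 (h.sub m3.1) m3.2 k2 k1 k3 n12 n13.symm n23.symm l12.symm l23 l13 e12 e22
      e21 e31 e e13
  refine h.step hF _ _ _ _ _ _ _ _ _ _ cert_P6 (Nat.zero_le _)
    (And.intro e12 (And.intro e13 (And.intro e21 (And.intro e22 e31))))
    (And.intro N11 (And.intro N23 (And.intro N32 N33))) ?_ ?_ (And.intro h.no_W4 h.no_W6)
    (by simp) ?_
  · intro x hxX hxf hx
    simp only [List.mem_cons, List.not_mem_nil, or_false, not_or] at hx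
    have a13 : G.Adj x z₁ → G.Adj x z₃ → False := fun u v =>
      h.no_hex hC m1 m2 hxX hxf k2 k1 k3 n12 hx.1 hx.2.1 l12.symm l23 l13 e12 e22 e21 u v e13
    simp
    split_ifs <;> first | omega | tauto
  · intro y hyY hyf hy
    simp only [List.mem_cons, List.not_mem_nil, or_false, not_or] at hy
    have a12 : G.Adj s₁ y → G.Adj s₂ y → False := fun u v =>
      h.no_four hC m1 m2 k2 ⟨hyY, hyf⟩ n12 (Ne.symm hy.2.1) e12 u e22 v
    have a23 : G.Adj s₂ y → G.Adj s₃ y → False := fun u v =>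
      h.no_four hC m2 m3 k1 ⟨hyY, hyf⟩ n23 (Ne.symm hy.1) e21 u e31 v
    have a13 : G.Adj s₁ y → G.Adj s₃ y → False := fun u v =>
      h.no_hex hC m1 m2 (h.sub m3.1) m3.2 k2 k1 ⟨hyY, hyf⟩ n12 n13.symm n23.symm l12.symm
        (Ne.symm hy.2.1) (Ne.symm hy.1) e12 e22 e21 e31 v u
    simp [row3]
    split_ifs <;> first | omega | tauto
  · intro i hi
    have := h.three_pairs hC hi (hF.sel [0, 1, 2] [2, 1, 0] (by decide) (by decide)) e13 e22 e31
    simp [row3]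
    omega

theorem Ctx.no_P6 (h : Ctx G X Y S n r) : ¬ Has G S Y r pP6 :=
  not_has (by decide) fun _ _ _ _ _ _ _ hF ⟨e1, e2, e3, e4, e5⟩ => h.P6_false hF e1 e2 e3 e4 e5

end Chain

section Swaps

variable {V : Type*} [Fintype V] [DecidableEq V] {G : SimpleGraph V} [DecidableRel G.Adj]
  {X Y S : Finset V} {n r : ℕ} {C : Fin r → Finset V}

theorem Ctx.beta_fr (h : Ctx G X Y S n r) {s₁ s₂ s₃ z₁ z₂ z₃ : V}
    (hF : Fr G S Y C [s₁, s₂, s₃] [z₁, z₂, z₃]) {i : Fin r} (hi : 3 ≤ (Y ∩ C i).card) {s : V}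
    (hs : s ∈ S ∧ Free C s)
    (H : ∀ (y : V) (C' : Fin r → Finset V), Fr G S Y C' [s₁, s₂, s₃] [z₁, z₂, y] →
      G.Adj s y → False) : dg G s (C i) + dg G z₃ (C i) ≤ (Y ∩ C i).card := by
  have hC := hF.min
  obtain ⟨m1, m2, m3, k1, k2, k3, n12, n13, n23, l12, l13, l23⟩ := hF.facts
  by_contra hcon
  obtain ⟨-, y, C', hyY, hyC, hsy, hC', hf⟩ := h.beta hC hi hs k3 (by omega)
  have hne : ∀ {v : V}, Free C v → v ≠ y := fun hv e => hv i (e ▸ hyC)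
  have hs' : ∀ {v : V}, v ∈ S → v ≠ z₃ := fun hv => h.ne (h.sub hv) k3.1
  refine H y C' (hC'.fr ⟨m1.1, ?_⟩ ⟨m2.1, ?_⟩ ⟨m3.1, ?_⟩ ⟨k1.1, ?_⟩ ⟨k2.1, ?_⟩ ⟨hyY, ?_⟩ n12 n13
    n23 l12 (hne k1.2) (hne k2.2)) hsy
  · exact (hf _).2 (Or.inr ⟨m1.2, hs' m1.1⟩)
  · exact (hf _).2 (Or.inr ⟨m2.2, hs' m2.1⟩)
  · exact (hf _).2 (Or.inr ⟨m3.2, hs' m3.1⟩)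
  · exact (hf _).2 (Or.inr ⟨k1.2, l13⟩)
  · exact (hf _).2 (Or.inr ⟨k2.2, l23⟩)
  · exact (hf _).2 (Or.inl rfl)

/-- Exchange a four-cycle of the family for another one. -/
theorem Ctx.quad_swap (h : Ctx G X Y S n r) {s₁ s₂ s₃ a b p q : V} {zs : List V}
    (hF : Fr G S Y C [s₁, s₂, s₃] zs) {i : Fin r} (hQ : Quad G S Y C i a b p q)
    (nt : ℕ) (is js : List ℕ) (hnt : zs.length = nt ∧ nt ≤ 4)
    (hi : is.Nodup ∧ ∀ k ∈ is, k ∈ [0, 1, 2, 3, 4])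
    (hj : js.Nodup ∧ ∀ k ∈ js, k ∈ List.range nt ++ [4, 5])
    (i₃ i₄ j₃ j₄ : ℕ) (hi' : i₃ ∈ [0, 1, 2, 3, 4] ∧ i₄ ∈ [0, 1, 2, 3, 4] ∧ i₃ ≠ i₄ ∧ i₃ ∉ is ∧ i₄ ∉ is)
    (hj' : j₃ ∈ List.range nt ++ [4, 5] ∧ j₄ ∈ List.range nt ++ [4, 5] ∧
      j₃ ≠ j₄ ∧ j₃ ∉ js ∧ j₄ ∉ js)
    (e33 : G.Adj (rowV s₁ s₂ s₃ a b i₃) (colV zs p q j₃))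
    (e34 : G.Adj (rowV s₁ s₂ s₃ a b i₃) (colV zs p q j₄))
    (e43 : G.Adj (rowV s₁ s₂ s₃ a b i₄) (colV zs p q j₃))
    (e44 : G.Adj (rowV s₁ s₂ s₃ a b i₄) (colV zs p q j₄)) :
    Fr G S Y (Function.update C i {rowV s₁ s₂ s₃ a b i₃, rowV s₁ s₂ s₃ a b i₄, colV zs p q j₃,
      colV zs p q j₄}) (is.map (rowV s₁ s₂ s₃ a b)) (js.map (colV zs p q)) := by
  obtain ⟨rfl, hlen⟩ := hnt
  obtain ⟨hr1, hr2⟩ := hQ.rows hF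
  obtain ⟨hc1, hc2⟩ := hQ.cols hF hlen
  have hxy : ∀ k ∈ [0, 1, 2, 3, 4], ∀ l ∈ List.range zs.length ++ [4, 5],
      rowV s₁ s₂ s₃ a b k ≠ colV zs p q l :=
    fun k hk l hl => h.ne (h.sub (hr1 k hk).1) (hc1 l hl).1
  have h2 := h.two_four (hr1 _ hi'.1).1 (hr1 _ hi'.2.1).1 (hc1 _ hj'.1).1 (hc1 _ hj'.2.1).1
    (fun e => hi'.2.2.1 (hr2 _ hi'.1 _ hi'.2.1 e)) (fun e => hj'.2.2.1 (hc2 _ hj'.1 _ hj'.2.1 e))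
    e33 e34 e43 e44
  refine hF.min.swap_frame h2 ?_ ?_ (hi.1.map_on ?_) (hj.1.map_on ?_) ?_ ?_
  · intro v hv
    simp only [mem_insert, mem_singleton] at hv
    rcases hv with rfl | rfl | rfl | rfl
    exacts [(hr1 _ hi'.1).2, (hr1 _ hi'.2.1).2, (hc1 _ hj'.1).2, (hc1 _ hj'.2.1).2]
  · rw [hQ.card h]
    exact Finset.card_le_four
  · exact fun k hk l hl => hr2 k (hi.2 k hk) l (hi.2 l hl)
  · exact fun k hk l hl => hc2 k (hj.2 k hk) l (hj.2 l hl)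
  · intro v hv
    obtain ⟨k, hk, rfl⟩ := List.mem_map.1 hv
    have hk' := hi.2 k hk
    refine ⟨(hr1 k hk').1, ?_, (hr1 k hk').2⟩
    simp only [mem_insert, mem_singleton, not_or]
    refine ⟨fun e => ?_, fun e => ?_, hxy _ hk' _ hj'.1, hxy _ hk' _ hj'.2.1⟩
    · exact hi'.2.2.2.1 (hr2 _ hk' _ hi'.1 e ▸ hk)
    · exact hi'.2.2.2.2 (hr2 _ hk' _ hi'.2.1 e ▸ hk)
  · intro v hv
    obtain ⟨k, hk, rfl⟩ := List.mem_map.1 hv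
    have hk' := hj.2 k hk
    refine ⟨(hc1 k hk').1, ?_, (hc1 k hk').2⟩
    simp only [mem_insert, mem_singleton, not_or]
    refine ⟨(hxy _ hi'.1 _ hk').symm, (hxy _ hi'.2.1 _ hk').symm, fun e => ?_, fun e => ?_⟩
    · exact hj'.2.2.2.1 (hc2 _ hk' _ hj'.1 e ▸ hk)
    · exact hj'.2.2.2.2 (hc2 _ hk' _ hj'.2.1 e ▸ hk)

theorem Quad.symmX {i : Fin r} {a b p q : V} (hQ : Quad G S Y C i a b p q) :
    Quad G S Y C i b a p q where
  eq := by
    rw [hQ.eq]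
    ext v
    simp only [mem_insert, mem_singleton]
    tauto
  ha := hQ.hb
  hb := hQ.ha
  hp := hQ.hp
  hq := hQ.hq
  hab := hQ.hab.symm
  hpq := hQ.hpq
  ap := hQ.bp
  aq := hQ.bq
  bp := hQ.ap
  bq := hQ.aq

theorem Quad.symmY {i : Fin r} {a b p q : V} (hQ : Quad G S Y C i a b p q) :
    Quad G S Y C i a b q p where
  eq := by
    rw [hQ.eq]
    ext v
    simp only [mem_insert, mem_singleton]
    tauto
  ha := hQ.ha
  hb := hQ.hb
  hp := hQ.hq
  hq := hQ.hp
  hab := hQ.hab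
  hpq := hQ.hpq.symm
  ap := hQ.aq
  aq := hQ.ap
  bp := hQ.bq
  bq := hQ.bp

theorem Quad.congr {C' : Fin r → Finset V} {i : Fin r} {a b p q : V}
    (hQ : Quad G S Y C i a b p q) (e : C' i = C i) : Quad G S Y C' i a b p q where
  eq := e.trans hQ.eq
  ha := hQ.ha
  hb := hQ.hb
  hp := hQ.hp
  hq := hQ.hq
  hab := hQ.hab
  hpq := hQ.hpq
  ap := hQ.ap
  aq := hQ.aq
  bp := hQ.bp
  bq := hQ.bq

/-- The certificate of `Ctx.two_check`; the second frame uses row `ρ` and column `κ` in place of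
row `2` and column `2`. -/
def tcert (base : List (ℕ × ℕ)) (wE : List ((ℕ × ℕ) × ℕ)) (T ρ κ : ℕ)
    (ts : List (List (ℕ × ℕ))) (wl wl' : List Wit) : Bool :=
  (wl.all (witValid [0, 1, 2, 3, 4] [0, 1, 2, 4, 5] ts.length)) &&
  (wl'.all (witValid [0, 1, 2, 3, 4] [0, 1, 2, 4, 5] ts.length)) &&
  ((wl ++ wl').all fun w => (witEdges ts w).all fun e => decide (e.1 < 5 ∧ e.2 ≠ 3)) &&
  ecert base wE T (wl.map (witEdges ts) ++ wl'.map fun w => (witEdges ts w).map fun e =>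
    (if e.1 = 2 then ρ else e.1, if e.2 = 2 then κ else e.2))

/-- A four-cycle receiving many edges from two frames which differ in at most two vertices. -/
theorem Ctx.two_check (h : Ctx G X Y S n r) {C' : Fin r → Finset V} {s₁ s₂ s₃ s₃' z₁ z₂ z₃ z₃' : V}
    (hF : Fr G S Y C [s₁, s₂, s₃] [z₁, z₂, z₃]) (hF' : Fr G S Y C' [s₁, s₂, s₃'] [z₁, z₂, z₃'])
    {i : Fin r} {a b p q : V} (hQ : Quad G S Y C i a b p q) (hi : C' i = C i)
    (P : ℕ → ℕ → Prop) [∀ k l, Decidable (P k l)] (ρ κ : ℕ)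
    (hP : ∀ k l, k < 5 → l ≠ 3 → P k l → G.Adj (rowV s₁ s₂ s₃ a b k) (colV [z₁, z₂, z₃] p q l))
    (hP' : ∀ k l, k < 5 → l ≠ 3 → P (if k = 2 then ρ else k) (if l = 2 then κ else l) →
      G.Adj (rowV s₁ s₂ s₃' a b k) (colV [z₁, z₂, z₃'] p q l))
    (base : List (ℕ × ℕ)) (wE : List ((ℕ × ℕ) × ℕ)) (T : ℕ)
    (ts : List (List (ℕ × ℕ))) (wl wl' : List Wit) (hcert : tcert base wE T ρ κ ts wl wl' = true)
    (hbase : ∀ e ∈ base, P e.1 e.2)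
    (hT : T ≤ (wE.map fun e => e.2 * if P e.1.1 e.1.2 then 1 else 0).sum) :
    ∃ E ∈ ts, Has G S Y r E := by
  simp only [tcert, Bool.and_eq_true, List.all_eq_true, decide_eq_true_eq] at hcert
  obtain ⟨⟨⟨hv, hv'⟩, hb⟩, hs⟩ := hcert
  obtain ⟨l, hl, hlP⟩ := exists_pattern P _ _ _ _ hs hbase hT
  rcases List.mem_append.1 hl with hl | hl
  · obtain ⟨w, hw, rfl⟩ := List.mem_map.1 hl
    obtain ⟨hc1, hc2⟩ := hQ.cols hF (by simp)
    obtain ⟨hr1, hr2⟩ := hQ.rows hF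
    exact h.has_of_wit hF.min i (hQ.card h) _ _ _ _ hr1 hc1 hr2 hc2 ts w (hv w hw)
      fun e he => hP _ _ (hb w (List.mem_append_left _ hw) e he).1
        (hb w (List.mem_append_left _ hw) e he).2 (hlP e he)
  · obtain ⟨w, hw, rfl⟩ := List.mem_map.1 hl
    have hQ' := hQ.congr hi
    obtain ⟨hc1, hc2⟩ := hQ'.cols hF' (by simp)
    obtain ⟨hr1, hr2⟩ := hQ'.rows hF'
    exact h.has_of_wit hF'.min i (hQ'.card h) _ _ _ _ hr1 hc1 hr2 hc2 ts w (hv' w hw)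
      fun e he => hP' _ _ (hb w (List.mem_append_right _ hw) e he).1
        (hb w (List.mem_append_right _ hw) e he).2 (hlP _ (List.mem_map_of_mem he))

end Swaps

/-- Edges from `s₁, s₂, s₃` to `{z₁, z₂, z₃}, {z₂}, {z₁}`. -/
def pSX : List (ℕ × ℕ) := [(0, 0), (0, 1), (0, 2), (1, 1), (2, 0)]

theorem cert_SX : scert [(1, 2), (2, 2)]
  [(1, 0), (1, 2), (2, 1), (2, 2)]
  pSX 2 0 0 0 3
  [pW4, pW6, pP6]
  [(43201, 42510, 2), (43102, 42501, 2), (43201, 52410, 2), (43102, 52401, 2)]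
  [[(1, 4), (1, 5), (2, 4), (3, 2)],
   [(1, 4), (1, 5), (2, 5), (3, 2)],
   [(1, 4), (2, 4), (2, 5), (3, 2)],
   [(1, 5), (2, 4), (2, 5), (3, 2)],
   [(1, 4), (1, 5), (2, 4), (4, 2)],
   [(1, 4), (1, 5), (2, 5), (4, 2)],
   [(1, 4), (2, 4), (2, 5), (4, 2)],
   [(1, 5), (2, 4), (2, 5), (4, 2)]] = true := by decide +kernel

theorem cert_SX_spider : tcert
  [(0, 0), (0, 1), (0, 2), (1, 1), (2, 0), (3, 4), (3, 5), (4, 4), (4, 5), (5, 2)]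
  [((1, 4), 1), ((1, 5), 1), ((2, 4), 1), ((2, 5), 1),
   ((5, 4), 1), ((5, 5), 1), ((3, 0), 1), ((3, 1), 1),
   ((3, 2), 1), ((4, 0), 1), ((4, 1), 1), ((4, 2), 1)]
  7 5 2
  [pW4, pW6, pP6]
  [(31420, 41205, 2), (41320, 51204, 2), (31204, 51420, 2), (43102, 42501, 2), (42103, 40521, 2),
   (40132, 20154, 0), (30142, 10254, 0), (43102, 52401, 2), (43120, 41205, 2), (32410, 40215, 2),
   (42310, 40215, 2), (31204, 41520, 2), (42103, 50421, 2), (30142, 21054, 0), (40132, 21054, 0)]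
  [(32104, 42501, 2), (42103, 52401, 2), (41320, 41025, 2), (43201, 40512, 2), (41203, 41502, 2),
   (32410, 42015, 2), (43102, 50421, 2), (31420, 41025, 2), (42310, 42015, 2), (30142, 20154, 0),
   (40132, 10254, 0)] = true := by decide +kernel

section SX

variable {V : Type*} [Fintype V] [DecidableEq V] {G : SimpleGraph V} [DecidableRel G.Adj]
  {X Y S : Finset V} {n r : ℕ} {C : Fin r → Finset V}

theorem Ctx.SX_nonadj (h : Ctx G X Y S n r) {s₁ s₂ s₃ z₁ z₂ z₃ : V}
    (hF : Fr G S Y C [s₁, s₂, s₃] [z₁, z₂, z₃]) (e11 : G.Adj s₁ z₁) (e12 : G.Adj s₁ z₂)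
    (e13 : G.Adj s₁ z₃) (e22 : G.Adj s₂ z₂) (e31 : G.Adj s₃ z₁) :
    ¬ G.Adj s₂ z₁ ∧ ¬ G.Adj s₂ z₃ ∧ ¬ G.Adj s₃ z₂ ∧ ¬ G.Adj s₃ z₃ := by
  have hC := hF.min
  obtain ⟨m1, m2, m3, k1, k2, k3, n12, n13, n23, l12, l13, l23⟩ := hF.facts
  exact ⟨fun e => h.no_four hC m1 m2 k1 k2 n12 l12 e11 e12 e e22,
    fun e => h.no_four hC m1 m2 k2 k3 n12 l23 e12 e13 e22 e,
    fun e => h.no_four hC m1 m3 k1 k2 n13 l12 e11 e12 e31 e,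
    fun e => h.no_four hC m1 m3 k1 k3 n13 l13 e11 e13 e31 e⟩

theorem Ctx.SX_leaf (h : Ctx G X Y S n r) {s₁ s₂ s₃ z₁ z₂ z₃ y : V}
    (hF : Fr G S Y C [s₁, s₂, s₃] [z₁, z₂, z₃]) (e11 : G.Adj s₁ z₁) (e12 : G.Adj s₁ z₂)
    (e22 : G.Adj s₂ z₂) (e31 : G.Adj s₃ z₁) (hyY : y ∈ Y) (hyf : Free C y)
    (hy : y ∉ [z₁, z₂, z₃]) : ¬ G.Adj s₂ y ∧ ¬ G.Adj s₃ y := by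
  have hF' := hF.consZ hyY hyf hy
  constructor
  · intro e
    exact h.P6_false (hF'.sel [1, 0, 2] [1, 2, 0] (by decide) (by decide)) e22 e e11 e12 e31
  · intro e
    exact h.P6_false (hF'.sel [2, 0, 1] [2, 1, 0] (by decide) (by decide)) e31 e e12 e11 e22

theorem Ctx.SX_spider (h : Ctx G X Y S n r) {s₁ s₂ s₃ z₁ z₂ z₃ a b p q : V}
    (hF : Fr G S Y C [s₁, s₂, s₃] [z₁, z₂, z₃]) (e11 : G.Adj s₁ z₁) (e12 : G.Adj s₁ z₂)
    (e13 : G.Adj s₁ z₃) (e22 : G.Adj s₂ z₂) (e31 : G.Adj s₃ z₁) {i : Fin r}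
    (hQ : Quad G S Y C i a b p q) (ea : G.Adj a z₃) (ep : G.Adj s₃ p) (eq : G.Adj s₃ q)
    (ep' : G.Adj s₂ p) : False := by
  have hC := hF.min
  obtain ⟨m1, m2, m3, k1, k2, k3, n12, n13, n23, l12, l13, l23⟩ := hF.facts
  obtain ⟨N21, N23, N32, N33⟩ := h.SX_nonadj hF e11 e12 e13 e22 e31
  have hF' := h.quad_swap hF hQ 3 [0, 1, 3] [0, 1, 2] (by simp) (by decide) (by decide) 2 4 4 5
    (by decide) (by decide) ep eq hQ.bp hQ.bq
  set C' := Function.update C i {rowV s₁ s₂ s₃ a b 2, rowV s₁ s₂ s₃ a b 4,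
    colV [z₁, z₂, z₃] p q 4, colV [z₁, z₂, z₃] p q 5} with hC'
  change Fr G S Y C' [s₁, s₂, a] [z₁, z₂, z₃] at hF'
  have hCC : ∀ j, j ≠ i → C' j = C j := fun j hj => Function.update_of_ne hj _ _
  obtain ⟨m1', m2', m3', k1', k2', k3', n12', n13', n23', -, -, -⟩ := hF'.facts
  have Na1 : ¬ G.Adj a z₁ := fun e => h.no_four hF'.min m1' m3' k1' k3' n13' l13 e11 e13 e ea
  have Na2 : ¬ G.Adj a z₂ := fun e => h.no_four hF'.min m1' m3' k2' k3' n13' l23 e12 e13 e ea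
  have Nb1 : ¬ G.Adj b z₁ := fun e =>
    h.P6_false (h.quad_swap hF hQ 3 [3, 0, 1] [1, 2, 5] (by simp) (by decide) (by decide) 4 2 0 4
      (by decide) (by decide) e hQ.bp e31 ep) ea hQ.aq e12 e13 e22
  have Nb2 : ¬ G.Adj b z₂ := fun e =>
    h.W6_false (h.quad_swap hF hQ 3 [0, 3, 2] [0, 2, 5] (by simp) (by decide) (by decide) 4 1 1 4
      (by decide) (by decide) e hQ.bp e22 ep') e11 e13 ea hQ.aq e31 eq
  have Nb3 : ¬ G.Adj b z₃ := fun e =>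
    h.P6_false (h.quad_swap hF hQ 3 [2, 0, 1] [1, 0, 5] (by simp) (by decide) (by decide) 3 4 2 4
      (by decide) (by decide) ea hQ.ap e hQ.bp) e31 eq e12 e11 e22
  have hQ2 : (Y ∩ C i).card = 2 := by
    have h1 := (h.card_cyc (hC.1.two i).1).2
    rw [hQ.card h] at h1
    omega
  have hY' : ∀ y ∈ Y, Free C y → y ∉ [z₁, z₂, z₃] → ¬ G.Adj s₂ y ∧ ¬ G.Adj s₃ y ∧ ¬ G.Adj a y := by
    intro y hyY hyf hy
    obtain ⟨h1, h2⟩ := h.SX_leaf hF e11 e12 e22 e31 hyY hyf hy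
    refine ⟨h1, h2, (h.SX_leaf (hF'.sel [0, 1, 2] [2, 1, 0] (by decide) (by decide)) e13 e12 e22 ea
      hyY ?_ ?_).2⟩
    · rw [hC', hC.free_update]
      refine ⟨?_, Or.inl hyf⟩
      simp only [mem_insert, mem_singleton, not_or]
      refine ⟨(h.ne (h.sub m3.1) hyY).symm, (h.ne (h.sub hQ.hb) hyY).symm, fun e => hyf i ?_,
        fun e => hyf i ?_⟩
      · rw [hQ.eq, e]
        simp [colV]
      · rw [hQ.eq, e]
        simp [colV]
    · simp only [List.mem_cons, List.not_mem_nil, or_false, not_or] at hy ⊢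
      exact ⟨hy.2.2, hy.2.1, hy.1⟩
  have hD := h.sum_dg_rest_le hC.1 ![s₂, s₃, a] ![z₃, z₂, z₁]
    (by simp [Fin.forall_fin_succ, h.sub m2.1, h.sub m3.1, h.sub hQ.ha])
    (by simp [Fin.forall_fin_succ, k1.1, k2.1, k3.1]) {s₁, s₂, s₃} {z₁, z₂, z₃}
    (by simp [h.sub m1.1, h.sub m2.1, h.sub m3.1, m1.2, m2.2, m3.2])
    (by simp [k1, k2, k3]) 3 0
    (by
      intro x _ _ _
      simp only [Fin.sum_univ_three]
      split_ifs <;> omega)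
    (by
      intro y hyY hyf hy
      have := hY' y hyY hyf (by simpa using hy)
      simp [-Finset.sum_boole, Fin.sum_univ_three, this])
  rw [sum_insert (by simp [n12, n13]), sum_insert (by simp [n23]), sum_singleton,
    sum_insert (by simp [l12, l13]), sum_insert (by simp [l23]), sum_singleton,
    card_insert_of_notMem (by simp [n12, n13]), card_insert_of_notMem (by simp [n23]),
    card_singleton] at hD
  simp [-Finset.sum_boole, Fin.sum_univ_three, N21, N23, N32, N33, Na1, Na2, e11, e12, e13, e22, e31, ea] at hD
  have hf : dg G s₂ (C i) + dg G z₃ (C i) + (dg G s₃ (C i) + dg G z₂ (C i)) +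
      (dg G a (C i) + dg G z₁ (C i)) ≤ 7 := by
    rw [hQ.dgX h (h.sub m2.1), hQ.dgX h (h.sub m3.1), hQ.dgX h (h.sub hQ.ha), hQ.dgY h k1.1,
      hQ.dgY h k2.1, hQ.dgY h k3.1]
    simp only [Na1, Na2, Nb1, Nb2, Nb3, ea, if_true, if_false]
    split_ifs <;> omega
  obtain ⟨j, hji, hj⟩ := h.exists_heavy_ne hC.1 i ![s₂, s₃, a] ![z₃, z₂, z₁]
    (by simp [Fin.forall_fin_succ, m2.1, m3.1, hQ.ha])
    (by simp [Fin.forall_fin_succ, k1.1, k2.1, k3.1])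
    (by simp [Fin.forall_fin_succ, N23, N32, Na1])
    (by
      simp [Fin.sum_univ_three]
      omega)
  simp only [Fin.sum_univ_three, Matrix.cons_val] at hj
  by_cases hm : 3 ≤ (Y ∩ C j).card
  · have hcj := hCC j hji
    by_cases h3 : (Y ∩ C j).card = 3
    · have t1 : ¬ 4 ≤ dg G s₂ (C j) + dg G z₂ (C j) := fun hs => by
        have := (h.tight hC hm m2 k2 e22 (by omega)).2.1
        omega
      have t2 : ¬ 4 ≤ dg G s₃ (C j) + dg G z₁ (C j) := fun hs => by
        have := (h.tight hC hm m3 k1 e31 (by omega)).2.1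
        omega
      have t3 : ¬ 4 ≤ dg G a (C j) + dg G z₃ (C j) := fun hs => by
        have := (h.tight hF'.min (i := j) (by rw [hcj]; exact hm) m3' k3' ea
          (by rw [hcj]; omega)).2.1
        rw [hcj] at this
        omega
      omega
    · have t1 := mt (h.gamma hC hm m2 k3 m1 k2 n12.symm l23 e22 e12 e13) h3
      have t2 := mt (h.gamma hC hm m3 k2 m1 k1 n13.symm l12 e31 e11 e12) h3
      have t3 := mt (h.gamma hF'.min (i := j) (by rw [hcj]; exact hm) m3' k1' m1' k3' n13'.symm
        l13.symm ea e13 e11) (by rw [hcj]; exact h3)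
      rw [hcj] at t3
      omega
  have h2 : (Y ∩ C j).card = 2 := by
    obtain ⟨h1, h2⟩ := h.card_cyc (hC.1.two j).1
    have h3 := card_le_card (inter_subset_inter h.sub (Subset.refl (C j)))
    rw [(hC.1.two j).2] at h3
    omega
  obtain ⟨c, d, u, v, hR⟩ := h.exists_quad hC.1 h2
  rw [h2, hR.dgX h (h.sub m2.1), hR.dgX h (h.sub m3.1), hR.dgX h (h.sub hQ.ha), hR.dgY h k1.1,
      hR.dgY h k2.1, hR.dgY h k3.1] at hj
  obtain ⟨E, hE, hHas⟩ := h.two_check hF hF' hR (hCC j hji)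
    (fun k l => G.Adj (if k = 5 then a else rowV s₁ s₂ s₃ c d k) (colV [z₁, z₂, z₃] u v l)) 5 2
    (by
      intro k l hk _ hP
      rwa [if_neg (by omega)] at hP)
    (by
      intro k l hk _ hP
      have e : (if (if k = 2 then 5 else k) = 5 then a else rowV s₁ s₂ s₃ c d (if k = 2 then 5 else k))
          = rowV s₁ s₂ a c d k := by
        interval_cases k <;> rfl
      rw [e] at hP
      have e' : (if l = 2 then 2 else l) = l := by
        split_ifs <;> omega
      rwa [e'] at hP) _ _ _ _ _ _ cert_SX_spider
    (by simp [rowV, colV, e11, e12, e13, e22, e31, ea, hR.ap, hR.aq, hR.bp, hR.bq])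
    (by
      simp only [List.map_cons, List.map_nil, List.sum_cons, List.sum_nil, rowV, colV,
        List.getD_cons_zero, List.getD_cons_succ, reduceIte, Nat.reduceEqDiff, one_mul]
      omega)
  simp only [List.mem_cons, List.not_mem_nil, or_false] at hE
  rcases hE with rfl | rfl | rfl
  exacts [h.no_W4 hHas, h.no_W6 hHas, h.no_P6 hHas]

end SX

section SX

variable {V : Type*} [Fintype V] [DecidableEq V] {G : SimpleGraph V} [DecidableRel G.Adj]
  {X Y S : Finset V} {n r : ℕ} {C : Fin r → Finset V}

theorem Ctx.SX_false (h : Ctx G X Y S n r) {s₁ s₂ s₃ z₁ z₂ z₃ : V}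
    (hF : Fr G S Y C [s₁, s₂, s₃] [z₁, z₂, z₃]) (e11 : G.Adj s₁ z₁) (e12 : G.Adj s₁ z₂)
    (e13 : G.Adj s₁ z₃) (e22 : G.Adj s₂ z₂) (e31 : G.Adj s₃ z₁) : False := by
  obtain ⟨N21, N23, N32, N33⟩ := h.SX_nonadj hF e11 e12 e13 e22 e31
  have hG : Fr G S Y C [s₁, s₃, s₂] [z₂, z₁, z₃] :=
    hF.sel [0, 2, 1] [1, 0, 2] (by decide) (by decide)
  refine h.step hF _ _ _ _ _ _ _ _ _ _ cert_SX (Nat.zero_le _)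
    (And.intro e11 (And.intro e12 (And.intro e13 (And.intro e22 e31))))
    (And.intro N21 (And.intro N23 (And.intro N32 N33))) ?_ ?_
    (And.intro h.no_W4 (And.intro h.no_W6 h.no_P6)) ?_ ?_
  · intro x hxX hxf hx
    simp
    split_ifs <;> omega
  · intro y hyY hyf hy
    obtain ⟨h1, h2⟩ := h.SX_leaf hF e11 e12 e22 e31 hyY hyf hy
    simp [row3, h1, h2]
  · intro i a b p q hQ l hl hlE
    simp only [List.mem_cons, List.not_mem_nil, or_false] at hl
    rcases hl with rfl | rfl | rfl | rfl | rfl | rfl | rfl | rfl <;>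
      simp [rowV, colV] at hlE <;> obtain ⟨f1, f2, f3, f4⟩ := hlE
    · exact h.SX_spider hG e12 e11 e13 e31 e22 hQ f4 f1 f2 f3
    · exact h.SX_spider hG e12 e11 e13 e31 e22 hQ.symmY f4 f2 f1 f3
    · exact h.SX_spider hF e11 e12 e13 e22 e31 hQ f4 f2 f3 f1
    · exact h.SX_spider hF e11 e12 e13 e22 e31 hQ.symmY f4 f3 f2 f1
    · exact h.SX_spider hG e12 e11 e13 e31 e22 hQ.symmX f4 f1 f2 f3
    · exact h.SX_spider hG e12 e11 e13 e31 e22 hQ.symmX.symmY f4 f2 f1 f3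
    · exact h.SX_spider hF e11 e12 e13 e22 e31 hQ.symmX f4 f2 f3 f1
    · exact h.SX_spider hF e11 e12 e13 e22 e31 hQ.symmX.symmY f4 f3 f2 f1
  · intro i hi
    obtain ⟨m1, m2, m3, -⟩ := hF.facts
    have h1 := h.beta_fr hF hi m2 fun y C' hF' e =>
      h.P6_false (hF'.sel [1, 0, 2] [0, 1, 2] (by decide) (by decide)) e22 e e11 e12 e31
    have h2 := h.beta_fr hF hi m3 fun y C' hF' e =>
      h.P6_false (hF'.sel [2, 0, 1] [1, 0, 2] (by decide) (by decide)) e31 e e12 e11 e22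
    simp [row3]
    omega

theorem Ctx.no_SX (h : Ctx G X Y S n r) : ¬ Has G S Y r pSX :=
  not_has (by decide) fun _ _ _ _ _ _ _ hF ⟨e1, e2, e3, e4, e5⟩ =>
    h.SX_false hF e1 e2 e3 e4 e5

end SX

/-- Edges from `s₁, s₂, s₃` to `{z₁, z₃}, {z₁, z₂}, {z₁}`. -/
def pSY : List (ℕ × ℕ) := [(0, 0), (0, 2), (1, 0), (1, 1), (2, 0)]

theorem cert_T3 : scert [(0, 2), (1, 3), (2, 1)]
  [(0, 2), (0, 3), (1, 1), (1, 3), (2, 1), (2, 2)]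
  [(0, 0), (0, 1), (1, 0), (1, 2), (2, 0), (2, 3)] 1 1 1 0 4
  [pW4, pW6, pP6, pSX]
  [(30421, 41203, 2), (40321, 51203, 2), (31420, 42105, 2), (41320, 52104, 2), (30421, 51204, 2),
   (40312, 41305, 2), (41320, 42103, 2), (31420, 52103, 2), (32401, 54201, 2), (30412, 54302, 2),
   (32401, 53204, 2), (42301, 53201, 2), (31402, 42301, 2), (31420, 54103, 2), (20413, 40325, 3),
   (41302, 52301, 2), (32410, 43102, 2), (30412, 41305, 2)]
  [] = true := by decide +kernel

theorem cert_SY : scert [(2, 1), (2, 2)]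
  [(0, 1), (1, 2), (2, 1), (2, 2)]
  pSY 1 0 1 0 3
  [pW4, pW6, pP6, pSX]
  [(32410, 54201, 2), (32401, 54102, 2), (42310, 54201, 2), (42301, 54102, 2)]
  [[(2, 4), (3, 1), (3, 2), (4, 1)],
   [(2, 5), (3, 1), (3, 2), (4, 1)],
   [(2, 4), (3, 1), (4, 1), (4, 2)],
   [(2, 5), (3, 1), (4, 1), (4, 2)],
   [(2, 4), (3, 1), (3, 2), (4, 2)],
   [(2, 5), (3, 1), (3, 2), (4, 2)],
   [(2, 4), (3, 2), (4, 1), (4, 2)],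
   [(2, 5), (3, 2), (4, 1), (4, 2)]] = true := by decide +kernel

theorem cert_SY_spider : tcert
  [(0, 0), (0, 2), (1, 0), (1, 1), (2, 0), (2, 3), (3, 4), (3, 5), (4, 4), (4, 5)]
  [((0, 4), 1), ((0, 5), 1), ((1, 4), 1), ((1, 5), 1),
   ((2, 4), 1), ((2, 5), 1), ((3, 1), 1), ((3, 2), 1),
   ((3, 3), 1), ((4, 1), 1), ((4, 2), 1), ((4, 3), 1)]
  7 2 3
  [pW4, pW6, pP6]
  [(30421, 42105, 2), (40321, 52104, 2), (30214, 52410, 2), (40213, 42510, 2), (32410, 54201, 2),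
   (31420, 51204, 2), (41203, 41520, 2), (40213, 52410, 2), (42301, 54102, 2), (41320, 41205, 2),
   (21043, 50142, 0), (10243, 40152, 0), (40321, 42105, 2), (41320, 51204, 2), (31420, 41205, 2),
   (20143, 50142, 0), (21043, 40152, 0)]
  [(31024, 41520, 2), (41023, 51420, 2), (40321, 54102, 2), (21043, 50142, 0), (30421, 54102, 2),
   (20143, 40152, 0), (10243, 50142, 0), (32014, 42510, 2), (32014, 52410, 2)] = true := by decide +kernel

section SY

variable {V : Type*} [Fintype V] [DecidableEq V] {G : SimpleGraph V} [DecidableRel G.Adj]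
  {X Y S : Finset V} {n r : ℕ} {C : Fin r → Finset V}

/-- Three vertices with a common neighbour cannot all have further private neighbours. -/
theorem Ctx.T3_false (h : Ctx G X Y S n r) {s₁ s₂ s₃ z y₁ y₂ y₃ : V}
    (hF : Fr G S Y C [s₁, s₂, s₃] [z, y₁, y₂, y₃]) (e1 : G.Adj s₁ z) (e2 : G.Adj s₂ z)
    (e3 : G.Adj s₃ z) (f1 : G.Adj s₁ y₁) (f2 : G.Adj s₂ y₂) (f3 : G.Adj s₃ y₃) : False := by
  have hC := hF.min
  have hG : Fr G S Y C [s₁, s₂, s₃] [y₁, y₂, y₃] :=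
    hF.sel [0, 1, 2] [1, 2, 3] (by decide) (by decide)
  obtain ⟨m1, m2, m3, k1, k2, k3, n12, n13, n23, l12, l13, l23⟩ := hG.facts
  have hz := hF.memz z (by simp)
  have hnd := hF.ndz
  simp only [List.nodup_cons, List.mem_cons, List.not_mem_nil, or_false, not_or] at hnd
  obtain ⟨⟨d1, d2, d3⟩, -⟩ := hnd
  have N12 : ¬ G.Adj s₁ y₂ := fun e => h.no_four hC m1 m2 hz k2 n12 d2 e1 e e2 f2
  have N13 : ¬ G.Adj s₁ y₃ := fun e => h.no_four hC m1 m3 hz k3 n13 d3 e1 e e3 f3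
  have N21 : ¬ G.Adj s₂ y₁ := fun e => h.no_four hC m1 m2 hz k1 n12 d1 e1 f1 e2 e
  have N23 : ¬ G.Adj s₂ y₃ := fun e => h.no_four hC m2 m3 hz k3 n23 d3 e2 e e3 f3
  have N31 : ¬ G.Adj s₃ y₁ := fun e => h.no_four hC m1 m3 hz k1 n13 d1 e1 f1 e3 e
  have N32 : ¬ G.Adj s₃ y₂ := fun e => h.no_four hC m2 m3 hz k2 n23 d2 e2 f2 e3 e
  refine h.step hF _ _ _ _ _ _ _ _ _ _ cert_T3 (Nat.zero_le _)
    (And.intro e1 (And.intro f1 (And.intro e2 (And.intro f2 (And.intro e3 f3)))))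
    (And.intro N12 (And.intro N13 (And.intro N21 (And.intro N23 (And.intro N31 N32))))) ?_ ?_
    (And.intro h.no_W4 (And.intro h.no_W6 (And.intro h.no_P6 h.no_SX))) (by simp) ?_
  · intro x hxX hxf hx
    simp only [List.mem_cons, List.not_mem_nil, or_false, not_or] at hx
    have a12 : G.Adj x y₁ → G.Adj x y₂ → False := fun u v =>
      h.no_hex hC m1 m2 hxX hxf hz k2 k1 n12 hx.1 hx.2.1 d2 d1 l12.symm e1 e2 f2 v u f1
    have a13 : G.Adj x y₁ → G.Adj x y₃ → False := fun u v =>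
      h.no_hex hC m1 m3 hxX hxf hz k3 k1 n13 hx.1 hx.2.2 d3 d1 l13.symm e1 e3 f3 v u f1
    have a23 : G.Adj x y₂ → G.Adj x y₃ → False := fun u v =>
      h.no_hex hC m2 m3 hxX hxf hz k3 k2 n23 hx.2.1 hx.2.2 d3 d2 l23.symm e2 e3 f3 v u f2
    simp
    split_ifs <;> first | omega | tauto
  · intro y hyY hyf hy
    simp only [List.mem_cons, List.not_mem_nil, or_false, not_or] at hy
    have hne : z ≠ y := fun e => hy.1 e.symm
    have a12 : G.Adj s₁ y → G.Adj s₂ y → False := fun u v =>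
      h.no_four hC m1 m2 hz ⟨hyY, hyf⟩ n12 hne e1 u e2 v
    have a13 : G.Adj s₁ y → G.Adj s₃ y → False := fun u v =>
      h.no_four hC m1 m3 hz ⟨hyY, hyf⟩ n13 hne e1 u e3 v
    have a23 : G.Adj s₂ y → G.Adj s₃ y → False := fun u v =>
      h.no_four hC m2 m3 hz ⟨hyY, hyf⟩ n23 hne e2 u e3 v
    simp [row3]
    split_ifs <;> first | omega | tauto
  · intro i hi
    have := h.three_pairs hC hi hG f1 f2 f3
    simp [row3]
    omega

theorem Hex.symm {i : Fin r} {a b x y₁ y₂ y₃ : V} (hH : Hex G X Y S C i a b x y₁ y₂ y₃) :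
    Hex G X Y S C i b a x y₂ y₁ y₃ where
  eq := by
    rw [hH.eq]
    ext v
    simp only [mem_insert, mem_singleton]
    tauto
  ha := hH.hb
  hb := hH.ha
  hx := hH.hx
  hxS := hH.hxS
  hab := hH.hab.symm
  h₁ := hH.h₂
  h₂ := hH.h₁
  h₃ := hH.h₃
  h12 := hH.h12.symm
  h13 := hH.h23
  h23 := hH.h13
  a1 := hH.b2
  x1 := hH.x2
  x2 := hH.x1
  b2 := hH.a1
  b3 := hH.a3
  a3 := hH.b3

theorem Hex.cases_dgY {i : Fin r} {a b x y₁ y₂ y₃ z : V} (hH : Hex G X Y S C i a b x y₁ y₂ y₃)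
    (h : Ctx G X Y S n r) (hz : z ∈ Y) (hd : 1 ≤ dg G z (C i)) :
    G.Adj a z ∨ G.Adj b z ∨ G.Adj x z := by
  by_contra hcon
  push Not at hcon
  have : dg G z (C i) = 0 := by
    refine sum_eq_zero fun v hv => if_neg fun e => ?_
    rw [hH.eq] at hv
    simp only [mem_insert, mem_singleton] at hv
    rcases hv with rfl | rfl | rfl | rfl | rfl | rfl
    · exact hcon.1 e.symm
    · exact hcon.2.1 e.symm
    · exact hcon.2.2 e.symm
    · exact h.not_mem_X.2 hH.h₁ (h.adj_Y e hz)
    · exact h.not_mem_X.2 hH.h₂ (h.adj_Y e hz)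
    · exact h.not_mem_X.2 hH.h₃ (h.adj_Y e hz)
  omega

theorem Hex.cases_dgX {i : Fin r} {a b x y₁ y₂ y₃ s : V} (hH : Hex G X Y S C i a b x y₁ y₂ y₃)
    (h : Ctx G X Y S n r) (hs : s ∈ X) (hd : 1 ≤ dg G s (C i)) :
    G.Adj s y₁ ∨ G.Adj s y₂ ∨ G.Adj s y₃ := by
  by_contra hcon
  push Not at hcon
  have : dg G s (C i) = 0 := by
    refine sum_eq_zero fun v hv => if_neg fun e => ?_
    rw [hH.eq] at hv
    simp only [mem_insert, mem_singleton] at hv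
    rcases hv with rfl | rfl | rfl | rfl | rfl | rfl
    · exact h.not_mem_X.2 (h.adj_X e hs) (h.sub hH.ha)
    · exact h.not_mem_X.2 (h.adj_X e hs) (h.sub hH.hb)
    · exact h.not_mem_X.2 (h.adj_X e hs) hH.hx
    · exact hcon.1 e
    · exact hcon.2.1 e
    · exact hcon.2.2 e
  omega

/-- Exchange a six-cycle of the family for one through three of its vertices. -/
theorem Ctx.hex_frame (h : Ctx G X Y S n r) {s t u z₀ z w a b x y₁ y₂ y₃ : V}
    (hF : Fr G S Y C [s, t, u] [z₀, z, w]) {i : Fin r} (hi : (Y ∩ C i).card = 3)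
    (hH : Hex G X Y S C i a b x y₁ y₂ y₃) (e1 : G.Adj s z₀) (e2 : G.Adj u z₀) (e3 : G.Adj s z)
    (e4 : G.Adj x z) (e5 : G.Adj u y₁) : ∃ C' : Fin r → Finset V, Fr G S Y C' [b, a, t] [w, y₃, y₂] := by
  have hC := hF.min
  obtain ⟨m1, m2, m3, k1, k2, k3, n12, n13, n23, l12, l13, l23⟩ := hF.facts
  have hin : ∀ v, v ∈ C i ↔ v ∈ ({a, b, x, y₁, y₂, y₃} : Finset V) := fun v => by rw [hH.eq]
  have ne : ∀ {v w : V}, Free C v → w ∈ ({a, b, x, y₁, y₂, y₃} : Finset V) → v ≠ w :=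
    fun hv hw e => hv i ((hin _).2 (e ▸ hw))
  have hy0 : y₁ ∈ Y ∧ y₂ ∈ Y ∧ y₃ ∈ Y := ⟨hH.h₁, hH.h₂, hH.h₃⟩
  have hab : ∀ v ∈ X, ∀ y ∈ Y, v ≠ y := fun v hv y hy => h.ne hv hy
  have hax : a ≠ x := fun e => hH.hxS (e ▸ hH.ha)
  have hbx : b ≠ x := fun e => hH.hxS (e ▸ hH.hb)
  have two := h.two_six m3.1 m1.1 hH.hx hH.hxS k1.1 k2.1 hH.h₁ n13.symm l12
    (ne k1.2 (by simp)) (ne k2.2 (by simp)) e2 e1 e3 e4 hH.x1 e5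
  refine ⟨_, hC.swap_frame (i := i) two ?_ ?_ ?_ ?_ ?_ ?_⟩
  · intro v hv
    simp only [mem_insert, mem_singleton] at hv
    rcases hv with rfl | rfl | rfl | rfl | rfl | rfl
    exacts [Or.inl m3.2, Or.inl m1.2, Or.inr ((hin _).2 (by simp)), Or.inl k1.2, Or.inl k2.2,
      Or.inr ((hin _).2 (by simp))]
  · rw [(h.card_cyc (hC.1.two i).1).2, hi]
    exact Finset.card_le_six
  · simp [hH.hab.symm, (ne m2.2 (w := a) (by simp)).symm, (ne m2.2 (w := b) (by simp)).symm]
  · simp [hH.h23.symm, ne k3.2 (w := y₃) (by simp), ne k3.2 (w := y₂) (by simp)]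
  · intro v hv
    simp only [List.mem_cons, List.not_mem_nil, or_false] at hv
    have hX : ∀ {v}, v ∈ X → v ≠ z₀ ∧ v ≠ z ∧ v ≠ y₁ := fun hv =>
      ⟨h.ne hv k1.1, h.ne hv k2.1, h.ne hv hH.h₁⟩
    simp only [mem_insert, mem_singleton, not_or]
    rcases hv with rfl | rfl | rfl
    · exact ⟨hH.hb, ⟨(ne m3.2 (by simp)).symm, (ne m1.2 (by simp)).symm, hbx, hX (h.sub hH.hb)⟩,
        Or.inr ((hin _).2 (by simp))⟩
    · exact ⟨hH.ha, ⟨(ne m3.2 (by simp)).symm, (ne m1.2 (by simp)).symm, hax, hX (h.sub hH.ha)⟩,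
        Or.inr ((hin _).2 (by simp))⟩
    · exact ⟨m2.1, ⟨n23, n12.symm, ne m2.2 (by simp), hX (h.sub m2.1)⟩, Or.inl m2.2⟩
  · intro v hv
    simp only [List.mem_cons, List.not_mem_nil, or_false] at hv
    have hX : ∀ {v}, v ∈ Y → v ≠ u ∧ v ≠ s ∧ v ≠ x := fun hv =>
      ⟨(h.ne (h.sub m3.1) hv).symm, (h.ne (h.sub m1.1) hv).symm, (h.ne hH.hx hv).symm⟩
    simp only [mem_insert, mem_singleton, not_or]
    rcases hv with rfl | rfl | rfl
    · exact ⟨k3.1, ⟨(hX k3.1).1, (hX k3.1).2.1, (hX k3.1).2.2, l13.symm, l23.symm,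
        ne k3.2 (by simp)⟩, Or.inl k3.2⟩
    · exact ⟨hH.h₃, ⟨(hX hH.h₃).1, (hX hH.h₃).2.1, (hX hH.h₃).2.2, (ne k1.2 (by simp)).symm,
        (ne k2.2 (by simp)).symm, hH.h13.symm⟩, Or.inr ((hin _).2 (by simp))⟩
    · exact ⟨hH.h₂, ⟨(hX hH.h₂).1, (hX hH.h₂).2.1, (hX hH.h₂).2.2, (ne k1.2 (by simp)).symm,
        (ne k2.2 (by simp)).symm, hH.h12.symm⟩, Or.inr ((hin _).2 (by simp))⟩

theorem Ctx.hex_P6 (h : Ctx G X Y S n r) {s t u z₀ z w a b x y₁ y₂ y₃ : V}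
    (hF : Fr G S Y C [s, t, u] [z₀, z, w]) {i : Fin r} (hi : (Y ∩ C i).card = 3)
    (hH : Hex G X Y S C i a b x y₁ y₂ y₃) (e1 : G.Adj s z₀) (e2 : G.Adj u z₀) (e3 : G.Adj s z)
    (e4 : G.Adj x z) (e5 : G.Adj u y₁) (e6 : G.Adj t w) (e7 : G.Adj a w) : False := by
  obtain ⟨C', hF'⟩ := h.hex_frame hF hi hH e1 e2 e3 e4 e5
  exact h.P6_false hF' hH.b3 hH.b2 e7 hH.a3 e6

theorem Ctx.SY_nonadj (h : Ctx G X Y S n r) {s₁ s₂ s₃ z₁ z₂ z₃ : V}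
    (hF : Fr G S Y C [s₁, s₂, s₃] [z₁, z₂, z₃]) (e11 : G.Adj s₁ z₁) (e13 : G.Adj s₁ z₃)
    (e21 : G.Adj s₂ z₁) (e22 : G.Adj s₂ z₂) (e31 : G.Adj s₃ z₁) :
    ¬ G.Adj s₁ z₂ ∧ ¬ G.Adj s₂ z₃ ∧ ¬ G.Adj s₃ z₂ ∧ ¬ G.Adj s₃ z₃ := by
  have hC := hF.min
  obtain ⟨m1, m2, m3, k1, k2, k3, n12, n13, n23, l12, l13, l23⟩ := hF.facts
  exact ⟨fun e => h.no_four hC m1 m2 k1 k2 n12 l12 e11 e e21 e22,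
    fun e => h.no_four hC m1 m2 k1 k3 n12 l13 e11 e13 e21 e,
    fun e => h.no_four hC m2 m3 k1 k2 n23 l12 e21 e22 e31 e,
    fun e => h.no_four hC m1 m3 k1 k3 n13 l13 e11 e13 e31 e⟩

theorem Ctx.SY_leaf (h : Ctx G X Y S n r) {s₁ s₂ s₃ z₁ z₂ z₃ : V}
    (hF : Fr G S Y C [s₁, s₂, s₃] [z₁, z₂, z₃]) (e11 : G.Adj s₁ z₁) (e13 : G.Adj s₁ z₃)
    (e21 : G.Adj s₂ z₁) (e22 : G.Adj s₂ z₂) {x : V} (hxX : x ∈ X) (hxf : Free C x)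
    (h1 : x ≠ s₁) (h2 : x ≠ s₂) : G.Adj x z₂ → G.Adj x z₃ → False := by
  obtain ⟨m1, m2, m3, k1, k2, k3, n12, n13, n23, l12, l13, l23⟩ := hF.facts
  exact fun u v =>
    h.no_hex hF.min m1 m2 hxX hxf k1 k2 k3 n12 h1 h2 l12 l13 l23 e11 e21 e22 u v e13

theorem Ctx.SY_hex (h : Ctx G X Y S n r) {s₁ s₂ s₃ z₁ z₂ z₃ : V}
    (hF : Fr G S Y C [s₁, s₂, s₃] [z₁, z₂, z₃]) (e11 : G.Adj s₁ z₁) (e13 : G.Adj s₁ z₃)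
    (e21 : G.Adj s₂ z₁) (e22 : G.Adj s₂ z₂) (e31 : G.Adj s₃ z₁) {i : Fin r}
    (hi : (Y ∩ C i).card = 3)
    (hsum : 4 ≤ dg G s₃ (C i) + dg G z₂ (C i)) :
    dg G s₃ (C i) = 2 ∧ dg G z₃ (C i) = 0 := by
  obtain ⟨m1, m2, m3, k1, k2, k3, n12, n13, n23, l12, l13, l23⟩ := hF.facts
  obtain ⟨a, b, x, y₁, y₂, y₃, hH, f1, f2, fx, fa, g1, g2⟩ := h.exists_hex hF.min hi m3 k2 hsum
  refine ⟨g1, ?_⟩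
  by_contra hne
  have hG : Fr G S Y C [s₂, s₁, s₃] [z₁, z₂, z₃] :=
    hF.sel [1, 0, 2] [0, 1, 2] (by decide) (by decide)
  rcases hH.cases_dgY h k3.1 (by omega) with e | e | e
  · exact h.hex_P6 hG hi hH e21 e31 e22 fx f1 e13 e
  · exact h.hex_P6 hG hi hH.symm e21 e31 e22 fx f2 e13 e
  · exact h.hex_P6 (hF.sel [0, 1, 2] [0, 2, 1] (by decide) (by decide)) hi hH e11 e31 e13 e f1 e22 fa

theorem Ctx.SY_spider (h : Ctx G X Y S n r) {s₁ s₂ s₃ z₁ z₂ z₃ a b p q : V}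
    (hF : Fr G S Y C [s₁, s₂, s₃] [z₁, z₂, z₃]) (e11 : G.Adj s₁ z₁) (e13 : G.Adj s₁ z₃)
    (e21 : G.Adj s₂ z₁) (e22 : G.Adj s₂ z₂) (e31 : G.Adj s₃ z₁) {i : Fin r}
    (hQ : Quad G S Y C i a b p q) (ep : G.Adj s₃ p) (ea : G.Adj a z₃) (eb : G.Adj b z₃)
    (ea' : G.Adj a z₂) : False := by
  have hC := hF.min
  obtain ⟨m1, m2, m3, k1, k2, k3, n12, n13, n23, l12, l13, l23⟩ := hF.facts
  obtain ⟨N12, N23, N32, N33⟩ := h.SY_nonadj hF e11 e13 e21 e22 e31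
  have hF' := h.quad_swap hF hQ 3 [0, 1, 2] [0, 1, 4] (by simp) (by decide) (by decide) 3 4 2 5
    (by decide) (by decide) ea hQ.aq eb hQ.bq
  set C' := Function.update C i {rowV s₁ s₂ s₃ a b 3, rowV s₁ s₂ s₃ a b 4,
    colV [z₁, z₂, z₃] p q 2, colV [z₁, z₂, z₃] p q 5} with hC'
  change Fr G S Y C' [s₁, s₂, s₃] [z₁, z₂, p] at hF'
  have hCC : ∀ j, j ≠ i → C' j = C j := fun j hj => Function.update_of_ne hj _ _
  obtain ⟨m1', m2', m3', k1', k2', k3', -, -, -, -, l13', l23'⟩ := hF'.facts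
  have Np1 : ¬ G.Adj s₁ p := fun e => h.no_four hF'.min m1' m3' k1' k3' n13 l13' e11 e e31 ep
  have Np2 : ¬ G.Adj s₂ p := fun e => h.no_four hF'.min m2' m3' k1' k3' n23 l13' e21 e e31 ep
  have Nq1 : ¬ G.Adj s₁ q := fun e =>
    h.P6_false (h.quad_swap hF hQ 3 [1, 2, 4] [4, 0, 1] (by simp) (by decide) (by decide) 0 3 2 5
      (by decide) (by decide) e13 e ea hQ.aq) e21 e22 ep e31 hQ.bp
  have Nq2 : ¬ G.Adj s₂ q := fun e =>
    h.W6_false (h.quad_swap hF hQ 3 [0, 2, 4] [2, 0, 4] (by simp) (by decide) (by decide) 1 3 1 5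
      (by decide) (by decide) e22 e ea' hQ.aq) e13 e11 e31 ep eb hQ.bp
  have Nq3 : ¬ G.Adj s₃ q := fun e =>
    h.P6_false (h.quad_swap hF hQ 3 [1, 0, 4] [2, 0, 1] (by simp) (by decide) (by decide) 2 3 4 5
      (by decide) (by decide) ep e hQ.ap hQ.aq) e21 e22 e13 e11 eb
  have hQ2 : (Y ∩ C i).card = 2 := by
    have h1 := (h.card_cyc (hC.1.two i).1).2
    rw [hQ.card h] at h1
    omega
  have hD := h.sum_dg_rest_le hC.1 ![s₃, s₂, s₁] ![z₂, z₃, p]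
    (by simp [Fin.forall_fin_succ, h.sub m1.1, h.sub m2.1, h.sub m3.1])
    (by simp [Fin.forall_fin_succ, k2.1, k3.1, hQ.hp]) {s₁, s₂, s₃} {z₁, z₂, z₃}
    (by simp [h.sub m1.1, h.sub m2.1, h.sub m3.1, m1.2, m2.2, m3.2])
    (by simp [k1, k2, k3]) 2 1
    (by
      intro x hxX hxf hx
      simp only [mem_insert, mem_singleton, not_or] at hx
      have := h.SY_leaf hF e11 e13 e21 e22 hxX hxf hx.1 hx.2.1
      by_cases c2 : G.Adj x z₂ <;> by_cases c3 : G.Adj x z₃ <;> by_cases c4 : G.Adj x p <;>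
        first
        | exact (this c2 c3).elim
        | simp [-Finset.sum_boole, Fin.sum_univ_three, c2, c3, c4])
    (by
      intro y hyY hyf hy
      simp only [mem_insert, mem_singleton, not_or] at hy
      have hne : z₁ ≠ y := fun e => hy.1 e.symm
      have a12 : G.Adj s₁ y → G.Adj s₂ y → False := fun u v =>
        h.no_four hC m1 m2 k1 ⟨hyY, hyf⟩ n12 hne e11 u e21 v
      have a13 : G.Adj s₁ y → G.Adj s₃ y → False := fun u v =>
        h.no_four hC m1 m3 k1 ⟨hyY, hyf⟩ n13 hne e11 u e31 v
      have a23 : G.Adj s₂ y → G.Adj s₃ y → False := fun u v =>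
        h.no_four hC m2 m3 k1 ⟨hyY, hyf⟩ n23 hne e21 u e31 v
      by_cases c1 : G.Adj s₁ y <;> by_cases c2 : G.Adj s₂ y <;> by_cases c3 : G.Adj s₃ y <;>
        first
        | exact (a12 c1 c2).elim
        | exact (a13 c1 c3).elim
        | exact (a23 c2 c3).elim
        | simp [-Finset.sum_boole, Fin.sum_univ_three, c1, c2, c3])
  rw [sum_insert (by simp [n12, n13]), sum_insert (by simp [n23]), sum_singleton,
    sum_insert (by simp [l12, l13]), sum_insert (by simp [l23]), sum_singleton,
    card_insert_of_notMem (by simp [n12, n13]), card_insert_of_notMem (by simp [n23]),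
    card_singleton, card_insert_of_notMem (by simp [l12, l13]),
    card_insert_of_notMem (by simp [l23]), card_singleton] at hD
  simp [-Finset.sum_boole, Fin.sum_univ_three, N12, N23, N32, N33, Np1, Np2, e11, e13, e21, e22,
    e31, ep] at hD
  have hf : dg G s₃ (C i) + dg G z₂ (C i) + (dg G s₂ (C i) + dg G z₃ (C i)) +
      (dg G s₁ (C i) + dg G p (C i)) ≤ 7 := by
    rw [hQ.dgX h (h.sub m1.1), hQ.dgX h (h.sub m2.1), hQ.dgX h (h.sub m3.1), hQ.dgY h hQ.hp,
      hQ.dgY h k2.1, hQ.dgY h k3.1]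
    simp only [Np1, Np2, Nq1, Nq2, Nq3, ep, if_true, if_false]
    split_ifs <;> omega
  obtain ⟨j, hji, hj⟩ := h.exists_heavy_ne hC.1 i ![s₃, s₂, s₁] ![z₂, z₃, p]
    (by simp [Fin.forall_fin_succ, m1.1, m2.1, m3.1])
    (by simp [Fin.forall_fin_succ, k2.1, k3.1, hQ.hp])
    (by simp [Fin.forall_fin_succ, N23, N32, Np1])
    (by
      simp [Fin.sum_univ_three]
      omega)
  simp only [Fin.sum_univ_three, Matrix.cons_val] at hj
  by_cases hm : 3 ≤ (Y ∩ C j).card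
  · have hcj := hCC j hji
    by_cases h3 : (Y ∩ C j).card = 3
    · have t1 : ¬ 4 ≤ dg G s₂ (C j) + dg G z₂ (C j) := fun hs => by
        have := (h.tight hC hm m2 k2 e22 (by omega)).2.1
        omega
      have t2 : ¬ 4 ≤ dg G s₁ (C j) + dg G z₃ (C j) := fun hs => by
        have := (h.tight hC hm m1 k3 e13 (by omega)).2.1
        omega
      have t3 : ¬ 4 ≤ dg G s₃ (C j) + dg G p (C j) := fun hs => by
        have := (h.tight hF'.min (i := j) (by rw [hcj]; exact hm) m3' k3' ep
          (by rw [hcj]; omega)).2.1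
        rw [hcj] at this
        omega
      omega
    · have t1 := mt (h.gamma hC hm m3 k2 m2 k1 n23.symm l12 e31 e21 e22) h3
      have t2 := mt (h.gamma hC hm m2 k3 m1 k1 n12.symm l13 e21 e11 e13) h3
      have t3 := mt (h.gamma hF'.min (i := j) (by rw [hcj]; exact hm) m1' k3' m3' k1' n13
        l13' e11 e31 ep) (by rw [hcj]; exact h3)
      rw [hcj] at t3
      omega
  have h2 : (Y ∩ C j).card = 2 := by
    obtain ⟨h1, h2⟩ := h.card_cyc (hC.1.two j).1
    have h3 := card_le_card (inter_subset_inter h.sub (Subset.refl (C j)))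
    rw [(hC.1.two j).2] at h3
    omega
  obtain ⟨c, d, u, v, hR⟩ := h.exists_quad hC.1 h2
  rw [h2, hR.dgX h (h.sub m1.1), hR.dgX h (h.sub m2.1), hR.dgX h (h.sub m3.1), hR.dgY h hQ.hp,
      hR.dgY h k2.1, hR.dgY h k3.1] at hj
  obtain ⟨E, hE, hHas⟩ := h.two_check hF hF' hR (hCC j hji)
    (fun k l => G.Adj (rowV s₁ s₂ s₃ c d k) (if l = 3 then p else colV [z₁, z₂, z₃] u v l)) 2 3
    (by
      intro k l _ hl hP
      rwa [if_neg hl] at hP)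
    (by
      intro k l hk hl hP
      have e : (if k = 2 then 2 else k) = k := by
        split_ifs <;> omega
      rw [e] at hP
      by_cases hl2 : l = 2
      · subst hl2
        exact hP
      · rw [if_neg hl2, if_neg hl] at hP
        have e' : colV [z₁, z₂, p] u v l = colV [z₁, z₂, z₃] u v l := by
          rcases l with _ | _ | _ | _ | _ | _ | l
          all_goals first | rfl | omega
        rwa [e']) _ _ _ _ _ _ cert_SY_spider
    (by simp [rowV, colV, e11, e13, e21, e22, e31, ep, hR.ap, hR.aq, hR.bp, hR.bq])
    (by
      simp only [List.map_cons, List.map_nil, List.sum_cons, List.sum_nil, rowV, colV,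
        List.getD_cons_zero, List.getD_cons_succ, reduceIte, Nat.reduceEqDiff, one_mul]
      omega)
  simp only [List.mem_cons, List.not_mem_nil, or_false] at hE
  rcases hE with rfl | rfl | rfl
  exacts [h.no_W4 hHas, h.no_W6 hHas, h.no_P6 hHas]

theorem Ctx.SY_false (h : Ctx G X Y S n r) {s₁ s₂ s₃ z₁ z₂ z₃ : V}
    (hF : Fr G S Y C [s₁, s₂, s₃] [z₁, z₂, z₃]) (e11 : G.Adj s₁ z₁) (e13 : G.Adj s₁ z₃)
    (e21 : G.Adj s₂ z₁) (e22 : G.Adj s₂ z₂) (e31 : G.Adj s₃ z₁) : False := by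
  have hC := hF.min
  obtain ⟨m1, m2, m3, k1, k2, k3, n12, n13, n23, l12, l13, l23⟩ := hF.facts
  obtain ⟨N12, N23, N32, N33⟩ := h.SY_nonadj hF e11 e13 e21 e22 e31
  have hG : Fr G S Y C [s₂, s₁, s₃] [z₁, z₃, z₂] :=
    hF.sel [1, 0, 2] [0, 2, 1] (by decide) (by decide)
  refine h.step hF _ _ _ _ _ _ _ _ _ _ cert_SY (Nat.zero_le _)
    (And.intro e11 (And.intro e13 (And.intro e21 (And.intro e22 e31))))
    (And.intro N12 (And.intro N23 (And.intro N32 N33))) ?_ ?_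
    (And.intro h.no_W4 (And.intro h.no_W6 (And.intro h.no_P6 h.no_SX))) ?_ ?_
  · intro x hxX hxf hx
    simp only [List.mem_cons, List.not_mem_nil, or_false, not_or] at hx
    have := h.SY_leaf hF e11 e13 e21 e22 hxX hxf hx.1 hx.2.1
    simp
    split_ifs <;> first | omega | tauto
  · intro y hyY hyf hy
    have h1 : ¬ G.Adj s₃ y := fun e =>
      h.T3_false ((hF.consZ hyY hyf hy).sel [0, 1, 2] [1, 3, 2, 0] (by decide) (by decide)) e11 e21
        e31 e13 e22 e
    simp [row3, h1]
  · intro i a b p q hQ l hl hlE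
    simp only [List.mem_cons, List.not_mem_nil, or_false] at hl
    rcases hl with rfl | rfl | rfl | rfl | rfl | rfl | rfl | rfl <;>
      simp [rowV, colV] at hlE <;> obtain ⟨f1, f2, f3, f4⟩ := hlE
    · exact h.SY_spider hG e21 e22 e11 e13 e31 hQ f1 f2 f4 f3
    · exact h.SY_spider hG e21 e22 e11 e13 e31 hQ.symmY f1 f2 f4 f3
    · exact h.SY_spider hG e21 e22 e11 e13 e31 hQ.symmX f1 f3 f2 f4
    · exact h.SY_spider hG e21 e22 e11 e13 e31 hQ.symmX.symmY f1 f3 f2 f4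
    · exact h.SY_spider hF e11 e13 e21 e22 e31 hQ f1 f3 f4 f2
    · exact h.SY_spider hF e11 e13 e21 e22 e31 hQ.symmY f1 f3 f4 f2
    · exact h.SY_spider hF e11 e13 e21 e22 e31 hQ.symmX f1 f4 f2 f3
    · exact h.SY_spider hF e11 e13 e21 e22 e31 hQ.symmX.symmY f1 f4 f2 f3
  · intro i hi
    have g1 := h.gamma hC hi m3 k2 m2 k1 n23.symm l12 e31 e21 e22
    have g2 := h.gamma hC hi m3 k3 m1 k1 n13.symm l13 e31 e11 e13
    have g3 := fun (hm : (Y ∩ C i).card = 3) => h.SY_hex hF e11 e13 e21 e22 e31 hm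
    have g4 := fun (hm : (Y ∩ C i).card = 3) => h.SY_hex hG e21 e22 e11 e13 e31 hm
    simp [row3]
    by_contra hcon
    have hm : (Y ∩ C i).card = 3 := by
      by_contra hm
      have := mt g1 hm
      have := mt g2 hm
      omega
    have := g3 hm
    have := g4 hm
    have := h.dgY_lt hC hi k2
    have := h.dgY_lt hC hi k3
    omega

theorem Ctx.no_SY (h : Ctx G X Y S n r) : ¬ Has G S Y r pSY :=
  not_has (by decide) fun _ _ _ _ _ _ _ hF ⟨e1, e2, e3, e4, e5⟩ =>
    h.SY_false hF e1 e2 e3 e4 e5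

end SY

/-- The edges `s₁z₁, s₁z₂, s₁z₃, s₂z₁, s₃z₁` between `s₁, s₂, s₃` and `z₁, z₂, z₃`. -/
def pDBL : List (ℕ × ℕ) := [(0, 0), (0, 1), (0, 2), (1, 0), (2, 0)]

/-- The edges `s₁z₁, s₁z₂, s₂z₂, s₃z₁` between `s₁, s₂, s₃` and `z₁, z₂, z₃`. -/
def pCP : List (ℕ × ℕ) := [(0, 0), (0, 1), (1, 1), (2, 0)]

/-- The edges `s₁z₁, s₁z₂, s₂z₁, s₃z₁` between `s₁, s₂, s₃` and `z₁, z₂, z₃`. -/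
def pCY : List (ℕ × ℕ) := [(0, 0), (0, 1), (1, 0), (2, 0)]

theorem cert_DBL : scert [(1, 1)]
  [(1, 1), (2, 1), (1, 2)]
  pDBL 1 0 0 0 3
  [pW4, pW6, pP6, pSX, pSY]
  [(31420, 54201, 3), (41320, 54201, 3), (43210, 41250, 4), (43210, 51240, 4)]
  [] = true := by decide +kernel

theorem cert_CP : scert [(0, 2), (1, 0), (2, 1)]
  [(0, 2), (1, 0), (2, 1), (1, 2), (2, 2)]
  pCP 3 0 0 0 3
  [pW4, pW6, pP6, pSX, pSY, pDBL]
  [(43201, 42510, 2), (43102, 42501, 2), (10243, 41250, 0), (20143, 40251, 0), (10432, 51240, 0),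
   (20431, 50241, 0), (40231, 10254, 0), (40132, 41250, 0), (42103, 40251, 2), (30142, 10254, 0),
   (40231, 40251, 0), (43201, 52410, 2), (32104, 54201, 2), (30241, 50241, 0), (30241, 10254, 0),
   (10432, 41025, 4), (20143, 50241, 0), (20341, 40251, 0), (10243, 51240, 0), (10342, 41025, 4),
   (43210, 52410, 3), (31204, 41250, 2), (41023, 51240, 2), (32104, 40521, 5), (42013, 50241, 2),
   (40213, 54210, 3), (10342, 51024, 4), (20431, 40125, 4), (30214, 54210, 3), (10342, 41250, 0),
   (10234, 51240, 2), (31024, 41250, 2), (41203, 41250, 2), (40213, 10425, 5), (43210, 42510, 3),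
   (30142, 41250, 0), (30142, 51240, 0), (31204, 51420, 5), (41203, 41520, 5)]
  [] = true := by decide +kernel

theorem cert_CY : scert [(0, 2), (1, 1), (2, 2)]
  [(0, 2), (1, 1), (2, 1), (1, 2), (2, 2)]
  pCY 3 0 0 0 3
  [pW4, pW6, pP6, pSX, pSY, pDBL]
  [(43210, 42150, 4), (43120, 42150, 4), (10243, 40251, 0), (30124, 51240, 2), (40123, 51240, 2),
   (43210, 52140, 4), (30421, 41250, 0), (31204, 54210, 2), (21043, 50241, 2), (32104, 54210, 2),
   (21403, 40215, 3), (43210, 52410, 5), (20143, 50241, 0), (30214, 41250, 2), (40213, 41250, 2),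
   (21340, 40125, 4), (21340, 50124, 4), (40123, 41250, 2), (41203, 54210, 2), (21430, 40125, 4),
   (21430, 50124, 4), (30124, 41250, 2), (21034, 50241, 2), (42103, 54210, 2), (43120, 52140, 4),
   (43210, 42510, 5), (40321, 41250, 0), (10423, 40215, 5), (10324, 40215, 5), (10423, 50214, 5),
   (10324, 50214, 5)]
  [] = true := by decide +kernel

section Connected

variable {V : Type*} [Fintype V] [DecidableEq V] {G : SimpleGraph V} [DecidableRel G.Adj]
  {X Y S : Finset V} {n r : ℕ} {C : Fin r → Finset V}

theorem Ctx.no_short_four (h : Ctx G X Y S n r) (hC : IsMin G S C) {i : Fin r}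
    (hi : 3 ≤ (Y ∩ C i).card) {a b p q : V} (ha : a ∈ S) (hb : b ∈ S) (hp : p ∈ Y) (hq : q ∈ Y)
    (hab : a ≠ b) (hpq : p ≠ q) (h1 : G.Adj a p) (h2 : G.Adj a q) (h3 : G.Adj b p)
    (h4 : G.Adj b q) (fa : Free C a ∨ a ∈ C i) (fb : Free C b ∨ b ∈ C i)
    (fp : Free C p ∨ p ∈ C i) (fq : Free C q ∨ q ∈ C i) : False := by
  have hc := hC.card_le (i := i) (h.two_four ha hb hp hq hab hpq h1 h2 h3 h4) (by
    intro v hv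
    simp only [mem_insert, mem_singleton] at hv
    rcases hv with rfl | rfl | rfl | rfl
    exacts [fa, fb, fp, fq])
  have h5 := (h.card_cyc (hC.1.two i).1)
  have h6 : ({a, b, p, q} : Finset V).card ≤ 4 := Finset.card_le_four
  omega

theorem Ctx.CY_extend (h : Ctx G X Y S n r) {s₁ s₂ s₃ z₁ z₂ z₃ : V}
    (hF : Fr G S Y C [s₁, s₂, s₃] [z₁, z₂, z₃]) (e11 : G.Adj s₁ z₁) (e12 : G.Adj s₁ z₂)
    (e21 : G.Adj s₂ z₁) (e31 : G.Adj s₃ z₁) : ¬ G.Adj s₂ z₃ ∧ ¬ G.Adj s₃ z₃ :=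
  ⟨fun e => h.SY_false (hF.sel [1, 0, 2] [0, 1, 2] (by decide) (by decide)) e21 e e11 e12 e31,
    fun e => h.SY_false (hF.sel [2, 0, 1] [0, 1, 2] (by decide) (by decide)) e31 e e11 e12 e21⟩

theorem Ctx.DBL_false (h : Ctx G X Y S n r) {s₁ s₂ s₃ z₁ z₂ z₃ : V}
    (hF : Fr G S Y C [s₁, s₂, s₃] [z₁, z₂, z₃]) (e11 : G.Adj s₁ z₁) (e12 : G.Adj s₁ z₂)
    (e13 : G.Adj s₁ z₃) (e21 : G.Adj s₂ z₁) (e31 : G.Adj s₃ z₁) : False := by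
  have hC := hF.min
  obtain ⟨m1, m2, m3, k1, k2, k3, n12, n13, n23, l12, l13, l23⟩ := hF.facts
  have N22 : ¬ G.Adj s₂ z₂ := fun e => h.no_four hC m1 m2 k1 k2 n12 l12 e11 e12 e21 e
  have N32 : ¬ G.Adj s₃ z₂ := fun e => h.no_four hC m1 m3 k1 k2 n13 l12 e11 e12 e31 e
  have N23 : ¬ G.Adj s₂ z₃ := fun e => h.no_four hC m1 m2 k1 k3 n12 l13 e11 e13 e21 e
  refine h.step hF _ _ _ _ _ _ _ _ _ _ cert_DBL (Nat.zero_le _)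
    (And.intro e11 (And.intro e12 (And.intro e13 (And.intro e21 e31))))
    (And.intro N22 (And.intro N32 N23)) ?_ ?_
    (And.intro h.no_W4 (And.intro h.no_W6 (And.intro h.no_P6 (And.intro h.no_SX h.no_SY))))
    (by simp) ?_
  · intro x hxX hxf hx
    simp
    split_ifs <;> omega
  · intro y hyY hyf hy
    have h1 := (h.CY_extend ((hF.consZ hyY hyf hy).sel [0, 1, 2] [1, 2, 0] (by decide) (by decide))
      e11 e12 e21 e31).1
    simp [row3, h1]
  · intro i hi
    have h1 := h.beta_fr (hF.sel [0, 1, 2] [0, 2, 1] (by decide) (by decide)) hi m2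
      fun y C' hF' e => (h.CY_extend hF' e11 e13 e21 e31).1 e
    simp [row3]
    omega

theorem Ctx.no_DBL (h : Ctx G X Y S n r) : ¬ Has G S Y r pDBL :=
  not_has (by decide) fun _ _ _ _ _ _ _ hF ⟨e1, e2, e3, e4, e5⟩ =>
    h.DBL_false hF e1 e2 e3 e4 e5

theorem Ctx.CP_extend (h : Ctx G X Y S n r) {s₁ s₂ s₃ z₁ z₂ z₃ : V}
    (hF : Fr G S Y C [s₁, s₂, s₃] [z₁, z₂, z₃]) (e11 : G.Adj s₁ z₁) (e12 : G.Adj s₁ z₂)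
    (e22 : G.Adj s₂ z₂) (e31 : G.Adj s₃ z₁) :
    ¬ G.Adj s₁ z₃ ∧ ¬ G.Adj s₂ z₃ ∧ ¬ G.Adj s₃ z₃ :=
  ⟨fun e => h.SX_false hF e11 e12 e e22 e31,
    fun e => h.P6_false (hF.sel [1, 0, 2] [0, 1, 2] (by decide) (by decide)) e22 e e11 e12 e31,
    fun e => h.P6_false (hF.sel [2, 0, 1] [1, 0, 2] (by decide) (by decide)) e31 e e12 e11 e22⟩

theorem Ctx.CP_false (h : Ctx G X Y S n r) {s₁ s₂ s₃ z₁ z₂ z₃ : V}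
    (hF : Fr G S Y C [s₁, s₂, s₃] [z₁, z₂, z₃]) (e11 : G.Adj s₁ z₁) (e12 : G.Adj s₁ z₂)
    (e22 : G.Adj s₂ z₂) (e31 : G.Adj s₃ z₁) : False := by
  have hC := hF.min
  obtain ⟨m1, m2, m3, k1, k2, k3, n12, n13, n23, l12, l13, l23⟩ := hF.facts
  have N21 : ¬ G.Adj s₂ z₁ := fun e => h.no_four hC m1 m2 k1 k2 n12 l12 e11 e12 e e22
  have N32 : ¬ G.Adj s₃ z₂ := fun e => h.no_four hC m1 m3 k1 k2 n13 l12 e11 e12 e31 e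
  obtain ⟨N13, N23, N33⟩ := h.CP_extend hF e11 e12 e22 e31
  refine h.step hF _ _ _ _ _ _ _ _ _ _ cert_CP (Nat.zero_le _)
    (And.intro e11 (And.intro e12 (And.intro e22 e31)))
    (And.intro N13 (And.intro N21 (And.intro N32 (And.intro N23 N33)))) ?_ ?_
    (And.intro h.no_W4 (And.intro h.no_W6 (And.intro h.no_P6 (And.intro h.no_SX
      (And.intro h.no_SY h.no_DBL))))) (by simp) ?_
  · intro x hxX hxf hx
    simp
    split_ifs <;> omega
  · intro y hyY hyf hy
    obtain ⟨h1, h2, h3⟩ := h.CP_extend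
      ((hF.consZ hyY hyf hy).sel [0, 1, 2] [1, 2, 0] (by decide) (by decide)) e11 e12 e22 e31
    simp [row3, h1, h2, h3]
  · intro i hi
    have h1 := h.beta_fr hF hi m1 fun y C' hF' e => (h.CP_extend hF' e11 e12 e22 e31).1 e
    have h2 := h.two_pairs hC hi m2 k2 e22 m3 k1 e31 n23
    simp [row3]
    omega

theorem Ctx.no_CP (h : Ctx G X Y S n r) : ¬ Has G S Y r pCP :=
  not_has (by decide) fun _ _ _ _ _ _ _ hF ⟨e1, e2, e3, e4⟩ => h.CP_false hF e1 e2 e3 e4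

theorem Hex.adj_of_two_le {i : Fin r} {a b x y₁ y₂ y₃ z : V} (hH : Hex G X Y S C i a b x y₁ y₂ y₃)
    (h : Ctx G X Y S n r) (hz : z ∈ Y) (hd : 2 ≤ dg G z (C i)) : G.Adj a z ∨ G.Adj b z := by
  by_contra hcon
  push Not at hcon
  have : dg G z (C i) ≤ ∑ v ∈ C i, if v = x then 1 else 0 := by
    refine sum_le_sum fun v hv => ?_
    rw [hH.eq] at hv
    simp only [mem_insert, mem_singleton] at hv
    by_cases e : G.Adj z v
    · rcases hv with rfl | rfl | rfl | rfl | rfl | rfl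
      · exact (hcon.1 e.symm).elim
      · exact (hcon.2 e.symm).elim
      · simp [e]
      · exact (h.not_mem_X.2 hH.h₁ (h.adj_Y e hz)).elim
      · exact (h.not_mem_X.2 hH.h₂ (h.adj_Y e hz)).elim
      · exact (h.not_mem_X.2 hH.h₃ (h.adj_Y e hz)).elim
    · simp [e]
  rw [sum_ite_eq'] at this
  split_ifs at this <;> omega

theorem Hex.mem {i : Fin r} {a b x y₁ y₂ y₃ : V} (hH : Hex G X Y S C i a b x y₁ y₂ y₃) :
    a ∈ C i ∧ b ∈ C i ∧ x ∈ C i ∧ y₁ ∈ C i ∧ y₂ ∈ C i ∧ y₃ ∈ C i := by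
  simp [hH.eq]

theorem Ctx.CY_hex (h : Ctx G X Y S n r) {s₁ s₂ s₃ z₁ z₂ z₃ a b x y₁ y₂ y₃ : V}
    (hF : Fr G S Y C [s₁, s₂, s₃] [z₁, z₂, z₃]) (e11 : G.Adj s₁ z₁) (e12 : G.Adj s₁ z₂)
    (e21 : G.Adj s₂ z₁) {i : Fin r} (hi : (Y ∩ C i).card = 3)
    (hH : Hex G X Y S C i a b x y₁ y₂ y₃) (f1 : G.Adj s₂ y₁) (fx : G.Adj x z₂)
    (f3 : G.Adj s₃ y₃) (fz : G.Adj a z₃) : False := by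
  obtain ⟨C', hF'⟩ := h.hex_frame (hF.sel [0, 2, 1] [0, 1, 2] (by decide) (by decide)) hi hH e11
    e21 e12 fx f1
  exact h.SY_false (hF'.sel [0, 1, 2] [1, 0, 2] (by decide) (by decide)) hH.b3 hH.b2 hH.a3 fz f3

theorem Ctx.CY_false (h : Ctx G X Y S n r) {s₁ s₂ s₃ z₁ z₂ z₃ : V}
    (hF : Fr G S Y C [s₁, s₂, s₃] [z₁, z₂, z₃]) (e11 : G.Adj s₁ z₁) (e12 : G.Adj s₁ z₂)
    (e21 : G.Adj s₂ z₁) (e31 : G.Adj s₃ z₁) : False := by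
  have hC := hF.min
  obtain ⟨m1, m2, m3, k1, k2, k3, n12, n13, n23, l12, l13, l23⟩ := hF.facts
  have N22 : ¬ G.Adj s₂ z₂ := fun e => h.no_four hC m1 m2 k1 k2 n12 l12 e11 e12 e21 e
  have N32 : ¬ G.Adj s₃ z₂ := fun e => h.no_four hC m1 m3 k1 k2 n13 l12 e11 e12 e31 e
  have N13 : ¬ G.Adj s₁ z₃ := fun e => h.DBL_false hF e11 e12 e e21 e31
  obtain ⟨N23, N33⟩ := h.CY_extend hF e11 e12 e21 e31
  refine h.step hF _ _ _ _ _ _ _ _ _ _ cert_CY (Nat.zero_le _)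
    (And.intro e11 (And.intro e12 (And.intro e21 e31)))
    (And.intro N13 (And.intro N22 (And.intro N32 (And.intro N23 N33)))) ?_ ?_
    (And.intro h.no_W4 (And.intro h.no_W6 (And.intro h.no_P6 (And.intro h.no_SX
      (And.intro h.no_SY h.no_DBL))))) (by simp) ?_
  · intro x hxX hxf hx
    simp
    split_ifs <;> omega
  · intro y hyY hyf hy
    have hF' := (hF.consZ hyY hyf hy).sel [0, 1, 2] [1, 2, 0] (by decide) (by decide)
    have h1 : ¬ G.Adj s₁ y := fun e => h.DBL_false hF' e11 e12 e e21 e31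
    obtain ⟨h2, h3⟩ := h.CY_extend hF' e11 e12 e21 e31
    simp [row3, h1, h2, h3]
  · intro i hi
    have h1 := h.beta_fr hF hi m1 fun y C' hF' e => h.DBL_false hF' e11 e12 e e21 e31
    have h3 := h.beta_fr hF hi m3 fun y C' hF' e => (h.CY_extend hF' e11 e12 e21 e31).2 e
    have h2 := h.gamma hC hi m2 k2 m1 k1 n12.symm l12 e21 e11 e12
    have t2 := h.dgX_lt hC hi m2
    have t3 := h.dgY_lt hC hi k2
    have t4 := h.dgY_lt hC hi k3
    simp [row3]
    by_contra hcon
    have hm : (Y ∩ C i).card = 3 := h2 (by omega)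
    have h12 : ¬ 4 ≤ dg G s₁ (C i) + dg G z₂ (C i) := fun hs => by
      have := (h.tight hC hi m1 k2 e12 (by omega)).2.1
      omega
    obtain ⟨a, b, x, y₁, y₂, y₃, hH, f1, f2, fx, fa, g1, g2⟩ := h.exists_hex hC hm m2 k2 (by omega)
    obtain ⟨-, -, -, c1, c2, -⟩ := hH.mem
    rcases hH.cases_dgX h (h.sub m3.1) (by omega) with f | f | f
    · exact h.no_short_four hC hi m2.1 m3.1 k1.1 hH.h₁ n23 (fun e => k1.2 i (e ▸ c1)) e21 f1 e31 f
        (Or.inl m2.2) (Or.inl m3.2) (Or.inl k1.2) (Or.inr c1)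
    · exact h.no_short_four hC hi m2.1 m3.1 k1.1 hH.h₂ n23 (fun e => k1.2 i (e ▸ c2)) e21 f2 e31 f
        (Or.inl m2.2) (Or.inl m3.2) (Or.inl k1.2) (Or.inr c2)
    · rcases hH.adj_of_two_le h k3.1 (by omega) with e | e
      · exact h.CY_hex hF e11 e12 e21 hm hH f1 fx f e
      · exact h.CY_hex hF e11 e12 e21 hm hH.symm f2 fx f e

theorem Ctx.no_CY (h : Ctx G X Y S n r) : ¬ Has G S Y r pCY :=
  not_has (by decide) fun _ _ _ _ _ _ _ hF ⟨e1, e2, e3, e4⟩ => h.CY_false hF e1 e2 e3 e4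

end Connected

/-- The edges `s₁z₁, s₁z₃, s₂z₁, s₂z₂` between `s₁, s₂, s₃` and `z₁, z₂, z₃`. -/
def pC0 : List (ℕ × ℕ) := [(0, 0), (0, 2), (1, 0), (1, 1)]

theorem cert_C0 : scert [(0, 1), (1, 2), (2, 0)]
  [(0, 1), (1, 2), (2, 0), (2, 1), (2, 2)]
  pC0 2 1 0 0 3
  [pW4, pW6, pP6, pSX, pSY, pDBL]
  [(32410, 54201, 2), (32401, 54102, 2), (30241, 20154, 0), (40231, 40251, 0), (30241, 52410, 0),
   (40231, 52410, 0), (10243, 40251, 0), (40231, 20154, 0), (10243, 40152, 0), (30241, 40251, 0),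
   (42310, 54201, 2), (10243, 50241, 0), (30241, 42105, 2), (30421, 52104, 5), (10243, 50142, 0),
   (30241, 50241, 0), (40213, 20514, 3), (31240, 41205, 2), (40231, 54210, 0), (30214, 20514, 3),
   (40231, 42105, 2), (30241, 54210, 0), (42310, 54210, 4), (43210, 41205, 2), (31240, 51024, 2),
   (40231, 52104, 2), (30241, 42150, 0), (31240, 51204, 2), (41230, 41025, 2), (30241, 20145, 4),
   (43210, 50214, 4), (40231, 42015, 2), (43210, 40215, 4), (32410, 54210, 4), (30241, 20541, 0),
   (30241, 20451, 0), (30241, 42510, 0), (30241, 52140, 0), (30241, 52014, 2), (30214, 20415, 3),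
   (30421, 42105, 5), (40321, 42105, 5), (40321, 52104, 5)]
  [] = true := by decide +kernel

section Path

variable {V : Type*} [Fintype V] [DecidableEq V] {G : SimpleGraph V} [DecidableRel G.Adj]
  {X Y S : Finset V} {n r : ℕ} {C : Fin r → Finset V}

theorem Ctx.dg_add_le (h : Ctx G X Y S n r) (hC : IsMin G S C) {i : Fin r}
    (hi : 3 ≤ (Y ∩ C i).card) {s z : V} (hs : s ∈ S ∧ Free C s) (hz : z ∈ Y ∧ Free C z) :
    dg G s (C i) + dg G z (C i) ≤ (Y ∩ C i).card + 1 := by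
  obtain ⟨p, c, hL⟩ := h.exists_lng hC.1 i hi
  obtain ⟨p, c, hL, hside⟩ := hL.exists_side h hC hs.1 hs.2
  by_contra hcon
  have h1 := hL.core h hC hs.1 hz.1 hz.2 hside (by omega)
  have h2 := hL.hpm
  omega

theorem Ctx.C0_long (h : Ctx G X Y S n r) {s₁ s₂ s₃ z₁ z₂ z₃ : V}
    (hF : Fr G S Y C [s₁, s₂, s₃] [z₁, z₂, z₃]) (e11 : G.Adj s₁ z₁) (e13 : G.Adj s₁ z₃)
    (e21 : G.Adj s₂ z₁) (e22 : G.Adj s₂ z₂) {i : Fin r} (hi : 3 ≤ (Y ∩ C i).card) :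
    dg G s₁ (C i) + dg G z₂ (C i) + (dg G s₂ (C i) + dg G z₃ (C i)) +
      (dg G s₃ (C i) + dg G z₁ (C i)) ≤ 3 * (Y ∩ C i).card := by
  have hC := hF.min
  obtain ⟨m1, m2, m3, k1, k2, k3, n12, n13, n23, l12, l13, l23⟩ := hF.facts
  by_contra hcon
  have h1 := h.two_pairs hC hi m1 k3 e13 m2 k2 e22 n12
  have h2 := h.dg_add_le hC hi m3 k1
  have q1 : ¬ (Y ∩ C i).card + 1 ≤ dg G s₁ (C i) + dg G z₃ (C i) := fun hs => by
    obtain ⟨-, -, t1, t2⟩ := h.tight hC hi m1 k3 e13 hs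
    have := t1 _ m3 n13.symm
    have := t2 _ k1
    omega
  have q2 : ¬ (Y ∩ C i).card + 1 ≤ dg G s₂ (C i) + dg G z₂ (C i) := fun hs => by
    obtain ⟨-, -, t1, t2⟩ := h.tight hC hi m2 k2 e22 hs
    have := t1 _ m3 n23.symm
    have := t2 _ k1
    omega
  have d2 := h.dgY_lt hC hi k2
  have d3 := h.dgY_lt hC hi k3
  by_cases hm : (Y ∩ C i).card = 3
  · obtain ⟨a, b, x, y₁, y₂, y₃, hH, f1, f2, fx, fa, g1, g2⟩ :=
      h.exists_hex hC hm m3 k1 (by omega)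
    obtain ⟨ma, -, -, c1, c2, c3⟩ := hH.mem
    have key : ∀ s, s ∈ S ∧ Free C s → G.Adj s z₁ → 1 ≤ dg G s (C i) → G.Adj s y₂ := by
      intro s hs e hd
      rcases hH.cases_dgX h (h.sub hs.1) hd with f | f | f
      · exact (h.no_short_four hC hi hs.1 hH.ha k1.1 hH.h₁ (fun e => hs.2 i (e ▸ ma))
          (fun e => k1.2 i (e ▸ c1)) e f fa hH.a1 (Or.inl hs.2) (Or.inr ma) (Or.inl k1.2)
          (Or.inr c1)).elim
      · exact f
      · exact (h.no_short_four hC hi hs.1 hH.ha k1.1 hH.h₃ (fun e => hs.2 i (e ▸ ma))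
          (fun e => k1.2 i (e ▸ c3)) e f fa hH.a3 (Or.inl hs.2) (Or.inr ma) (Or.inl k1.2)
          (Or.inr c3)).elim
    exact h.no_short_four hC hi m1.1 m2.1 k1.1 hH.h₂ n12 (fun e => k1.2 i (e ▸ c2)) e11
      (key s₁ m1 e11 (by omega)) e21 (key s₂ m2 e21 (by omega)) (Or.inl m1.2) (Or.inl m2.2)
      (Or.inl k1.2) (Or.inr c2)
  · have t1 := h.dgY_adj hC (i := i) (by omega) m1 k1 e11 (by omega)
    have t2 := h.dgY_adj hC (i := i) (by omega) m1 k3 e13 (by omega)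
    have := h.dg_full hC hi m3 m1 n13.symm (by omega)
    omega

theorem Ctx.C0_false (h : Ctx G X Y S n r) {s₁ s₂ s₃ z₁ z₂ z₃ : V}
    (hF : Fr G S Y C [s₁, s₂, s₃] [z₁, z₂, z₃]) (e11 : G.Adj s₁ z₁) (e13 : G.Adj s₁ z₃)
    (e21 : G.Adj s₂ z₁) (e22 : G.Adj s₂ z₂) : False := by
  have hC := hF.min
  obtain ⟨m1, m2, m3, k1, k2, k3, n12, n13, n23, l12, l13, l23⟩ := hF.facts
  have N12 : ¬ G.Adj s₁ z₂ := fun e => h.no_four hC m1 m2 k1 k2 n12 l12 e11 e e21 e22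
  have N23 : ¬ G.Adj s₂ z₃ := fun e => h.no_four hC m1 m2 k1 k3 n12 l13 e11 e13 e21 e
  have N31 : ¬ G.Adj s₃ z₁ := fun e => h.SY_false hF e11 e13 e21 e22 e
  have N32 : ¬ G.Adj s₃ z₂ := fun e =>
    h.P6_false (hF.sel [0, 1, 2] [1, 0, 2] (by decide) (by decide)) e11 e13 e22 e21 e
  have N33 : ¬ G.Adj s₃ z₃ := fun e =>
    h.P6_false (hF.sel [1, 0, 2] [2, 0, 1] (by decide) (by decide)) e21 e22 e13 e11 e
  refine h.step hF _ _ _ _ _ _ _ _ _ _ cert_C0 (Nat.zero_le _)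
    (And.intro e11 (And.intro e13 (And.intro e21 e22)))
    (And.intro N12 (And.intro N23 (And.intro N31 (And.intro N32 N33)))) ?_ ?_
    (And.intro h.no_W4 (And.intro h.no_W6 (And.intro h.no_P6 (And.intro h.no_SX
      (And.intro h.no_SY h.no_DBL))))) (by simp) ?_
  · intro x hxX hxf hx
    simp only [List.mem_cons, List.not_mem_nil, or_false, not_or] at hx
    have := h.SY_leaf hF e11 e13 e21 e22 hxX hxf hx.1 hx.2.1
    simp
    split_ifs <;> first | omega | tauto
  · intro y hyY hyf hy
    have hG := hF.consZ hyY hyf hy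
    simp only [List.mem_cons, List.not_mem_nil, or_false, not_or] at hy
    have a12 : G.Adj s₁ y → G.Adj s₂ y → False := fun u v =>
      h.no_four hC m1 m2 k1 ⟨hyY, hyf⟩ n12 (Ne.symm hy.1) e11 u e21 v
    have a13 : G.Adj s₁ y → G.Adj s₃ y → False := fun u v =>
      h.P6_false (hG.sel [1, 0, 2] [0, 1, 2] (by decide) (by decide)) e21 e22 u e11 v
    have a23 : G.Adj s₂ y → G.Adj s₃ y → False := fun u v =>
      h.P6_false (hG.sel [0, 1, 2] [0, 1, 3] (by decide) (by decide)) e11 e13 u e21 v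
    simp [row3]
    split_ifs <;> first | omega | tauto
  · intro i hi
    have := h.C0_long hF e11 e13 e21 e22 hi
    simp [row3]
    omega

theorem Ctx.no_C0 (h : Ctx G X Y S n r) : ¬ Has G S Y r pC0 :=
  not_has (by decide) fun _ _ _ _ _ _ _ hF ⟨e1, e2, e3, e4⟩ => h.C0_false hF e1 e2 e3 e4

end Path

/-- The edges `s₁z₁, s₁z₃, s₂z₂, s₃z₁` between `s₁, s₂, s₃` and `z₁, z₂, z₃`. -/
def pA : List (ℕ × ℕ) := [(0, 0), (0, 2), (1, 1), (2, 0)]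

theorem cert_A : scert [(1, 2), (2, 1)]
  [(0, 1), (1, 0), (1, 2), (2, 1), (2, 2)]
  pA 2 0 0 0 3
  [pW4, pW6, pP6, pSX, pSY, pDBL, pC0, pCY, pCP]
  [(31420, 41205, 2), (41320, 51204, 2), (31204, 51420, 2), (41203, 41520, 2), (43120, 41250, 6),
   (31420, 54102, 8), (31204, 41520, 2), (31420, 51204, 2), (32140, 54021, 2), (43021, 42150, 2),
   (43120, 51240, 6), (41320, 54102, 8), (42130, 54021, 2), (43021, 52140, 2)]
  [] = true := by decide +kernel

section LeafConnected

variable {V : Type*} [Fintype V] [DecidableEq V] {G : SimpleGraph V} [DecidableRel G.Adj]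
  {X Y S : Finset V} {n r : ℕ} {C : Fin r → Finset V}

theorem Ctx.A_leaf_long (h : Ctx G X Y S n r) {s₁ s₂ s₃ z₁ z₂ z₃ : V}
    (hF : Fr G S Y C [s₁, s₂, s₃] [z₁, z₂, z₃]) (e11 : G.Adj s₁ z₁) (e13 : G.Adj s₁ z₃)
    (e22 : G.Adj s₂ z₂) (e31 : G.Adj s₃ z₁) {i : Fin r} (hi : 3 ≤ (Y ∩ C i).card) :
    dg G s₂ (C i) + dg G z₃ (C i) + (dg G s₃ (C i) + dg G z₂ (C i)) ≤
      2 * (Y ∩ C i).card := by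
  have hC := hF.min
  obtain ⟨m1, m2, m3, k1, k2, k3, n12, n13, n23, l12, l13, l23⟩ := hF.facts
  by_contra hcon
  have q2 : ¬ (Y ∩ C i).card + 1 ≤ dg G s₂ (C i) + dg G z₂ (C i) := fun hs => by
    obtain ⟨t3, t4, t1, t2⟩ := h.tight hC hi m2 k2 e22 hs
    have := t1 _ m3 n23.symm
    have := t2 _ k3
    omega
  have hm := h.gamma hC hi m3 k3 m1 k1 n13.symm l13 e31 e11 e13 (by omega)
  obtain ⟨a, b, x, y₁, y₂, y₃, hH, f1, f2, fx, fa, g1, g2⟩ :=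
    h.exists_hex hC hm m3 k3 (by omega)
  have := h.dg_full hC hi m3 m2 n23.symm (by omega)
  have hF' := hF.sel [0, 1, 2] [0, 2, 1] (by decide) (by decide)
  rcases hH.adj_of_two_le h k2.1 (by omega) with e | e
  · exact h.hex_P6 hF' hm hH e11 e31 e13 fx f1 e22 e
  · exact h.hex_P6 hF' hm hH.symm e11 e31 e13 fx f2 e22 e

theorem Ctx.A_leaf_false (h : Ctx G X Y S n r) {s₁ s₂ s₃ z₁ z₂ z₃ : V}
    (hF : Fr G S Y C [s₁, s₂, s₃] [z₁, z₂, z₃]) (e11 : G.Adj s₁ z₁) (e13 : G.Adj s₁ z₃)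
    (e22 : G.Adj s₂ z₂) (e31 : G.Adj s₃ z₁)
    (hd : ∀ y ∈ Y, Free C y → y ≠ z₂ → ¬ G.Adj s₂ y) : False := by
  have hC := hF.min
  obtain ⟨m1, m2, m3, k1, k2, k3, n12, n13, n23, l12, l13, l23⟩ := hF.facts
  have N12 : ¬ G.Adj s₁ z₂ := fun e => h.SX_false
    (hF.sel [0, 1, 2] [0, 1, 2] (by decide) (by decide)) e11 e e13 e22 e31
  have N21 := hd z₁ k1.1 k1.2 l12
  have N23 := hd z₃ k3.1 k3.2 l23.symm
  have N32 : ¬ G.Adj s₃ z₂ := fun e => h.P6_false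
    (hF.sel [0, 2, 1] [1, 0, 2] (by decide) (by decide)) e11 e13 e e31 e22
  have N33 : ¬ G.Adj s₃ z₃ := fun e => h.no_four hC m1 m3 k1 k3 n13 l13 e11 e13 e31 e
  refine h.step hF _ _ _ _ _ _ _ _ _ _ cert_A (Nat.zero_le _)
    (And.intro e11 (And.intro e13 (And.intro e22 e31)))
    (And.intro N12 (And.intro N21 (And.intro N23 (And.intro N32 N33)))) ?_ ?_
    (And.intro h.no_W4 (And.intro h.no_W6 (And.intro h.no_P6 (And.intro h.no_SX
      (And.intro h.no_SY (And.intro h.no_DBL (And.intro h.no_C0 (And.intro h.no_CY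
        h.no_CP)))))))) (by simp) ?_
  · intro x hxX hxf hx
    simp
    split_ifs <;> omega
  · intro y hyY hyf hy
    have hG := hF.consZ hyY hyf hy
    simp only [List.mem_cons, List.not_mem_nil, or_false, not_or] at hy
    have h2 := hd y hyY hyf hy.2.1
    have h3 : ¬ G.Adj s₃ y := fun e => h.C0_false
      (hG.sel [0, 2, 1] [1, 0, 3] (by decide) (by decide)) e11 e13 e31 e
    simp [row3, h2, h3]
  · intro i hi
    have := h.A_leaf_long hF e11 e13 e22 e31 hi
    simp [row3]
    omega

end LeafConnected

theorem cert_I : scert [(0, 1), (1, 0)]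
  [(0, 1), (0, 3), (1, 0), (1, 2)]
  [(0, 0), (0, 2), (1, 1), (1, 3)] 1 1 0 0 4
  [pW4, pW6, pP6, pSX, pSY, pDBL, pC0, pCY, pCP]
  [(30241, 40351, 6), (40231, 50341, 6), (31240, 41250, 6), (41230, 51240, 6), (30241, 50341, 6),
   (40231, 40351, 6), (30241, 54301, 6), (40231, 54301, 6), (31240, 54210, 6), (41230, 54210, 6),
   (43210, 40215, 6), (43210, 50214, 6), (43210, 41035, 6), (43210, 51034, 6)]
  [[(0, 4), (0, 5), (1, 4), (1, 5), (3, 0)],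
   [(0, 4), (0, 5), (1, 4), (1, 5), (4, 0)],
   [(0, 4), (0, 5), (1, 4), (1, 5), (3, 1)],
   [(0, 4), (0, 5), (1, 4), (1, 5), (4, 1)]] = true := by decide +kernel
section Vees

variable {V : Type*} [Fintype V] [DecidableEq V] {G : SimpleGraph V} [DecidableRel G.Adj]
  {X Y S : Finset V} {n r : ℕ} {C : Fin r → Finset V}

theorem isCyc_list {l : List V} (v : V) (hl : 3 ≤ l.length) (hnd : l.Nodup)
    (hadj : ∀ i, i + 1 < l.length → G.Adj (l.getD i v) (l.getD (i + 1) v))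
    (hc : G.Adj (l.getD (l.length - 1) v) (l.getD 0 v)) : IsCyc G l.toFinset := by
  convert isCyc_image l.length (fun i => l.getD i v) hl hadj hc ?_ using 1
  · ext w
    simp only [List.mem_toFinset, mem_image, mem_range, List.mem_iff_getElem]
    constructor
    · rintro ⟨k, hk, rfl⟩
      exact ⟨k, hk, List.getD_eq_getElem _ _ hk⟩
    · rintro ⟨k, hk, rfl⟩
      exact ⟨k, hk, (List.getD_eq_getElem _ _ hk).symm⟩
  · intro i j hi hj he
    exact hnd.getElem_inj_iff.1
      ((List.getD_eq_getElem l v hi).symm.trans (he.trans (List.getD_eq_getElem l v hj)))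

theorem Ctx.common_false (h : Ctx G X Y S n r) {s₁ s₂ s₃ z₁ z₂ z₃ z₄ : V}
    (hF : Fr G S Y C [s₁, s₂, s₃] [z₁, z₂, z₃, z₄]) (e11 : G.Adj s₁ z₁) (e13 : G.Adj s₁ z₃)
    (e22 : G.Adj s₂ z₂) (e24 : G.Adj s₂ z₄) :
    (¬ G.Adj s₁ z₂ ∧ ¬ G.Adj s₁ z₄ ∧ ¬ G.Adj s₂ z₁ ∧ ¬ G.Adj s₂ z₃) ∧
      ∀ y ∈ Y, Free C y → G.Adj s₁ y → G.Adj s₂ y → False := by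
  have N : ¬ G.Adj s₁ z₂ ∧ ¬ G.Adj s₁ z₄ ∧ ¬ G.Adj s₂ z₁ ∧ ¬ G.Adj s₂ z₃ :=
    ⟨fun e => h.C0_false (hF.sel [0, 1, 2] [1, 3, 0] (by decide) (by decide)) e e11 e22 e24,
    fun e => h.C0_false (hF.sel [0, 1, 2] [3, 1, 0] (by decide) (by decide)) e e11 e24 e22,
    fun e => h.C0_false (hF.sel [0, 1, 2] [0, 1, 2] (by decide) (by decide)) e11 e13 e e22,
    fun e => h.C0_false (hF.sel [0, 1, 2] [2, 1, 0] (by decide) (by decide)) e13 e11 e e22⟩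
  refine ⟨N, fun y hY hf e1 e2 => ?_⟩
  by_cases hy : y ∈ [z₁, z₂, z₃, z₄]
  · simp only [List.mem_cons, List.not_mem_nil, or_false] at hy
    rcases hy with rfl | rfl | rfl | rfl
    exacts [N.2.2.1 e2, N.1 e1, N.2.2.2 e2, N.2.1 e1]
  · exact h.C0_false ((hF.consZ hY hf hy).sel [0, 1, 2] [0, 2, 1] (by decide) (by decide))
      e1 e11 e2 e22

theorem Ctx.exists_unique_common (h : Ctx G X Y S n r) {s₁ s₂ s₃ z₁ z₂ z₃ z₄ : V}
    (hF : Fr G S Y C [s₁, s₂, s₃] [z₁, z₂, z₃, z₄]) (e11 : G.Adj s₁ z₁) (e13 : G.Adj s₁ z₃)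
    (e22 : G.Adj s₂ z₂) (e24 : G.Adj s₂ z₄) :
    ∃ x₀, (x₀ ∈ X ∧ Free C x₀) ∧
      ((∀ x ∈ X, Free C x → G.Adj x z₁ → G.Adj x z₂ → x = x₀) ∨
        ∀ x ∈ X, Free C x → G.Adj x z₃ → G.Adj x z₄ → x = x₀) := by
  by_contra! hcon
  have hC := hF.min
  obtain ⟨⟨N12, N14, N21, N23⟩, -⟩ := h.common_false hF e11 e13 e22 e24
  obtain ⟨m1, m2, m3, k1, k2, k3, n12, n13, n23, l12, l13, l23⟩ :=
    (hF.sel [0, 1, 2] [0, 1, 2] (by decide) (by decide)).facts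
  have k4 := hF.memz z₄ (by simp)
  have hnd := hF.ndz
  simp only [List.nodup_cons, List.mem_cons, List.not_mem_nil, or_false, not_or] at hnd
  obtain ⟨⟨-, -, l14⟩, ⟨-, l24⟩, l34, -⟩ := hnd
  obtain ⟨⟨x, hx, fx, x1, x2, -⟩, -⟩ := hcon s₃ ⟨h.sub m3.1, m3.2⟩
  obtain ⟨-, ⟨x', hx', fx', x3, x4, hne⟩⟩ := hcon x ⟨hx, fx⟩
  have p1 : s₁ ≠ x := fun e => N12 (e ▸ x2)
  have p2 : s₂ ≠ x := fun e => N21 (e ▸ x1)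
  have p3 : s₁ ≠ x' := fun e => N14 (e ▸ x4)
  have p4 : s₂ ≠ x' := fun e => N23 (e ▸ x3)
  have hxS : x ∉ S := fun hs => h.C0_false
    (hC.fr m1 ⟨hs, fx⟩ m2 k1 k2 k3 p1 n12 p2.symm l12 l13 l23) e11 e13 x1 x2
  have hxS' : x' ∉ S := fun hs => h.C0_false
    (hC.fr m1 ⟨hs, fx'⟩ m2 k3 k4 k1 p3 n12 p4.symm l34 l13.symm (Ne.symm l14)) e13 e11 x3 x4
  have hxy : ∀ v ∈ X, v ≠ z₁ ∧ v ≠ z₂ ∧ v ≠ z₃ ∧ v ≠ z₄ := fun v hv =>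
    ⟨h.ne hv k1.1, h.ne hv k2.1, h.ne hv k3.1, h.ne hv k4.1⟩
  obtain ⟨a1, a2, a3, a4⟩ := hxy s₁ (h.sub m1.1)
  obtain ⟨b1, b2, b3, b4⟩ := hxy s₂ (h.sub m2.1)
  obtain ⟨c1, c2, c3, c4⟩ := hxy x hx
  obtain ⟨d1, d2, d3, d4⟩ := hxy x' hx'
  have hnd : [s₁, z₁, x, z₂, s₂, z₄, x', z₃].Nodup := by
    simp only [List.nodup_cons, List.mem_cons, List.not_mem_nil, or_false, not_or,
      not_false_eq_true, List.nodup_nil, and_true]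
    exact ⟨⟨a1, p1, a2, n12, a4, p3, a3⟩, ⟨c1.symm, l12, b1.symm, l14, d1.symm, l13⟩,
      ⟨c2, p2.symm, c4, hne.symm, c3⟩, ⟨b2.symm, l24, d2.symm, l23⟩, ⟨b4, p4, b3⟩,
      ⟨d4.symm, Ne.symm l34⟩, d3⟩
  have hcyc : IsCyc G [s₁, z₁, x, z₂, s₂, z₄, x', z₃].toFinset := by
    refine isCyc_list s₁ (by simp) hnd ?_ (by simp [e13.symm])
    intro i hi
    have : i < 7 := Nat.lt_of_succ_lt_succ hi
    interval_cases i <;> simp [e11, x1.symm, x2, e22.symm, e24, x4.symm, x3]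
  have hns : ∀ y ∈ Y, y ∉ S := fun y hy hs => h.not_mem_X.2 hy (h.sub hs)
  refine h.no_free_two hC.1 (A := {s₁, z₁, x, z₂, s₂, z₄, x', z₃})
    ⟨by simpa using hcyc, ?_⟩ ?_
  · have : S ∩ {s₁, z₁, x, z₂, s₂, z₄, x', z₃} = {s₁, s₂} := by
      ext v
      simp only [mem_inter, mem_insert, mem_singleton]
      constructor
      · rintro ⟨hv, rfl | rfl | rfl | rfl | rfl | rfl | rfl | rfl⟩
        exacts [Or.inl rfl, (hns _ k1.1 hv).elim, (hxS hv).elim, (hns _ k2.1 hv).elim, Or.inr rfl,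
          (hns _ k4.1 hv).elim, (hxS' hv).elim, (hns _ k3.1 hv).elim]
      · rintro (rfl | rfl)
        exacts [⟨m1.1, Or.inl rfl⟩, ⟨m2.1, by simp⟩]
    rw [this, card_pair n12]
  · intro v hv
    simp only [mem_insert, mem_singleton] at hv
    rcases hv with rfl | rfl | rfl | rfl | rfl | rfl | rfl | rfl
    exacts [m1.2, k1.2, fx, k2.2, m2.2, k4.2, fx', k3.2]

theorem Quad.free_of_update {i : Fin r} {a b p q u v : V} (hC : IsMin G S C) (h : Ctx G X Y S n r)
    (hQ : Quad G S Y C i a b p q) {y : V} (hy : y ∈ Y)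
    (hf : Free (Function.update C i {u, v, p, q}) y) : Free C y := by
  rw [hC.free_update] at hf
  simp only [mem_insert, mem_singleton, not_or] at hf
  obtain ⟨⟨-, -, h3, h4⟩, h5 | h5⟩ := hf
  · exact h5
  · rw [hQ.eq] at h5
    simp only [mem_insert, mem_singleton] at h5
    rcases h5 with rfl | rfl | rfl | rfl
    exacts [(h.not_mem_X.2 hy (h.sub hQ.ha)).elim, (h.not_mem_X.2 hy (h.sub hQ.hb)).elim,
      (h3 rfl).elim, (h4 rfl).elim]

theorem Ctx.two_vees (h : Ctx G X Y S n r) {s₁ s₂ s₃ z₁ z₂ z₃ z₄ x₀ : V}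
    (hF : Fr G S Y C [s₁, s₂, s₃] [z₁, z₂, z₃, z₄]) (e11 : G.Adj s₁ z₁) (e13 : G.Adj s₁ z₃)
    (e22 : G.Adj s₂ z₂) (e24 : G.Adj s₂ z₄) (hx₀ : x₀ ∈ X ∧ Free C x₀)
    (hun : ∀ x ∈ X, Free C x → G.Adj x z₁ → G.Adj x z₂ → x = x₀)
    (h₂ : ∀ (C' : Fin r → Finset V) (t : V), Fr G S Y C' [s₁, t, s₃] [z₁, z₂, z₃, z₄] →
      (∀ y ∈ Y, Free C' y → Free C y) → G.Adj t z₁ → False)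
    (h₁ : ∀ (C' : Fin r → Finset V) (t : V), Fr G S Y C' [t, s₂, s₃] [z₁, z₂, z₃, z₄] →
      (∀ y ∈ Y, Free C' y → Free C y) → G.Adj t z₂ → False) : False := by
  have hC := hF.min
  obtain ⟨⟨N12, N14, N21, N23⟩, hcom⟩ := h.common_false hF e11 e13 e22 e24
  obtain ⟨m1, m2, m3, k1, k2, k3, n12, n13, n23, l12, l13, l23⟩ :=
    (hF.sel [0, 1, 2] [0, 1, 2] (by decide) (by decide)).facts
  have k4 := hF.memz z₄ (by simp)
  have hnd := hF.ndz
  simp only [List.nodup_cons, List.mem_cons, List.not_mem_nil, or_false, not_or] at hnd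
  obtain ⟨⟨-, -, l14⟩, ⟨-, l24⟩, l34, -⟩ := hnd
  wlog hx : x₀ ≠ s₁ ∧ x₀ ≠ s₂ generalizing x₀
  · refine this (x₀ := s₃) ⟨h.sub m3.1, m3.2⟩ (fun x hxX hxf x1 x2 => ?_) ⟨n13.symm, n23.symm⟩
    have := hun x hxX hxf x1 x2
    subst this
    rw [not_and_or, not_not, not_not] at hx
    rcases hx with rfl | rfl
    exacts [(N12 x2).elim, (N21 x1).elim]
  have sx : ∀ x, ∑ j, (if G.Adj x (![z₂, z₁] j) then 1 else 0) =
      (if G.Adj x z₂ then 1 else 0) + if G.Adj x z₁ then 1 else 0 := fun x => Fin.sum_univ_two _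
  have sy : ∀ y, ∑ j, (if G.Adj (![s₁, s₂] j) y then 1 else 0) =
      (if G.Adj s₁ y then 1 else 0) + if G.Adj s₂ y then 1 else 0 := fun y => Fin.sum_univ_two _
  obtain ⟨i, hi⟩ := h.exists_heavy_of_bound hC.1 (K := 2) ![s₁, s₂] ![z₂, z₁]
    (by intro j; fin_cases j; exacts [m1.1, m2.1]) (by intro j; fin_cases j; exacts [k2.1, k1.1])
    (by intro j; fin_cases j; exacts [N12, N21]) {s₁, s₂, x₀} {z₁, z₂, z₃, z₄}
    (by intro v hv
        simp only [mem_insert, mem_singleton] at hv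
        rcases hv with rfl | rfl | rfl
        exacts [⟨h.sub m1.1, m1.2⟩, ⟨h.sub m2.1, m2.2⟩, hx₀])
    (by intro v hv
        simp only [mem_insert, mem_singleton] at hv
        rcases hv with rfl | rfl | rfl | rfl
        exacts [k1, k2, k3, k4])
    1 1 0 0 rfl (Nat.zero_le _)
    (by intro x hxX hxf hxP
        simp only [mem_insert, mem_singleton, not_or] at hxP
        have := hun x hxX hxf
        rw [sx]
        split_ifs with f1 f2 <;> first | omega | exact (hxP.2.2 (this f2 f1)).elim)
    (by intro y hyY hyf hyP
        have := hcom y hyY hyf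
        rw [sy]
        split_ifs <;> first | omega | tauto)
    (by have c1 : ({s₁, s₂, x₀} : Finset V).card = 3 :=
          card_eq_three.2 ⟨_, _, _, n12, hx.1.symm, hx.2.symm, rfl⟩
        have c2 : ({z₁, z₂, z₃, z₄} : Finset V).card = 4 := by
          rw [card_insert_of_notMem (by simp [l12, l13, l14])]
          rw [card_eq_three.2 ⟨_, _, _, l23, l24, l34, rfl⟩]
        rw [c1, c2, sum_insert (by simp [n12, hx.1.symm]), sum_insert (by simp [hx.2.symm]),
          sum_singleton, sum_insert (by simp [l12, l13, l14]), sum_insert (by simp [l23, l24]),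
          sum_insert (by simp [l34]), sum_singleton]
        simp only [sx, sy, N12, N14, N21, N23, if_false]
        split_ifs <;> omega)
  simp only [Fin.sum_univ_two, Matrix.cons_val_zero, Matrix.cons_val_one] at hi
  refine h.false_of_heavy hF _ _ _ _ _ _ _ _ _ _ cert_I
    (And.intro e11 (And.intro e13 (And.intro e22 e24)))
    (And.intro h.no_W4 (And.intro h.no_W6 (And.intro h.no_P6 (And.intro h.no_SX
      (And.intro h.no_SY (And.intro h.no_DBL (And.intro h.no_C0 (And.intro h.no_CY
        h.no_CP)))))))) ?_ ?_ (i := i) (by simpa [row3, add_assoc] using hi)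
  · intro j a b p q hQ l hl hP
    simp only [List.mem_cons, List.not_mem_nil, or_false] at hl
    rcases hl with rfl | rfl | rfl | rfl <;>
      simp only [List.forall_mem_cons, List.not_mem_nil, false_imp_iff, implies_true, and_true]
        at hP <;> obtain ⟨f1, f2, f3, f4, f5⟩ := hP
    · exact h₂ _ _ (h.quad_swap hF hQ 4 [0, 3, 2] [0, 1, 2, 3] (by simp) (by decide) (by decide)
        1 4 4 5 (by decide) (by decide) f3 f4 hQ.bp hQ.bq)
        (fun y hy hf => hQ.free_of_update hC h hy hf) f5
    · exact h₂ _ _ (h.quad_swap hF hQ 4 [0, 4, 2] [0, 1, 2, 3] (by simp) (by decide) (by decide)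
        1 3 4 5 (by decide) (by decide) f3 f4 hQ.ap hQ.aq)
        (fun y hy hf => hQ.free_of_update hC h hy hf) f5
    · exact h₁ _ _ (h.quad_swap hF hQ 4 [3, 1, 2] [0, 1, 2, 3] (by simp) (by decide) (by decide)
        0 4 4 5 (by decide) (by decide) f1 f2 hQ.bp hQ.bq)
        (fun y hy hf => hQ.free_of_update hC h hy hf) f5
    · exact h₁ _ _ (h.quad_swap hF hQ 4 [4, 1, 2] [0, 1, 2, 3] (by simp) (by decide) (by decide)
        0 3 4 5 (by decide) (by decide) f1 f2 hQ.ap hQ.aq)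
        (fun y hy hf => hQ.free_of_update hC h hy hf) f5
  · intro i hi
    have := h.two_pairs hC hi m1 k1 e11 m2 k2 e22 n12
    simp [row3]
    omega

end Vees

/-- The edges `s₁z₁, s₁z₂, s₂z₁` between `s₁, s₂, s₃` and `z₁, z₂, z₃`. -/
def pI1 : List (ℕ × ℕ) := [(0, 0), (0, 1), (1, 0)]

theorem cert_I1 : scert [(2, 2)]
  [(2, 2), (2, 0), (2, 1)]
  pI1 1 0 0 0 3
  [pW4, pW6, pP6, pSX, pSY, pDBL, pC0, pCY, pCP, pA]
  [(32140, 54120, 9), (42130, 54120, 9), (43120, 42150, 9), (43120, 52140, 9)]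
  [] = true := by decide +kernel

/-- The edges `s₁z₃, s₂z₂, s₃z₁` between `s₁, s₂, s₃` and `z₁, z₂, z₃`. -/
def pM3 : List (ℕ × ℕ) := [(0, 2), (1, 1), (2, 0)]

/-- The edges `s₁z₂, s₂z₁` between `s₁, s₂, s₃` and `z₁, z₂, z₃`. -/
def pM2 : List (ℕ × ℕ) := [(0, 1), (1, 0)]

/-- The edge `s₁z₁` between `s₁, s₂, s₃` and `z₁, z₂, z₃`. -/
def pe : List (ℕ × ℕ) := [(0, 0)]

theorem cert_M3 : scert [(0, 1), (1, 2)]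
  [(0, 0), (0, 1), (1, 0), (1, 2), (2, 1), (2, 2)]
  pM3 2 0 0 0 3
  [pW4, pW6, pP6, pSX, pSY, pDBL, pC0, pCY, pCP, pA, pI1]
  [(30421, 42105, 9), (40321, 52104, 9), (30124, 52401, 9), (40123, 42501, 9), (31420, 41205, 9),
   (31024, 51402, 9), (41023, 41502, 9), (41320, 51204, 9)]
  [] = true := by decide +kernel

theorem cert_M2 : scert [(2, 2)]
  [(2, 2), (2, 0)]
  pM2 1 0 0 0 3
  [pW4, pW6, pP6, pSX, pSY, pDBL, pC0, pCY, pCP, pA, pI1, pM3]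
  [(32410, 54102, 11), (42310, 54102, 11), (43210, 42105, 11), (43210, 52104, 11)]
  [] = true := by decide +kernel

theorem cert_e : scert [(1, 1)]
  [(1, 1), (2, 1), (1, 2)]
  pe 1 0 0 0 3
  [pW4, pW6, pP6, pSX, pSY, pDBL, pC0, pCY, pCP, pA, pI1, pM3, pM2]
  [(31240, 54201, 12), (41230, 54201, 12), (43210, 41205, 12), (43210, 51204, 12)]
  [] = true := by decide +kernel

theorem cert_0 : scert [(0, 0)]
  [(0, 0), (0, 1), (0, 2), (1, 0), (1, 1), (1, 2), (2, 0), (2, 1), (2, 2)]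
  [] 1 0 0 0 3
  [pW4, pW6, pP6, pSX, pSY, pDBL, pC0, pCY, pCP, pA, pI1, pM3, pM2, pe]
  [(30214, 54210, 13), (40213, 54210, 13), (43210, 40215, 13), (43210, 50214, 13)]
  [] = true := by decide +kernel

section Sparse

variable {V : Type*} [Fintype V] [DecidableEq V] {G : SimpleGraph V} [DecidableRel G.Adj]
  {X Y S : Finset V} {n r : ℕ} {C : Fin r → Finset V}

theorem Ctx.A_false (h : Ctx G X Y S n r) {s₁ s₂ s₃ z₁ z₂ z₃ : V}
    (hF : Fr G S Y C [s₁, s₂, s₃] [z₁, z₂, z₃]) (e11 : G.Adj s₁ z₁) (e13 : G.Adj s₁ z₃)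
    (e22 : G.Adj s₂ z₂) (e31 : G.Adj s₃ z₁) : False := by
  have hC := hF.min
  obtain ⟨m1, m2, m3, k1, k2, k3, n12, n13, n23, l12, l13, l23⟩ := hF.facts
  by_cases hd : ∀ y ∈ Y, Free C y → y ≠ z₂ → ¬ G.Adj s₂ y
  · exact h.A_leaf_false hF e11 e13 e22 e31 hd
  push Not at hd
  obtain ⟨y, hyY, hyf, hy2, e24⟩ := hd
  by_cases hy1 : y = z₁
  · subst hy1
    exact h.SY_false hF e11 e13 e24 e22 e31
  by_cases hy3 : y = z₃
  · subst hy3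
    exact h.P6_false (hF.sel [1, 0, 2] [0, 2, 1] (by decide) (by decide)) e24 e22 e11 e13 e31
  have hG := (hF.consZ hyY hyf (by simp [hy1, hy2, hy3])).sel [0, 1, 2] [1, 2, 3, 0]
    (by decide) (by decide)
  have hleaf : ∀ (C' : Fin r → Finset V), (∀ y ∈ Y, Free C' y → Free C y) →
      ∀ y ∈ Y, Free C' y → y ≠ z₁ → ¬ G.Adj s₃ y := by
    intro C' hC' y' hy' hf' hne e
    by_cases hy3 : y' = z₃
    · subst hy3
      exact h.no_four hC m1 m3 k1 k3 n13 l13 e11 e13 e31 e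
    · exact h.C0_false (hC.fr m1 m3 m2 k1 ⟨hy', hC' y' hy' hf'⟩ k3 n13 n12 n23.symm
        (Ne.symm hne) l13 hy3) e11 e13 e31 e
  obtain ⟨x₀, hx₀, hun | hun⟩ := h.exists_unique_common hG e11 e13 e22 e24
  · refine h.two_vees hG e11 e13 e22 e24 hx₀ hun ?_ ?_
    · exact fun C' t hF' _ e => h.CY_false
        (hF'.sel [0, 1, 2] [0, 2, 1] (by decide) (by decide)) e11 e13 e e31
    · exact fun C' t hF' hY e => h.A_leaf_false
        (hF'.sel [1, 2, 0] [1, 0, 3] (by decide) (by decide)) e22 e24 e31 e (hleaf C' hY)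
  · refine h.two_vees (hG.sel [0, 1, 2] [2, 3, 0, 1] (by decide) (by decide)) e13 e11 e24 e22
      hx₀ hun ?_ ?_
    · exact fun C' t hF' _ e => h.CP_false
        (hF'.sel [0, 1, 2] [2, 0, 1] (by decide) (by decide)) e11 e13 e e31
    · exact fun C' t hF' hY e => h.A_leaf_false
        (hF'.sel [1, 2, 0] [1, 2, 3] (by decide) (by decide)) e24 e22 e31 e (hleaf C' hY)

theorem Ctx.no_A (h : Ctx G X Y S n r) : ¬ Has G S Y r pA :=
  not_has (by decide) fun _ _ _ _ _ _ _ hF ⟨e1, e2, e3, e4⟩ => h.A_false hF e1 e2 e3 e4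

theorem Ctx.I1_false (h : Ctx G X Y S n r) {s₁ s₂ s₃ z₁ z₂ z₃ : V}
    (hF : Fr G S Y C [s₁, s₂, s₃] [z₁, z₂, z₃]) (e11 : G.Adj s₁ z₁) (e12 : G.Adj s₁ z₂)
    (e21 : G.Adj s₂ z₁) : False := by
  have N31 : ¬ G.Adj s₃ z₁ := fun e => h.CY_false hF e11 e12 e21 e
  have N32 : ¬ G.Adj s₃ z₂ := fun e => h.CP_false
    (hF.sel [0, 2, 1] [0, 1, 2] (by decide) (by decide)) e11 e12 e e21
  have key : ∀ (C' : Fin r → Finset V) (y : V), Fr G S Y C' [s₁, s₂, s₃] [z₁, z₂, y] →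
      ¬ G.Adj s₃ y := fun C' y hF' e => h.A_false
    (hF'.sel [0, 2, 1] [0, 2, 1] (by decide) (by decide)) e11 e12 e e21
  refine h.step hF _ _ _ _ _ _ _ _ _ _ cert_I1 (Nat.zero_le _)
    (And.intro e11 (And.intro e12 e21)) (And.intro (key C _ hF) (And.intro N31 N32)) ?_ ?_
    (And.intro h.no_W4 (And.intro h.no_W6 (And.intro h.no_P6 (And.intro h.no_SX
      (And.intro h.no_SY (And.intro h.no_DBL (And.intro h.no_C0 (And.intro h.no_CY
        (And.intro h.no_CP h.no_A))))))))) (by simp) ?_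
  · intro x hxX hxf hx
    simp
    split_ifs <;> omega
  · intro y hyY hyf hy
    have := key C y ((hF.consZ hyY hyf hy).sel [0, 1, 2] [1, 2, 0] (by decide) (by decide))
    simp [row3, this]
  · intro i hi
    have := h.beta_fr hF hi hF.facts.2.2.1 fun y C' hF' e => key C' y hF' e
    simp [row3]
    omega

theorem Ctx.no_I1 (h : Ctx G X Y S n r) : ¬ Has G S Y r pI1 :=
  not_has (by decide) fun _ _ _ _ _ _ _ hF ⟨e1, e2, e3⟩ => h.I1_false hF e1 e2 e3

theorem Ctx.exists_third_S (h : Ctx G X Y S n r) (hC : IsMin G S C) (u v : V) :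
    ∃ w, (w ∈ S ∧ Free C w) ∧ w ≠ u ∧ w ≠ v := by
  obtain ⟨-, h3, -⟩ := h.card_rest hC.1
  by_contra! hcon
  have : S ∩ rest C ⊆ {u, v} := fun w hw => by
    rw [mem_inter, mem_rest] at hw
    have := hcon w hw
    simp only [mem_insert, mem_singleton]
    tauto
  have := (card_le_card this).trans card_le_two
  omega

theorem Ctx.exists_third_Y (h : Ctx G X Y S n r) (hC : IsMin G S C) (u v : V) :
    ∃ w, (w ∈ Y ∧ Free C w) ∧ w ≠ u ∧ w ≠ v := by
  obtain ⟨-, -, h3, -⟩ := h.card_rest hC.1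
  by_contra! hcon
  have : Y ∩ rest C ⊆ {u, v} := fun w hw => by
    rw [mem_inter, mem_rest] at hw
    have := hcon w hw
    simp only [mem_insert, mem_singleton]
    tauto
  have := (card_le_card this).trans card_le_two
  omega

theorem Ctx.two_branching (h : Ctx G X Y S n r) (hC : IsMin G S C) {s t u u' v v' : V}
    (hs : s ∈ S ∧ Free C s) (ht : t ∈ S ∧ Free C t) (hst : s ≠ t) (hu : u ∈ Y ∧ Free C u)
    (hu' : u' ∈ Y ∧ Free C u') (huu : u ≠ u') (hv : v ∈ Y ∧ Free C v) (hv' : v' ∈ Y ∧ Free C v')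
    (hvv : v ≠ v') (e1 : G.Adj s u) (e2 : G.Adj s u') (e3 : G.Adj t v) (e4 : G.Adj t v') :
    False := by
  obtain ⟨w, hw, hws, hwt⟩ := h.exists_third_S hC s t
  obtain ⟨z, hz, hzu, hzu'⟩ := h.exists_third_Y hC u u'
  have N1 : ¬ G.Adj t u := fun e => h.I1_false (hC.fr hs ht hw hu hu' hz hst hws.symm hwt.symm huu
    hzu.symm hzu'.symm) e1 e2 e
  have N2 : ¬ G.Adj t u' := fun e => h.I1_false (hC.fr hs ht hw hu' hu hz hst hws.symm hwt.symm
    huu.symm hzu'.symm hzu.symm) e2 e1 e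
  have a1 : u ≠ v := fun e => N1 (e ▸ e3)
  have a2 : u ≠ v' := fun e => N1 (e ▸ e4)
  have a3 : u' ≠ v := fun e => N2 (e ▸ e3)
  have a4 : u' ≠ v' := fun e => N2 (e ▸ e4)
  have hF := (hC.fr hs ht hw hv hu' hv' hst hws.symm hwt.symm a3.symm hvv a4).consZ hu.1 hu.2
    (by simp [a1, a2, huu])
  have key : ∀ {z₁ z₂ z₃ z₄ x₀ : V}, Fr G S Y C [s, t, w] [z₁, z₂, z₃, z₄] → G.Adj s z₁ →
      G.Adj s z₃ → G.Adj t z₂ → G.Adj t z₄ → (x₀ ∈ X ∧ Free C x₀) →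
      (∀ x ∈ X, Free C x → G.Adj x z₁ → G.Adj x z₂ → x = x₀) → False :=
    fun hG e11 e13 e22 e24 hx₀ hun => h.two_vees hG e11 e13 e22 e24 hx₀ hun
      (fun C' t hF' _ e => h.I1_false
        (hF'.sel [0, 1, 2] [0, 2, 1] (by decide) (by decide)) e11 e13 e)
      (fun C' t hF' _ e => h.I1_false
        (hF'.sel [1, 0, 2] [1, 3, 0] (by decide) (by decide)) e22 e24 e)
  obtain ⟨x₀, hx₀, hun | hun⟩ := h.exists_unique_common hF e1 e2 e3 e4
  · exact key hF e1 e2 e3 e4 hx₀ hun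
  · exact key (hF.sel [0, 1, 2] [2, 3, 0, 1] (by decide) (by decide)) e2 e1 e4 e3 hx₀ hun

theorem Ctx.M3_core (h : Ctx G X Y S n r) {s₁ s₂ s₃ z₁ z₂ z₃ : V}
    (hF : Fr G S Y C [s₁, s₂, s₃] [z₁, z₂, z₃]) (e13 : G.Adj s₁ z₃) (e22 : G.Adj s₂ z₂)
    (e31 : G.Adj s₃ z₁) (d1 : ∀ y ∈ Y, Free C y → y ≠ z₃ → ¬ G.Adj s₁ y)
    (d2 : ∀ y ∈ Y, Free C y → y ≠ z₂ → ¬ G.Adj s₂ y) : False := by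
  obtain ⟨m1, m2, m3, k1, k2, k3, n12, n13, n23, l12, l13, l23⟩ := hF.facts
  have N32 : ¬ G.Adj s₃ z₂ := fun e => h.I1_false
    (hF.sel [2, 1, 0] [1, 0, 2] (by decide) (by decide)) e e31 e22
  have N33 : ¬ G.Adj s₃ z₃ := fun e => h.I1_false
    (hF.sel [2, 0, 1] [2, 0, 1] (by decide) (by decide)) e e31 e13
  refine h.step hF _ _ _ _ _ _ _ _ _ _ cert_M3 (Nat.zero_le _)
    (And.intro e13 (And.intro e22 e31)) (And.intro (d1 _ k1.1 k1.2 l13) (And.intro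
      (d1 _ k2.1 k2.2 l23) (And.intro (d2 _ k1.1 k1.2 l12) (And.intro (d2 _ k3.1 k3.2 l23.symm)
        (And.intro N32 N33))))) ?_ ?_
    (And.intro h.no_W4 (And.intro h.no_W6 (And.intro h.no_P6 (And.intro h.no_SX
      (And.intro h.no_SY (And.intro h.no_DBL (And.intro h.no_C0 (And.intro h.no_CY
        (And.intro h.no_CP (And.intro h.no_A h.no_I1)))))))))) (by simp) ?_
  · intro x hxX hxf hx
    simp
    split_ifs <;> omega
  · intro y hyY hyf hy
    simp only [List.mem_cons, List.not_mem_nil, or_false, not_or] at hy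
    simp [row3, d1 y hyY hyf hy.2.2, d2 y hyY hyf hy.2.1]
  · intro i hi
    have := h.two_pairs hF.min hi m1 k3 e13 m2 k2 e22 n12
    simp [row3]
    omega

theorem Ctx.M3_false (h : Ctx G X Y S n r) {s₁ s₂ s₃ z₁ z₂ z₃ : V}
    (hF : Fr G S Y C [s₁, s₂, s₃] [z₁, z₂, z₃]) (e13 : G.Adj s₁ z₃) (e22 : G.Adj s₂ z₂)
    (e31 : G.Adj s₃ z₁) : False := by
  have hC := hF.min
  obtain ⟨m1, m2, m3, k1, k2, k3, n12, n13, n23, l12, l13, l23⟩ := hF.facts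
  have key : ∀ {s t z w : V}, s ∈ S ∧ Free C s → t ∈ S ∧ Free C t → s ≠ t → z ∈ Y ∧ Free C z →
      w ∈ Y ∧ Free C w → G.Adj s z → G.Adj t w →
      (¬ ∀ y ∈ Y, Free C y → y ≠ z → ¬ G.Adj s y) →
      ∀ y ∈ Y, Free C y → y ≠ w → ¬ G.Adj t y := by
    intro s t z w hs ht hst hz hw e1 e2 hd y hy hyf hyw e3
    push Not at hd
    obtain ⟨y', hy', hyf', hyz, e4⟩ := hd
    exact h.two_branching hC hs ht hst hz ⟨hy', hyf'⟩ (Ne.symm hyz) hw ⟨hy, hyf⟩ (Ne.symm hyw)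
      e1 e4 e2 e3
  by_cases d1 : ∀ y ∈ Y, Free C y → y ≠ z₃ → ¬ G.Adj s₁ y
  · by_cases d2 : ∀ y ∈ Y, Free C y → y ≠ z₂ → ¬ G.Adj s₂ y
    · exact h.M3_core hF e13 e22 e31 d1 d2
    · exact h.M3_core (hF.sel [0, 2, 1] [1, 0, 2] (by decide) (by decide)) e13 e31 e22 d1
        (key m2 m3 n23 k2 k1 e22 e31 d2)
  · exact h.M3_core (hF.sel [1, 2, 0] [2, 0, 1] (by decide) (by decide)) e22 e31 e13
      (key m1 m2 n12 k3 k2 e13 e22 d1) (key m1 m3 n13 k3 k1 e13 e31 d1)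

theorem Ctx.no_M3 (h : Ctx G X Y S n r) : ¬ Has G S Y r pM3 :=
  not_has (by decide) fun _ _ _ _ _ _ _ hF ⟨e1, e2, e3⟩ => h.M3_false hF e1 e2 e3

theorem Ctx.M2_core (h : Ctx G X Y S n r) {s₁ s₂ s₃ z₁ z₂ z₃ : V}
    (hF : Fr G S Y C [s₁, s₂, s₃] [z₁, z₂, z₃]) (e12 : G.Adj s₁ z₂) (e21 : G.Adj s₂ z₁)
    (N31 : ¬ G.Adj s₃ z₁) : False := by
  have key : ∀ (C' : Fin r → Finset V) (y : V), Fr G S Y C' [s₁, s₂, s₃] [z₁, z₂, y] →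
      ¬ G.Adj s₃ y := fun C' y hF' e => h.M3_false
    (hF'.sel [2, 0, 1] [0, 1, 2] (by decide) (by decide)) e e12 e21
  refine h.step hF _ _ _ _ _ _ _ _ _ _ cert_M2 (Nat.zero_le _)
    (And.intro e12 e21) (And.intro (key C _ hF) N31) ?_ ?_
    (And.intro h.no_W4 (And.intro h.no_W6 (And.intro h.no_P6 (And.intro h.no_SX
      (And.intro h.no_SY (And.intro h.no_DBL (And.intro h.no_C0 (And.intro h.no_CY
        (And.intro h.no_CP (And.intro h.no_A (And.intro h.no_I1 h.no_M3))))))))))) (by simp) ?_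
  · intro x hxX hxf hx
    simp
    split_ifs <;> omega
  · intro y hyY hyf hy
    have := key C y ((hF.consZ hyY hyf hy).sel [0, 1, 2] [1, 2, 0] (by decide) (by decide))
    simp [row3, this]
  · intro i hi
    have := h.beta_fr hF hi hF.facts.2.2.1 fun y C' hF' e => key C' y hF' e
    simp [row3]
    omega

theorem Ctx.M2_false (h : Ctx G X Y S n r) {s₁ s₂ s₃ z₁ z₂ z₃ : V}
    (hF : Fr G S Y C [s₁, s₂, s₃] [z₁, z₂, z₃]) (e12 : G.Adj s₁ z₂) (e21 : G.Adj s₂ z₁) :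
    False := by
  by_cases N31 : G.Adj s₃ z₁
  · refine h.M2_core (hF.sel [1, 0, 2] [1, 0, 2] (by decide) (by decide)) e21 e12 fun N32 => ?_
    exact h.I1_false (hF.sel [2, 1, 0] [0, 1, 2] (by decide) (by decide)) N31 N32 e21
  · exact h.M2_core hF e12 e21 N31

theorem Ctx.no_M2 (h : Ctx G X Y S n r) : ¬ Has G S Y r pM2 :=
  not_has (by decide) fun _ _ _ _ _ _ _ hF ⟨e1, e2⟩ => h.M2_false hF e1 e2

theorem Ctx.edge_false (h : Ctx G X Y S n r) {s₁ s₂ s₃ z₁ z₂ z₃ : V}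
    (hF : Fr G S Y C [s₁, s₂, s₃] [z₁, z₂, z₃]) (e11 : G.Adj s₁ z₁) : False := by
  have key : ∀ (C' : Fin r → Finset V) (z y : V), Fr G S Y C' [s₁, s₂, s₃] [z₁, z, y] →
      ¬ G.Adj s₂ y := fun C' z y hF' e => h.M2_false
    (hF'.sel [1, 0, 2] [0, 2, 1] (by decide) (by decide)) e e11
  have hF' := hF.sel [0, 1, 2] [0, 2, 1] (by decide) (by decide)
  have N32 : ¬ G.Adj s₃ z₂ := fun e => h.M2_false
    (hF.sel [2, 0, 1] [0, 1, 2] (by decide) (by decide)) e e11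
  refine h.step hF _ _ _ _ _ _ _ _ _ _ cert_e (Nat.zero_le _)
    e11 (And.intro (key C _ _ hF') (And.intro N32 (key C _ _ hF))) ?_ ?_
    (And.intro h.no_W4 (And.intro h.no_W6 (And.intro h.no_P6 (And.intro h.no_SX
      (And.intro h.no_SY (And.intro h.no_DBL (And.intro h.no_C0 (And.intro h.no_CY
        (And.intro h.no_CP (And.intro h.no_A (And.intro h.no_I1 (And.intro h.no_M3
          h.no_M2)))))))))))) (by simp) ?_
  · intro x hxX hxf hx
    simp
    split_ifs <;> omega
  · intro y hyY hyf hy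
    have := key C z₂ y ((hF.consZ hyY hyf hy).sel [0, 1, 2] [1, 2, 0] (by decide) (by decide))
    simp [row3, this]
  · intro i hi
    have := h.beta_fr hF' hi hF.facts.2.1 fun y C' hG e => key C' z₃ y hG e
    simp [row3]
    omega

theorem Ctx.no_edge (h : Ctx G X Y S n r) : ¬ Has G S Y r pe :=
  not_has (by decide) fun _ _ _ _ _ _ _ hF e => h.edge_false hF e

theorem Ctx.frame_false (h : Ctx G X Y S n r) {s₁ s₂ s₃ z₁ z₂ z₃ : V}
    (hF : Fr G S Y C [s₁, s₂, s₃] [z₁, z₂, z₃]) : False := by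
  have hF' := hF.sel [0, 1, 2] [1, 2, 0] (by decide) (by decide)
  refine h.step hF _ _ _ _ _ _ _ _ _ _ cert_0 (Nat.zero_le _) trivial
    (And.intro (fun e => h.edge_false (hF.sel [0, 1, 2] [0, 1, 2] (by decide) (by decide)) e)
    (And.intro (fun e => h.edge_false (hF.sel [0, 1, 2] [1, 0, 2] (by decide) (by decide)) e)
    (And.intro (fun e => h.edge_false (hF.sel [0, 1, 2] [2, 0, 1] (by decide) (by decide)) e)
    (And.intro (fun e => h.edge_false (hF.sel [1, 0, 2] [0, 1, 2] (by decide) (by decide)) e)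
    (And.intro (fun e => h.edge_false (hF.sel [1, 0, 2] [1, 0, 2] (by decide) (by decide)) e)
    (And.intro (fun e => h.edge_false (hF.sel [1, 0, 2] [2, 0, 1] (by decide) (by decide)) e)
    (And.intro (fun e => h.edge_false (hF.sel [2, 0, 1] [0, 1, 2] (by decide) (by decide)) e)
    (And.intro (fun e => h.edge_false (hF.sel [2, 0, 1] [1, 0, 2] (by decide) (by decide)) e)
      (fun e => h.edge_false (hF.sel [2, 0, 1] [2, 0, 1] (by decide) (by decide)) e)))))))))
    ?_ ?_
    (And.intro h.no_W4 (And.intro h.no_W6 (And.intro h.no_P6 (And.intro h.no_SX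
      (And.intro h.no_SY (And.intro h.no_DBL (And.intro h.no_C0 (And.intro h.no_CY
        (And.intro h.no_CP (And.intro h.no_A (And.intro h.no_I1 (And.intro h.no_M3
          (And.intro h.no_M2 h.no_edge))))))))))))) (by simp) ?_
  · intro x hxX hxf hx
    simp
    split_ifs <;> omega
  · intro y hyY hyf hy
    have : ¬ G.Adj s₁ y := fun e => h.edge_false
      ((hF.consZ hyY hyf hy).sel [0, 1, 2] [0, 1, 2] (by decide) (by decide)) e
    simp [row3, this]
  · intro i hi
    have := h.beta_fr hF' hi hF.facts.1 fun y C' hG e => h.edge_false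
      (hG.sel [0, 1, 2] [2, 0, 1] (by decide) (by decide)) e
    simp [row3]
    omega

theorem Ctx.not_isMin (h : Ctx G X Y S n r) (hC : IsMin G S C) : False := by
  obtain ⟨-, h1, h2, -⟩ := h.card_rest hC.1
  obtain ⟨s₁, m1, s₂, m2, s₃, m3, n12, n13, n23⟩ := two_lt_card.1 h1
  obtain ⟨z₁, k1, z₂, k2, z₃, k3, l12, l13, l23⟩ := two_lt_card.1 h2
  simp only [mem_inter, mem_rest] at m1 m2 m3 k1 k2 k3
  exact h.frame_false (hC.fr m1 m2 m3 k1 k2 k3 n12 n13 n23 l12 l13 l23)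

end Sparse

section Main

variable {V : Type*}

theorem IsConf.exists_isMin [DecidableEq V] {G : SimpleGraph V} {S : Finset V} {r : ℕ}
    {C : Fin r → Finset V} (h : IsConf G S C) : ∃ C' : Fin r → Finset V, IsMin G S C' := by
  classical
  have hex : ∃ m, ∃ C' : Fin r → Finset V, IsConf G S C' ∧ ∑ i, (C' i).card = m := ⟨_, C, h, rfl⟩
  obtain ⟨C', hC', e⟩ := Nat.find_spec hex
  exact ⟨C', hC', fun D hD => e.trans_le (Nat.find_min' hex ⟨D, hD, rfl⟩)⟩

theorem goal_of_card [Fintype V] [DecidableEq V] {G : SimpleGraph V} [DecidableRel G.Adj]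
    {X Y S : Finset V} {n : ℕ} (hdisj : Disjoint X Y) (hcover : X ∪ Y = univ) (hX : X.card = n)
    (hY : Y.card = n) (hbip : ∀ u v : V, G.Adj u v → (u ∈ X ∧ v ∈ Y) ∨ (u ∈ Y ∧ v ∈ X))
    (hSX : S ⊆ X)
    (hdeg : ∀ x ∈ S, ∀ y ∈ Y, ¬ G.Adj x y → n + 1 ≤ G.degree x + G.degree y) (k : ℕ)
    (hk : 2 * k + 1 ≤ S.card) : Goal G S k := by
  induction k with
  | zero =>
    exact ⟨Fin.elim0, fun i => i.elim0, fun i => i.elim0, fun i => i.elim0, .inr fun i => i.elim0⟩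
  | succ k ih =>
    obtain ⟨C, hC, hcyc, -, ⟨-, hS⟩ | htwo⟩ := ih (by omega)
    · omega
    · obtain ⟨D, hD⟩ := IsConf.exists_isMin (G := G) (S := S) ⟨hC, fun i => ⟨hcyc i, htwo i⟩⟩
      by_contra hgoal
      exact Ctx.not_isMin (n := n) (X := X) (Y := Y)
        ⟨hdisj, hcover, hX, hY, hbip, hSX, by omega, hdeg, hgoal⟩ hD

theorem exists_walk_support {G : SimpleGraph V} {c : ℕ → V} (h : ∀ i, G.Adj (c i) (c (i + 1)))
    (m : ℕ) : ∃ w : G.Walk (c 0) (c m), w.support = (List.range (m + 1)).map c := by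
  induction m with
  | zero => exact ⟨.nil, rfl⟩
  | succ m ih =>
    obtain ⟨w, hw⟩ := ih
    exact ⟨w.concat (h m), by
      rw [SimpleGraph.Walk.support_concat, hw, List.range_succ (n := m + 1)]; simp⟩

theorem CycParam.exists_isCycle [DecidableEq V] {G : SimpleGraph V} {c : ℕ → V} {L : ℕ}
    (h : CycParam G c L) :
    ∃ w : G.Walk (c (L - 1)) (c (L - 1)), w.IsCycle ∧ w.support.toFinset = (range L).image c := by
  have h3 := h.three_le
  obtain ⟨w, hw⟩ := exists_walk_support h.adj (L - 1)
  rw [Nat.sub_add_cancel (by omega)] at hw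
  have hadj : G.Adj (c (L - 1)) (c 0) := by
    have h1 := h.adj (L - 1)
    have h2 := h.per 0
    rw [Nat.sub_add_cancel (by omega)] at h1
    rw [zero_add] at h2
    rwa [h2] at h1
  have hpath : w.IsPath := by
    rw [SimpleGraph.Walk.isPath_def, hw]
    exact List.Nodup.map_on (fun i hi j hj e => h.inj i j (List.mem_range.1 hi)
      (List.mem_range.1 hj) e) List.nodup_range
  refine ⟨.cons hadj w, ?_, ?_⟩
  · rw [SimpleGraph.Walk.cons_isCycle_iff]
    refine ⟨hpath, fun hmem => ?_⟩
    have hlen := hpath.length_eq_one_of_mem_edges (Sym2.eq_swap ▸ hmem)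
    have h2 := w.length_support
    rw [hw, hlen, List.length_map, List.length_range] at h2
    omega
  · ext v
    simp only [SimpleGraph.Walk.support_cons, hw, List.mem_toFinset, List.mem_cons, List.mem_map,
      List.mem_range, mem_image, mem_range]
    constructor
    · rintro (rfl | h)
      · exact ⟨L - 1, by omega, rfl⟩
      · exact h
    · exact .inr

end Main

end FeasibleCycles

/-- Theorem 1.4 ('moreover' part): if G[X,Y] is a balanced bipartite graph of
order 2n, S ⊆ X with |S| ≥ 2k+1 and σ₁,₁(S) ≥ n+1, then G contains k disjoint
feasible cycles such that either they cover all vertices of G, or each cycle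
contains exactly two vertices of S. -/
theorem bipartite_S_k_feasible_strong {V : Type*} [Fintype V] [DecidableEq V]
    (G : SimpleGraph V) [DecidableRel G.Adj]
    (X Y S : Finset V) (n k : ℕ) (hk : 0 < k)
    (hdisj : Disjoint X Y) (hcover : X ∪ Y = Finset.univ)
    (hX : X.card = n) (hY : Y.card = n)
    (hbip : ∀ u v : V, G.Adj u v → (u ∈ X ∧ v ∈ Y) ∨ (u ∈ Y ∧ v ∈ X))
    (hSX : S ⊆ X) (hScard : 2 * k + 1 ≤ S.card)
    (hdeg : ∀ x ∈ S, ∀ y ∈ Y, ¬ G.Adj x y → n + 1 ≤ G.degree x + G.degree y) :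
    ∃ (v : Fin k → V) (c : ∀ i, G.Walk (v i) (v i)),
      (∀ i, (c i).IsCycle) ∧
      (∀ i j, i ≠ j → Disjoint (c i).support.toFinset (c j).support.toFinset) ∧
      (∀ i, 2 ≤ (S ∩ (c i).support.toFinset).card) ∧
      ((∀ u : V, ∃ i, u ∈ (c i).support) ∨
        (∀ i, (S ∩ (c i).support.toFinset).card = 2)) := by
  obtain ⟨C, hC, hcyc, htwo, hor⟩ :=
    FeasibleCycles.goal_of_card hdisj hcover hX hY hbip hSX hdeg k hScard
  have hw : ∀ i, ∃ v, ∃ w : G.Walk v v, w.IsCycle ∧ w.support.toFinset = C i := by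
    intro i
    obtain ⟨L, c, hc, e⟩ := hcyc i
    obtain ⟨w, hw, hs⟩ := hc.exists_isCycle
    exact ⟨_, w, hw, hs.trans e.symm⟩
  choose v c hc hs using hw
  refine ⟨v, c, hc, ?_, ?_, ?_⟩
  · simpa only [hs] using hC
  · simpa only [hs] using htwo
  · simp only [← List.mem_toFinset, hs]
    exact hor.imp_left And.left
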